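/- arXiv:1608.04184 — 2 statements merged into one kernel-verified Lean document; each statement's English description precedes it below -/
import Mathlib

section
/- Let H_0 be a self-adjoint operator on a separable complex Hilbert space ℋ, let F : ℋ → 𝒦 be an H_0-Hilbert-Schmidt rigging operator, let V = F*JF with J ∈ ℬ_sa(𝒦), and let H_r = H_0 + rV. Let λ be an essentially regular point of the path {H_r}, i.e. λ ∈ Λ(H_s, F) for some real s, and let r_λ ∈ R(λ; H_0, V) be a resonance point. Then for all sufficiently small y > 0 the resonance index satisfies ind_res(λ; H_{r_λ}, V) = Tr((1/π) ∮_{C_+(r_λ)} J Im T_{λ+iy}(H_r) dr), where C_+(r_λ) is the upper semicircle of a small circle centred at r_λ enclosing exactly the resonance points of the r_λ-group. -/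
open MeasureTheory Filter Complex Set Topology
open scoped InnerProductSpace ComplexInnerProductSpace ENNReal Topology Real
set_option autoImplicit false

noncomputable section

namespace SSF

variable {𝓗 : Type*} {𝓚 : Type*}

section TraceClass

variable [NormedAddCommGroup 𝓗] [InnerProductSpace ℂ 𝓗]
variable [NormedAddCommGroup 𝓚] [InnerProductSpace ℂ 𝓚]

/-- A bounded operator `T` on a Hilbert space is trace class iff the sums
`∑ |⟪e i, T (f i)⟫|` over finite orthonormal families `e,f` are uniformly bounded. -/
def IsTraceClass (T : 𝓗 →L[ℂ] 𝓗) : Prop :=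
  ∃ C : ℝ, ∀ (n : ℕ) (e f : Fin n → 𝓗), Orthonormal ℂ e → Orthonormal ℂ f →
    ∑ i, ‖⟪e i, T (f i)⟫_ℂ‖ ≤ C

/-- The trace norm of a bounded operator: the supremum of `∑ |⟪e i, T (f i)⟫|` over
finite orthonormal families `e,f`. -/
def traceNorm (T : 𝓗 →L[ℂ] 𝓗) : ℝ :=
  sSup {c : ℝ | ∃ (n : ℕ) (e f : Fin n → 𝓗), Orthonormal ℂ e ∧ Orthonormal ℂ f ∧
    c = ∑ i, ‖⟪e i, T (f i)⟫_ℂ‖}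

/-- The trace of a bounded operator, computed in a Hilbert basis (meaningful for
trace class operators). -/
def trace [CompleteSpace 𝓗] (T : 𝓗 →L[ℂ] 𝓗) : ℂ :=
  ∑' i : (exists_hilbertBasis ℂ 𝓗).choose, ⟪(i : 𝓗), T (i : 𝓗)⟫_ℂ

/-- A bounded operator between Hilbert spaces is Hilbert-Schmidt iff the sums
`∑ ‖T (e i)‖ ^ 2` over finite orthonormal families are uniformly bounded. -/
def IsHilbertSchmidt (T : 𝓗 →L[ℂ] 𝓚) : Prop :=
  ∃ C : ℝ, ∀ (n : ℕ) (e : Fin n → 𝓗), Orthonormal ℂ e → ∑ i, ‖T (e i)‖ ^ 2 ≤ C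

end TraceClass

variable [NormedAddCommGroup 𝓗] [InnerProductSpace ℂ 𝓗] [CompleteSpace 𝓗]
variable [NormedAddCommGroup 𝓚] [InnerProductSpace ℂ 𝓚] [CompleteSpace 𝓚]

/-- A (possibly unbounded) self-adjoint operator on a Hilbert space, bundled together
with its resolvent `R_z = (H - z)⁻¹` at every nonreal `z`. -/
structure SelfAdjointOperator (𝓗 : Type*) [NormedAddCommGroup 𝓗]
    [InnerProductSpace ℂ 𝓗] [CompleteSpace 𝓗] where
  domain : Submodule ℂ 𝓗
  dense_domain : Dense (domain : Set 𝓗)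
  op : domain →ₗ[ℂ] 𝓗
  symmetric : ∀ f g : domain, ⟪op f, (g : 𝓗)⟫_ℂ = ⟪(f : 𝓗), op g⟫_ℂ
  resolvent : ℂ → (𝓗 →L[ℂ] 𝓗)
  resolvent_mem : ∀ z : ℂ, z.im ≠ 0 → ∀ f : 𝓗, resolvent z f ∈ domain
  resolvent_right : ∀ (z : ℂ) (hz : z.im ≠ 0) (f : 𝓗),
    op ⟨resolvent z f, resolvent_mem z hz f⟩ - z • resolvent z f = f
  resolvent_left : ∀ (z : ℂ), z.im ≠ 0 → ∀ g : domain,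
    resolvent z (op g - z • (g : 𝓗)) = (g : 𝓗)

/-- `IsSum H0 V H1` encodes the relation `H1 = H0 + V` for a bounded perturbation `V`,
via the second resolvent identity (which characterises it uniquely). -/
def IsSum (H0 : SelfAdjointOperator 𝓗) (V : 𝓗 →L[ℂ] 𝓗)
    (H1 : SelfAdjointOperator 𝓗) : Prop :=
  ∀ z : ℂ, z.im ≠ 0 →
    H1.resolvent z - H0.resolvent z = -(H1.resolvent z ∘L (V ∘L H0.resolvent z))

/-- Two self-adjoint operators are resolvent comparable if the difference of their
resolvents at some (hence any) nonreal point is trace class. -/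
def ResolventComparable (H0 H1 : SelfAdjointOperator 𝓗) : Prop :=
  ∃ z : ℂ, z.im ≠ 0 ∧ IsTraceClass (H1.resolvent z - H0.resolvent z)

/-- The spectral measure of a self-adjoint operator `H`, bundled with the associated
scalar spectral measures, the Borel functional calculus, and the decomposition into
absolutely continuous and singular parts. -/
structure SpectralMeasure (H : SelfAdjointOperator 𝓗) where
  proj : Set ℝ → (𝓗 →L[ℂ] 𝓗)
  proj_sa : ∀ s, IsSelfAdjoint (proj s)
  proj_mul : ∀ s t, proj (s ∩ t) = proj s ∘L proj t
  proj_univ : proj Set.univ = 1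
  scalar : 𝓗 → Measure ℝ
  scalar_finite : ∀ f, IsFiniteMeasure (scalar f)
  scalar_spec : ∀ (f : 𝓗) (s : Set ℝ), MeasurableSet s →
    (scalar f s).toReal = (⟪f, proj s f⟫_ℂ).re
  resolvent_spec : ∀ (z : ℂ), z.im ≠ 0 → ∀ f : 𝓗,
    ⟪f, H.resolvent z f⟫_ℂ = ∫ x : ℝ, ((x : ℂ) - z)⁻¹ ∂(scalar f)
  fc : (ℝ → ℂ) → (𝓗 →L[ℂ] 𝓗)
  fc_spec : ∀ (φ : ℝ → ℂ), Measurable φ → (∃ C, ∀ x, ‖φ x‖ ≤ C) →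
    ∀ f : 𝓗, ⟪f, fc φ f⟫_ℂ = ∫ x : ℝ, φ x ∂(scalar f)
  acProj : Set ℝ → (𝓗 →L[ℂ] 𝓗)
  sProj : Set ℝ → (𝓗 →L[ℂ] 𝓗)
  acProj_add_sProj : ∀ s, acProj s + sProj s = proj s
  acScalar : 𝓗 → Measure ℝ
  sScalar : 𝓗 → Measure ℝ
  acScalar_spec : ∀ (f : 𝓗) (s : Set ℝ), MeasurableSet s →
    (acScalar f s).toReal = (⟪f, acProj s f⟫_ℂ).re
  sScalar_spec : ∀ (f : 𝓗) (s : Set ℝ), MeasurableSet s →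
    (sScalar f s).toReal = (⟪f, sProj s f⟫_ℂ).re
  acScalar_ac : ∀ f, acScalar f ≪ MeasureTheory.volume
  sScalar_sing : ∀ f, (sScalar f).MutuallySingular MeasureTheory.volume

/-- The real-valued test function version of the functional calculus. -/
def SpectralMeasure.fcR {H : SelfAdjointOperator 𝓗} (E : SpectralMeasure H)
    (φ : ℝ → ℝ) : 𝓗 →L[ℂ] 𝓗 :=
  E.fc fun x => (φ x : ℂ)


/-- A rigging operator: a bounded operator with trivial kernel and dense range. -/
def IsRigging (F : 𝓗 →L[ℂ] 𝓚) : Prop :=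
  Function.Injective F ∧ Dense (Set.range F)

/-- The perturbation `F* J F` determined by a rigging `F` and a bounded operator `J`. -/
def sandwich (F : 𝓗 →L[ℂ] 𝓚) (J : 𝓚 →L[ℂ] 𝓚) : 𝓗 →L[ℂ] 𝓗 :=
  ContinuousLinearMap.adjoint F ∘L (J ∘L F)

/-- The sandwiched resolvent `T_z(H) = F R_z(H) F*`. -/
def Tz (F : 𝓗 →L[ℂ] 𝓚) (H : SelfAdjointOperator 𝓗) (z : ℂ) : 𝓚 →L[ℂ] 𝓚 :=
  F ∘L (H.resolvent z ∘L ContinuousLinearMap.adjoint F)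

/-- The imaginary part `Im T = (T - T*)/2i` of a bounded operator. -/
def imOp (T : 𝓚 →L[ℂ] 𝓚) : 𝓚 →L[ℂ] 𝓚 :=
  ((2 * Complex.I)⁻¹) • (T - ContinuousLinearMap.adjoint T)

/-- `Λ(H,F)`: the set of real points `l` at which the norm limit
`T_{l+i0}(H) = lim_{y→0⁺} T_{l+iy}(H)` exists. -/
def LambdaSet (F : 𝓗 →L[ℂ] 𝓚) (H : SelfAdjointOperator 𝓗) : Set ℝ :=
  {l : ℝ | ∃ L : 𝓚 →L[ℂ] 𝓚,
    Tendsto (fun y : ℝ => Tz F H ((l : ℂ) + y * Complex.I)) (𝓝[>] (0:ℝ)) (𝓝 L)}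

/-- The norm limit `T_{l+i0}(H)` (meaningful for `l ∈ Λ(H,F)`). -/
def Tlim (F : 𝓗 →L[ℂ] 𝓚) (H : SelfAdjointOperator 𝓗) (l : ℝ) : 𝓚 →L[ℂ] 𝓚 :=
  limUnder (𝓝[>] (0:ℝ)) (fun y : ℝ => Tz F H ((l : ℂ) + y * Complex.I))

/-- Convergence in trace norm along a filter. -/
def TendstoTraceNorm (f : ℝ → (𝓚 →L[ℂ] 𝓚)) (lf : Filter ℝ) (L : 𝓚 →L[ℂ] 𝓚) : Prop :=
  (∀ᶠ y in lf, IsTraceClass (f y - L)) ∧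
  Tendsto (fun y : ℝ => traceNorm (f y - L)) lf (𝓝 0)

/-- `Λ(H,F;𝓛₁)`: the set of points `l ∈ Λ(H,F)` at which additionally
`Im T_{l+i0}(H)` exists in trace class. -/
def LambdaSetTC (F : 𝓗 →L[ℂ] 𝓚) (H : SelfAdjointOperator 𝓗) : Set ℝ :=
  {l : ℝ | l ∈ LambdaSet F H ∧ ∃ M : 𝓚 →L[ℂ] 𝓚, IsTraceClass M ∧
    TendstoTraceNorm (fun y : ℝ => imOp (Tz F H ((l : ℂ) + y * Complex.I)))
      (𝓝[>] (0:ℝ)) M}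

/-- `F` is an `H`-Hilbert-Schmidt rigging operator. -/
def IsHSRigging (F : 𝓗 →L[ℂ] 𝓚) (H : SelfAdjointOperator 𝓗) : Prop :=
  IsRigging F ∧ ∃ z : ℂ, z.im ≠ 0 ∧ IsHilbertSchmidt (F ∘L H.resolvent z)

/-- The meromorphic continuation in the coupling constant:
`T_z(H_r) = T_z(H_s)(1 + (r−s) J T_z(H_s))⁻¹`, where `T = T_z(H_s)`, for complex `r`. -/
def Tcoupling (T J : 𝓚 →L[ℂ] 𝓚) (s : ℝ) (r : ℂ) : 𝓚 →L[ℂ] 𝓚 :=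
  T ∘L Ring.inverse ((1 : 𝓚 →L[ℂ] 𝓚) + (r - (s : ℂ)) • (J ∘L T))

/-- The set of poles (in the complex coupling constant `r`) of `r ↦ T_z(H_r)`,
where `T = T_z(H_s)`. -/
def couplingPoles (T J : 𝓚 →L[ℂ] 𝓚) (s : ℝ) : Set ℂ :=
  {r : ℂ | ¬ IsUnit ((1 : 𝓚 →L[ℂ] 𝓚) + (r - (s : ℂ)) • (J ∘L T))}

/-- The multiplicity of a pole `r` of `r ↦ T_z(H_r)`: the algebraic multiplicity of the
eigenvalue `(s − r)⁻¹` of `J T_z(H_s)`. -/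
def couplingMult (T J : 𝓚 →L[ℂ] 𝓚) (s : ℝ) (r : ℂ) : ℕ :=
  Module.finrank ℂ
    (Module.End.maxGenEigenspace ((J ∘L T : 𝓚 →L[ℂ] 𝓚) : 𝓚 →ₗ[ℂ] 𝓚) (((s : ℂ) - r)⁻¹))

/-- The number `N₊` (`upper = true`) resp. `N₋` (`upper = false`) of poles of
`r ↦ T_z(H_r)`, counted with multiplicities, lying in the upper resp. lower half-plane
within distance `ε` of the point `c`. -/
def poleCount (T J : 𝓚 →L[ℂ] 𝓚) (s : ℝ) (c ε : ℝ) (upper : Bool) : ℕ :=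
  ∑ᶠ r ∈ {r : ℂ | dist r (c : ℂ) < ε ∧ (if upper then 0 < r.im else r.im < 0) ∧
    r ∈ couplingPoles T J s}, couplingMult T J s r

/-- The contour integral over the (counterclockwise oriented) closed upper semicircle
of radius `ε` centred at the real point `c`. -/
def upperSemicircleIntegral (g : ℂ → (𝓚 →L[ℂ] 𝓚)) (c ε : ℝ) : 𝓚 →L[ℂ] 𝓚 :=
  (∫ t in (c - ε)..(c + ε), g (t : ℂ)) +
    ∫ θ in (0:ℝ)..π, ((ε : ℂ) * Complex.exp (θ * Complex.I) * Complex.I) •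
      g ((c : ℂ) + (ε : ℂ) * Complex.exp (θ * Complex.I))

section CompactOperators

variable {E : Type*} [NormedAddCommGroup E] [InnerProductSpace ℂ E]

/-- The Fredholm alternative: an injective compact perturbation of the identity is invertible. -/
lemma isUnit_one_add_of_isCompactOperator [CompleteSpace E] {K : E →L[ℂ] E} (hK : IsCompactOperator K)
    (hinj : ∀ x, x + K x = 0 → x = 0) : IsUnit (1 + K) := by
  rcases hK.hasEigenvalue_or_mem_resolventSet (μ := (-1 : ℂ)) (by norm_num) with h | h
  · exfalso
    obtain ⟨x, hx⟩ := h.exists_hasEigenvector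
    have h1 : K x = (-1 : ℂ) • x := hx.apply_eq_smul
    exact hx.2 (hinj x (by rw [h1]; simp))
  · rw [spectrum.mem_resolventSet_iff] at h
    have h2 : (algebraMap ℂ (E →L[ℂ] E) (-1) - K) = -(1 + K) := by
      simp; abel
    rw [h2] at h
    exact IsUnit.neg_iff _ |>.mp h

/-- Powers of `A - a` are compact perturbations of `(-a) ^ k`. -/
lemma exists_isCompactOperator_sub_smul_pow {A : E →L[ℂ] E} (hA : IsCompactOperator A) (a : ℂ)
    (k : ℕ) : ∃ K : E →L[ℂ] E, IsCompactOperator K ∧ (A - a • 1) ^ k = (-a) ^ k • 1 + K := by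
  induction k with
  | zero => exact ⟨0, isCompactOperator_zero, by simp⟩
  | succ k ih =>
    obtain ⟨K, hK, h⟩ := ih
    refine ⟨(-a) ^ k • A + K * (A - a • 1), ?_, ?_⟩
    · exact (hA.smul _).add (hK.comp_clm _)
    · rw [pow_succ, h, pow_succ]
      simp only [add_mul, smul_mul_assoc, one_mul, smul_sub, smul_smul]
      have : (-a) ^ k * -a = -((-a) ^ k * a) := by ring
      rw [this, neg_smul]
      abel

/-- A compact operator has finite ascent at every nonzero scalar. -/
lemma exists_ker_pow_succ_le [CompleteSpace E] {A : E →L[ℂ] E} (hA : IsCompactOperator A) {a : ℂ} (ha : a ≠ 0) :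
    ∃ k : ℕ, ∀ x, ((A - a • 1) ^ (k + 1)) x = 0 → ((A - a • 1) ^ k) x = 0 := by
  by_contra! hcon
  set B : E →L[ℂ] E := A - a • 1 with hB
  have hcomm : ∀ n x, (B ^ n) (A x) = A ((B ^ n) x) := by
    intro n x
    have : Commute (B ^ n) A := by
      apply Commute.pow_left
      rw [hB]
      exact (Commute.refl A).sub_left ((Commute.one_left A).smul_left a)
    exact congrArg (fun L : E →L[ℂ] E => L x) this.eq
  have hunit : ∀ n : ℕ, ∃ x : E, ‖x‖ = 1 ∧ (B ^ (n + 1)) x = 0 ∧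
      ∀ v, (B ^ n) v = 0 → ⟪x, v⟫_ℂ = 0 := by
    intro n
    obtain ⟨x, hx1, hx0⟩ := hcon n
    let N : Submodule ℂ E := LinearMap.ker (B ^ n : E →L[ℂ] E).toLinearMap
    have hNc : IsClosed (N : Set E) := (B ^ n).isClosed_ker
    have : CompleteSpace N := hNc.completeSpace_coe
    obtain ⟨v, hv, w, hw, rfl⟩ := N.exists_add_mem_mem_orthogonal x
    have hv' : (B ^ n) v = 0 := hv
    have hv1 : (B ^ (n + 1)) v = 0 := by rw [pow_succ']; simp [hv']
    have hw1 : (B ^ (n + 1)) w = 0 := by rwa [map_add, hv1, zero_add] at hx1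
    have hw0 : w ≠ 0 := by
      rintro rfl
      exact hx0 (by simpa using hv')
    refine ⟨((‖w‖⁻¹ : ℝ) : ℂ) • w, ?_, ?_, ?_⟩
    · rw [norm_smul]
      simp [hw0]
    · rw [map_smul, hw1, smul_zero]
    · intro u hu
      rw [inner_smul_left, N.mem_orthogonal' w |>.1 hw u hu, mul_zero]
  choose x hx1 hx2 hx3 using hunit
  have hsep : ∀ m n, m < n → ‖a‖ ≤ ‖A (x n) - A (x m)‖ := by
    intro m n hmn
    have hm : (B ^ n) (x m) = 0 := by
      obtain ⟨d, rfl⟩ := Nat.exists_eq_add_of_lt hmn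
      rw [show m + d + 1 = d + (m + 1) by ring, pow_add]
      simp [hx2 m]
    have h1 : ⟪x n, A (x n) - A (x m)⟫_ℂ = a := by
      have e : A (x n) - A (x m) = a • x n + (B (x n) - A (x m)) := by
        simp only [hB, sub_apply, smul_apply, one_apply_eq_self]
        abel
      rw [e, inner_add_right, inner_smul_right, inner_self_eq_norm_sq_to_K, hx1,
        hx3 n (B (x n) - A (x m))]
      · simp
      · rw [map_sub, hcomm, hm, map_zero, sub_zero]
        have := hx2 n
        rwa [pow_succ] at this
    calc ‖a‖ = ‖⟪x n, A (x n) - A (x m)⟫_ℂ‖ := by rw [h1]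
      _ ≤ ‖x n‖ * ‖A (x n) - A (x m)‖ := norm_inner_le_norm _ _
      _ = _ := by rw [hx1, one_mul]
  obtain ⟨K, hK, hK'⟩ := IsCompactOperator.image_closedBall_subset_compact (f := A.toLinearMap) hA 1
  obtain ⟨y, -, ψ, hψ, hψy⟩ := hK.tendsto_subseq (x := fun n => A (x n))
    (fun n ↦ hK' ⟨x n, by simp [hx1], rfl⟩)
  obtain ⟨N, hN⟩ := Metric.cauchySeq_iff'.1 hψy.cauchySeq ‖a‖ (norm_pos_iff.2 ha)
  have h1 := hN (N + 1) (by omega)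
  rw [dist_eq_norm] at h1
  exact absurd h1 (not_lt.2 (hsep _ _ (hψ (Nat.lt_succ_self N))))

/-- The kernel of a power of `A - a` is finite dimensional for compact `A` and `a ≠ 0`. -/
lemma finiteDimensional_ker_sub_smul_pow {A : E →L[ℂ] E} (hA : IsCompactOperator A) {a : ℂ}
    (ha : a ≠ 0) (k : ℕ) :
    FiniteDimensional ℂ (LinearMap.ker ((A - a • 1) ^ k : E →L[ℂ] E).toLinearMap) := by
  obtain ⟨K, hK, h⟩ := exists_isCompactOperator_sub_smul_pow hA a k
  set N := LinearMap.ker ((A - a • 1) ^ k : E →L[ℂ] E).toLinearMap with hN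
  have hKx : ∀ x ∈ N, K x = -((-a) ^ k • x) := by
    intro x hx
    have : ((A - a • 1) ^ k) x = 0 := hx
    rw [h] at this
    simp only [add_apply, smul_apply,
      one_apply_eq_self] at this
    rw [eq_neg_iff_add_eq_zero, add_comm, this]
  have hmaps : ∀ x ∈ N, K.toLinearMap x ∈ N := by
    intro x hx
    rw [ContinuousLinearMap.coe_coe, hKx x hx]
    exact N.neg_mem (N.smul_mem _ hx)
  have hNc : IsClosed (N : Set E) := ContinuousLinearMap.isClosed_ker _
  have hc := IsCompactOperator.restrict (f := K.toLinearMap) hK hmaps hNc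
  apply FiniteDimensional.of_isCompactOperator_id (𝕜 := ℂ)
  have h2 := hc.smul (-((-a) ^ k)⁻¹)
  have h3 : (id : N → N) = -((-a) ^ k)⁻¹ • ⇑(K.toLinearMap.restrict hmaps) := ?_
  · rw [h3]; exact h2
  funext x
  apply Subtype.ext
  have hx := hKx x x.2
  have ha' : (-a) ^ k ≠ 0 := pow_ne_zero _ (neg_ne_zero.2 ha)
  simp [hx, ha', smul_smul]

/-- The Riesz projection of a compact operator at a nonzero scalar. -/
lemma exists_rieszProjection [CompleteSpace E] {A : E →L[ℂ] E} (hA : IsCompactOperator A) {a : ℂ} (ha : a ≠ 0) :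
    ∃ Q : E →L[ℂ] E, Q * Q = Q ∧ Commute A Q ∧
      FiniteDimensional ℂ (LinearMap.range Q.toLinearMap) ∧
      LinearMap.range Q.toLinearMap = Module.End.maxGenEigenspace (A : E →ₗ[ℂ] E) a ∧
      ∃ k : ℕ, (A - a • 1) ^ k * Q = 0 := by
  obtain ⟨k, hk⟩ := exists_ker_pow_succ_le hA ha
  set B : E →L[ℂ] E := A - a • 1 with hB
  have hfin := finiteDimensional_ker_sub_smul_pow hA ha k
  rw [← hB] at hfin
  have hAB : Commute A (B ^ k) :=
    (((Commute.refl A).sub_right ((Commute.one_right A).smul_right a))).pow_right k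
  set N := LinearMap.ker (B ^ k : E →L[ℂ] E).toLinearMap with hN
  have hmemN : ∀ x, x ∈ N ↔ (B ^ k) x = 0 := fun x => Iff.rfl
  have hasc : ∀ j x, (B ^ (k + j)) x = 0 → (B ^ k) x = 0 := by
    intro j
    induction j with
    | zero => exact fun x h => h
    | succ j ih =>
      intro x h
      have h1 : (B ^ (k + 1)) ((B ^ j) x) = 0 := by
        rw [← mul_apply_eq_comp, ← pow_add]
        rwa [show k + 1 + j = k + (j + 1) by ring]
      apply ih
      have h2 := hk _ h1
      rwa [← mul_apply_eq_comp, ← pow_add] at h2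
  let G : E →L[ℂ] E := N.starProjection
  have hGN : ∀ x, G x ∈ N := fun x => N.starProjection_apply_mem x
  have hGid : ∀ x ∈ N, G x = x := fun x hx => N.starProjection_eq_self_iff.2 hx
  obtain ⟨K, hK, hBK⟩ := exists_isCompactOperator_sub_smul_pow hA a k
  rw [← hB] at hBK
  have ha' : (-a) ^ k ≠ 0 := pow_ne_zero _ (neg_ne_zero.2 ha)
  have hinj : ∀ x, (B ^ k) x + G x = 0 → x = 0 := by
    intro x hx
    have h1 : (B ^ k) x = -G x := eq_neg_of_add_eq_zero_left hx
    have h2 : (B ^ (k + k)) x = 0 := by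
      rw [pow_add, mul_apply_eq_comp, h1, map_neg, (hmemN _).1 (hGN x), neg_zero]
    have h3 := hasc k x h2
    rw [h3, zero_add, hGid x h3] at hx
    exact hx
  have hGc : IsCompactOperator G := by
    have : IsCompactOperator (N.subtypeL ∘L N.orthogonalProjectionOnto) := by
      exact IsCompactOperator.clm_comp
        (isCompactOperator_of_locallyCompactSpace_dom N.orthogonalProjectionOnto) N.subtypeL
    exact this
  have hCu : IsUnit (B ^ k + G) := by
    have h1 : IsUnit (1 + ((-a) ^ k)⁻¹ • (K + G)) := by
      apply isUnit_one_add_of_isCompactOperator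
      · exact (hK.add hGc).smul _
      · intro x hx
        apply hinj
        rw [hBK]
        have := congrArg (fun v => (-a) ^ k • v) hx
        simp only [smul_apply, smul_add, smul_smul, mul_inv_cancel₀ ha',
          one_smul, smul_zero, add_apply] at this
        simpa [add_assoc] using this
    have h2 : B ^ k + G = (-a) ^ k • (1 + ((-a) ^ k)⁻¹ • (K + G)) := by
      rw [hBK, smul_add, smul_smul, mul_inv_cancel₀ ha', one_smul, add_assoc]
    rw [h2]
    exact IsUnit.smul (Units.mk0 _ ha') h1
  obtain ⟨C, hC⟩ := hCu
  let D : E →L[ℂ] E := ↑C⁻¹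
  have hCD : (B ^ k + G) * D = 1 := by rw [← hC]; exact C.mul_inv
  have hDC : D * (B ^ k + G) = 1 := by rw [← hC]; exact C.inv_mul
  have hdec : ∀ v, v = (B ^ k) (D v) + G (D v) := fun v =>
    (congrArg (fun L : E →L[ℂ] E => L v) hCD).symm
  let Q : E →L[ℂ] E := G * D
  have hQN : ∀ x ∈ N, Q x = x := by
    intro x hx
    have h1 : D x = x := by
      have := congrArg (fun L : E →L[ℂ] E => L x) hDC
      simpa [(hmemN x).1 hx, hGid x hx] using this
    change G (D x) = x
    rw [h1, hGid x hx]
  have hQmem : ∀ x, Q x ∈ N := fun x => hGN _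
  have hQB : ∀ x, Q ((B ^ k) x) = 0 := by
    intro x
    have h1 := hdec ((B ^ k) x)
    have h2 : (B ^ k) (x - D ((B ^ k) x)) = G (D ((B ^ k) x)) := by
      rw [map_sub, sub_eq_iff_eq_add, add_comm]; exact h1
    have h3 : (B ^ (k + k)) (x - D ((B ^ k) x)) = 0 := by
      rw [pow_add, mul_apply_eq_comp, h2, (hmemN _).1 (hGN _)]
    have h4 := hasc k _ h3
    rw [h2] at h4
    exact h4
  refine ⟨Q, ?_, ?_, ?_, ?_, k, ?_⟩
  · ext x; exact hQN _ (hQmem x)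
  · ext v
    have hAN : A (G (D v)) ∈ N := by
      rw [hmemN, ← mul_apply_eq_comp, ← hAB.eq, mul_apply_eq_comp,
        (hmemN _).1 (hGN _), map_zero]
    have h1 : A v = (B ^ k) (A (D v)) + A (G (D v)) := by
      conv_lhs => rw [hdec v, map_add]
      rw [← mul_apply_eq_comp A, hAB.eq, mul_apply_eq_comp]
    change A (Q v) = Q (A v)
    rw [h1, map_add, hQB, zero_add, hQN _ hAN]
    rfl
  · exact Submodule.finiteDimensional_of_le (S₂ := N) (by rintro _ ⟨x, rfl⟩; exact hQmem x)
  · have hpow : ∀ (j : ℕ) (x : E),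
        (((A : E →ₗ[ℂ] E) - a • (1 : Module.End ℂ E)) ^ j) x = (B ^ j) x := by
      intro j
      induction j with
      | zero => intro x; simp
      | succ j ih => intro x; rw [pow_succ, pow_succ, Module.End.mul_apply, ih]; rfl
    apply le_antisymm
    · rintro _ ⟨x, rfl⟩
      rw [Module.End.mem_maxGenEigenspace]
      exact ⟨k, by rw [hpow]; exact hQmem x⟩
    · intro x hx
      rw [Module.End.mem_maxGenEigenspace] at hx
      obtain ⟨j, hj⟩ := hx
      rw [hpow] at hj
      have : (B ^ (k + j)) x = 0 := by
        rw [pow_add, mul_apply_eq_comp, hj, map_zero]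
      exact ⟨x, hQN x (hasc j x this)⟩
  · ext x; exact hQmem x

/-- Hilbert-Schmidt operators are compact. -/
lemma IsHilbertSchmidt.isCompactOperator {E' : Type*} [NormedAddCommGroup E']
    [InnerProductSpace ℂ E'] [CompleteSpace E'] {T : E →L[ℂ] E'} (hT : IsHilbertSchmidt T) :
    IsCompactOperator T := by
  obtain ⟨C, hC⟩ := hT
  let S : Set ℝ := {c | ∃ (n : ℕ) (e : Fin n → E), Orthonormal ℂ e ∧ c = ∑ i, ‖T (e i)‖ ^ 2}
  have hne : S.Nonempty := ⟨0, 0, Fin.elim0, ⟨fun i => i.elim0, fun i => i.elim0⟩, by simp⟩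
  have hbdd : BddAbove S := ⟨C, by rintro _ ⟨n, e, he, rfl⟩; exact hC n e he⟩
  have key : ∀ δ : ℝ, 0 < δ → ∃ K : E →L[ℂ] E', IsCompactOperator K ∧ ‖T - K‖ ≤ δ := by
    intro δ hδ
    obtain ⟨_, ⟨n, e, he, rfl⟩, hlt⟩ := exists_lt_of_lt_csSup hne
      (show sSup S - δ ^ 2 < sSup S by nlinarith [sq_pos_of_pos hδ])
    let N : Submodule ℂ E := Submodule.span ℂ (Set.range e)
    have : FiniteDimensional ℂ N := FiniteDimensional.span_of_finite ℂ (Set.finite_range e)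
    have horth : ∀ x ∈ Nᗮ, ‖x‖ = 1 → ‖T x‖ ≤ δ := by
      intro x hx hx1
      have hon : Orthonormal ℂ (Fin.cons x e : Fin (n + 1) → E) := by
        rw [orthonormal_iff_ite] at he ⊢
        have h0 : ∀ i, ⟪x, e i⟫_ℂ = 0 := fun i =>
          (N.mem_orthogonal' x).1 hx _ (Submodule.subset_span ⟨i, rfl⟩)
        have h0' : ∀ i, ⟪e i, x⟫_ℂ = 0 := fun i =>
          (N.mem_orthogonal x).1 hx _ (Submodule.subset_span ⟨i, rfl⟩)
        intro i j
        refine Fin.cases ?_ (fun i => ?_) i <;> refine Fin.cases ?_ (fun j => ?_) j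
        · simp [hx1]
        · simp [h0, Fin.succ_ne_zero, eq_comm]
        · simp [h0', Fin.succ_ne_zero]
        · simp [he i j]
      have hle : ‖T x‖ ^ 2 + ∑ i, ‖T (e i)‖ ^ 2 ≤ sSup S := by
        apply le_csSup hbdd
        exact ⟨n + 1, _, hon, by simp [Fin.sum_univ_succ]⟩
      exact abs_le_of_sq_le_sq' (by linarith) hδ.le |>.2
    refine ⟨T ∘L (N.subtypeL ∘L N.orthogonalProjectionOnto), ?_, ?_⟩
    · exact ((isCompactOperator_of_locallyCompactSpace_dom
        N.orthogonalProjectionOnto).clm_comp N.subtypeL).clm_comp T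
    · refine ContinuousLinearMap.opNorm_le_bound _ hδ.le fun x => ?_
      set v := x - (N.orthogonalProjectionOnto x : E) with hv
      have hvN : v ∈ Nᗮ := N.sub_starProjection_mem_orthogonal x
      have hvx : ‖v‖ ≤ ‖x‖ := by
        have h2 : Nᗮ.starProjection x = v := by
          rw [Submodule.starProjection_orthogonal_val]; rfl
        rw [← h2]
        exact Submodule.norm_starProjection_apply_le _ x
      have hTv : ‖T v‖ ≤ δ * ‖v‖ := by
        rcases eq_or_ne v 0 with h | h
        · simp [h]
        · have h1 := horth (((‖v‖⁻¹ : ℝ) : ℂ) • v) (Submodule.smul_mem _ _ hvN) (by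
            rw [norm_smul]; simp [h])
          rw [map_smul, norm_smul] at h1
          have hpos : 0 < ‖v‖ := norm_pos_iff.2 h
          simp only [Complex.ofReal_inv, norm_inv, Complex.norm_real, norm_norm] at h1
          rwa [inv_mul_le_iff₀ hpos, mul_comm] at h1
      calc _ = ‖T v‖ := by simp [hv]
        _ ≤ δ * ‖v‖ := hTv
        _ ≤ δ * ‖x‖ := by gcongr
  have hcl : IsClosed {K : E →L[ℂ] E' | IsCompactOperator K} := isClosed_setOfPred_isCompactOperator
  have : T ∈ closure {K : E →L[ℂ] E' | IsCompactOperator K} := by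
    rw [Metric.mem_closure_iff]
    intro δ hδ
    obtain ⟨K, hK, h⟩ := key (δ / 2) (by linarith)
    exact ⟨K, hK, by rw [dist_eq_norm]; linarith⟩
  rwa [hcl.closure_eq] at this

end CompactOperators

section HalfDisc

variable {X : Type*} [NormedAddCommGroup X] [NormedSpace ℂ X]

/-- The boundary of the closed upper half-disc of radius `ε` centred at `c`. -/
def halfDiscBoundary (c ε : ℝ) : Set ℂ :=
  (fun t : ℝ => (t : ℂ)) '' Icc (c - ε) (c + ε) ∪
    (fun θ : ℝ => (c : ℂ) + (ε : ℂ) * Complex.exp (θ * Complex.I)) '' Icc 0 π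

/-- The contour integral over the boundary of the upper half-disc, with values in any complex
normed space. -/
def halfDiscIntegral (g : ℂ → X) (c ε : ℝ) : X :=
  (∫ t in (c - ε)..(c + ε), g (t : ℂ)) +
    ∫ θ in (0:ℝ)..π, ((ε : ℂ) * Complex.exp (θ * Complex.I) * Complex.I) •
      g ((c : ℂ) + (ε : ℂ) * Complex.exp (θ * Complex.I))

variable {c ε : ℝ}

lemma ofReal_mem_halfDiscBoundary (hε : 0 < ε) {t : ℝ} (ht : t ∈ uIcc (c - ε) (c + ε)) :
    (t : ℂ) ∈ halfDiscBoundary c ε := by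
  rw [uIcc_of_le (by linarith)] at ht
  exact Or.inl ⟨t, ht, rfl⟩

lemma arc_mem_halfDiscBoundary {θ : ℝ} (hθ : θ ∈ uIcc 0 π) :
    (c : ℂ) + (ε : ℂ) * Complex.exp (θ * Complex.I) ∈ halfDiscBoundary c ε := by
  rw [uIcc_of_le Real.pi_pos.le] at hθ
  exact Or.inr ⟨θ, hθ, rfl⟩

lemma im_nonneg_of_mem_halfDiscBoundary (hε : 0 < ε) {r : ℂ} (hr : r ∈ halfDiscBoundary c ε) :
    0 ≤ r.im := by
  rcases hr with ⟨t, -, rfl⟩ | ⟨θ, hθ, rfl⟩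
  · simp
  · have : 0 ≤ Real.sin θ := Real.sin_nonneg_of_mem_Icc hθ
    simp only [Complex.add_im, Complex.ofReal_im, Complex.mul_im, Complex.ofReal_re,
      Complex.exp_ofReal_mul_I_im, zero_mul, zero_add, add_zero]
    positivity

lemma halfDiscBoundary_subset_closedBall (hε : 0 < ε) :
    halfDiscBoundary c ε ⊆ Metric.closedBall (c : ℂ) ε := by
  rintro r (⟨t, ht, rfl⟩ | ⟨θ, -, rfl⟩)
  · rw [Metric.mem_closedBall, dist_eq_norm]
    dsimp only
    rw [← Complex.ofReal_sub, Complex.norm_real, Real.norm_eq_abs, abs_le]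
    exact ⟨by linarith [ht.1], by linarith [ht.2]⟩
  · rw [Metric.mem_closedBall, dist_eq_norm]
    simp [Complex.norm_exp_ofReal_mul_I, abs_of_pos hε]

lemma mem_halfDiscBoundary_of_norm_eq {r : ℂ} (him : 0 ≤ r.im)
    (hr : dist r (c : ℂ) = ε) : r ∈ halfDiscBoundary c ε := by
  refine Or.inr ⟨Complex.arg (r - c), ⟨?_, Complex.arg_le_pi _⟩, ?_⟩
  · rw [Complex.arg_nonneg_iff]; simpa using him
  · rw [dist_eq_norm] at hr
    dsimp only
    rw [← hr, Complex.norm_mul_exp_arg_mul_I]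
    ring

lemma intervalIntegrable_segment {X : Type*} [NormedAddCommGroup X] (hε : 0 < ε) {g : ℂ → X}
    (hg : ContinuousOn g (halfDiscBoundary c ε)) :
    IntervalIntegrable (fun t : ℝ => g (t : ℂ)) volume (c - ε) (c + ε) :=
  (hg.comp Complex.continuous_ofReal.continuousOn
    fun _ ht => ofReal_mem_halfDiscBoundary hε ht).intervalIntegrable

lemma intervalIntegrable_arc {g : ℂ → X}
    (hg : ContinuousOn g (halfDiscBoundary c ε)) :
    IntervalIntegrable (fun θ : ℝ => ((ε : ℂ) * Complex.exp (θ * Complex.I) * Complex.I) •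
      g ((c : ℂ) + (ε : ℂ) * Complex.exp (θ * Complex.I))) volume 0 π := by
  apply ContinuousOn.intervalIntegrable
  apply ContinuousOn.smul (by fun_prop)
  exact hg.comp (by fun_prop) fun _ hθ => arc_mem_halfDiscBoundary hθ

lemma halfDiscIntegral_add (hε : 0 < ε) {g h : ℂ → X}
    (hg : ContinuousOn g (halfDiscBoundary c ε)) (hh : ContinuousOn h (halfDiscBoundary c ε)) :
    halfDiscIntegral (fun r => g r + h r) c ε
      = halfDiscIntegral g c ε + halfDiscIntegral h c ε := by
  unfold halfDiscIntegral
  simp only [smul_add]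
  rw [intervalIntegral.integral_add (intervalIntegrable_segment hε hg)
      (intervalIntegrable_segment hε hh),
    intervalIntegral.integral_add (intervalIntegrable_arc hg)
      (intervalIntegrable_arc hh)]
  abel

lemma halfDiscIntegral_smul (z : ℂ) (g : ℂ → X) :
    halfDiscIntegral (fun r => z • g r) c ε = z • halfDiscIntegral g c ε := by
  unfold halfDiscIntegral
  simp only [smul_comm _ z]
  rw [intervalIntegral.integral_smul, intervalIntegral.integral_smul, smul_add]

lemma halfDiscIntegral_congr (hε : 0 < ε) {g h : ℂ → X}
    (hgh : ∀ r ∈ halfDiscBoundary c ε, g r = h r) :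
    halfDiscIntegral g c ε = halfDiscIntegral h c ε := by
  unfold halfDiscIntegral
  congr 1
  · exact intervalIntegral.integral_congr fun t ht => hgh _ (ofReal_mem_halfDiscBoundary hε ht)
  · refine intervalIntegral.integral_congr fun t ht => ?_
    rw [hgh _ (arc_mem_halfDiscBoundary ht)]

lemma halfDiscIntegral_clm [CompleteSpace X] {Y : Type*} [NormedAddCommGroup Y] [NormedSpace ℂ Y]
    [CompleteSpace Y] (L : X →L[ℂ] Y) (hε : 0 < ε) {g : ℂ → X}
    (hg : ContinuousOn g (halfDiscBoundary c ε)) :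
    halfDiscIntegral (fun r => L (g r)) c ε = L (halfDiscIntegral g c ε) := by
  unfold halfDiscIntegral
  simp only [← map_smul]
  rw [L.intervalIntegral_comp_comm (intervalIntegrable_segment hε hg),
    L.intervalIntegral_comp_comm (intervalIntegrable_arc hg), map_add]

lemma hasDerivAt_arc (c ε θ : ℝ) :
    HasDerivAt (fun θ : ℝ => (c : ℂ) + (ε : ℂ) * Complex.exp (θ * Complex.I))
      ((ε : ℂ) * Complex.exp (θ * Complex.I) * Complex.I) θ := by
  have h1 : HasDerivAt (fun θ : ℝ => (θ : ℂ) * Complex.I) Complex.I θ := by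
    simpa using (Complex.ofRealCLM.hasDerivAt (x := θ)).mul_const Complex.I
  simpa [mul_assoc] using (h1.cexp.const_mul (ε : ℂ)).const_add (c : ℂ)

/-- The integral of a derivative over the boundary of the half-disc vanishes. -/
lemma halfDiscIntegral_eq_zero_of_hasDerivAt [CompleteSpace X] (hε : 0 < ε) {G g : ℂ → X}
    (hg : ContinuousOn g (halfDiscBoundary c ε))
    (hG : ∀ r ∈ halfDiscBoundary c ε, HasDerivAt G (g r) r) :
    halfDiscIntegral g c ε = 0 := by
  unfold halfDiscIntegral
  rw [intervalIntegral.integral_eq_sub_of_hasDerivAt (f := fun t : ℝ => G (t : ℂ))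
      (fun t ht => by simpa [Function.comp_def] using
        (hG _ (ofReal_mem_halfDiscBoundary hε ht)).scomp t (Complex.ofRealCLM.hasDerivAt (x := t)))
      (intervalIntegrable_segment hε hg),
    intervalIntegral.integral_eq_sub_of_hasDerivAt
      (f := fun θ : ℝ => G ((c : ℂ) + (ε : ℂ) * Complex.exp (θ * Complex.I)))
      (fun θ hθ => (hG _ (arc_mem_halfDiscBoundary hθ)).scomp θ (hasDerivAt_arc c ε θ))
      (intervalIntegrable_arc hg)]
  simp [sub_eq_add_neg]

/-- Cauchy's theorem for the half-disc. -/
lemma halfDiscIntegral_eq_zero_of_differentiableOn [CompleteSpace X] (hε : 0 < ε) {δ : ℝ}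
    (hδ : ε < δ) {g : ℂ → X} (hg : DifferentiableOn ℂ g (Metric.ball (c : ℂ) δ)) :
    halfDiscIntegral g c ε = 0 := by
  have hsub : halfDiscBoundary c ε ⊆ Metric.ball (c : ℂ) δ :=
    (halfDiscBoundary_subset_closedBall hε).trans (Metric.closedBall_subset_ball hδ)
  obtain ⟨G, hG⟩ := hg.isExactOn_ball
  exact halfDiscIntegral_eq_zero_of_hasDerivAt hε (hg.continuousOn.mono hsub)
    fun r hr => hG r (hsub hr)

lemma continuousOn_sub_pow_inv {p : ℂ} (hp : p ∉ halfDiscBoundary c ε) (j : ℕ) :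
    ContinuousOn (fun r : ℂ => ((r - p) ^ j)⁻¹) (halfDiscBoundary c ε) := by
  apply ContinuousOn.inv₀ (by fun_prop)
  intro r hr
  apply pow_ne_zero
  rw [sub_ne_zero]
  rintro rfl
  exact hp hr

lemma halfDiscIntegral_sub_pow_inv (hε : 0 < ε) {p : ℂ} (hp : p ∉ halfDiscBoundary c ε) (j : ℕ) :
    halfDiscIntegral (fun r : ℂ => ((r - p) ^ (j + 2))⁻¹) c ε = 0 := by
  refine halfDiscIntegral_eq_zero_of_hasDerivAt hε
    (G := fun r => -((j : ℂ) + 1)⁻¹ * ((r - p) ^ (j + 1))⁻¹) (continuousOn_sub_pow_inv hp _) ?_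
  intro r hr
  have hne : r - p ≠ 0 := by
    rw [sub_ne_zero]
    rintro rfl
    exact hp hr
  have hj : (j : ℂ) + 1 ≠ 0 := by exact_mod_cast Nat.succ_ne_zero j
  have h1 : HasDerivAt (fun r : ℂ => -((j : ℂ) + 1)⁻¹ * ((r - p) ^ (j + 1))⁻¹)
      (-((j : ℂ) + 1)⁻¹ * (-(((j + 1 : ℕ) : ℂ) * (r - p) ^ j * 1) / ((r - p) ^ (j + 1)) ^ 2)) r :=
    ((((hasDerivAt_id' r).sub_const p).fun_pow (j + 1)).fun_inv
      (pow_ne_zero _ hne)).const_mul (-((j : ℂ) + 1)⁻¹)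
  refine h1.congr_deriv ?_
  push_cast
  field_simp
  ring

lemma halfDiscIntegral_sub_inv_of_im_neg (hε : 0 < ε) {p : ℂ} (hp : p.im < 0) :
    halfDiscIntegral (fun r : ℂ => (r - p)⁻¹) c ε = 0 := by
  have hp' : p ∉ halfDiscBoundary c ε := fun h =>
    absurd (im_nonneg_of_mem_halfDiscBoundary hε h) (not_le.2 hp)
  refine halfDiscIntegral_eq_zero_of_hasDerivAt hε
    (G := fun r => Complex.log (-Complex.I * (r - p)))
    (by simpa using continuousOn_sub_pow_inv hp' 1) ?_
  intro r hr
  have him := im_nonneg_of_mem_halfDiscBoundary hε hr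
  have hne : r - p ≠ 0 := by
    rw [sub_ne_zero]
    rintro rfl
    exact hp' hr
  have hs : -Complex.I * (r - p) ∈ Complex.slitPlane := by
    left
    simp
    linarith
  refine ((((hasDerivAt_id' r).sub_const p).const_mul (-Complex.I)).clog hs).congr_deriv ?_
  have := Complex.I_ne_zero
  field_simp

lemma halfDiscIntegral_sub_inv_of_mem_ball (hε : 0 < ε) {p : ℂ} (hp : 0 < p.im)
    (hpb : p ∈ Metric.ball (c : ℂ) ε) :
    halfDiscIntegral (fun r : ℂ => (r - p)⁻¹) c ε = 2 * π * Complex.I := by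
  have hcirc := circleIntegral.integral_sub_inv_of_mem_ball hpb
  have hsph : ∀ θ : ℝ, (c : ℂ) + (ε : ℂ) * Complex.exp (θ * Complex.I) - p ≠ 0 := by
    intro θ h
    rw [sub_eq_zero] at h
    rw [← h, Metric.mem_ball, dist_eq_norm] at hpb
    simp [Complex.norm_exp_ofReal_mul_I, abs_of_pos hε] at hpb
  have hcont : Continuous fun θ : ℝ => ((ε : ℂ) * Complex.exp (θ * Complex.I) * Complex.I) •
      ((c : ℂ) + (ε : ℂ) * Complex.exp (θ * Complex.I) - p)⁻¹ := by
    have h1 : Continuous fun θ : ℝ =>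
        ((c : ℂ) + (ε : ℂ) * Complex.exp (θ * Complex.I) - p)⁻¹ :=
      Continuous.inv₀ (by fun_prop) hsph
    fun_prop
  have hlog : ∀ r : ℂ, r.im ≤ 0 →
      HasDerivAt (fun r => Complex.log (Complex.I * (r - p))) ((r - p)⁻¹) r := by
    intro r hr
    have hne : r - p ≠ 0 := by
      rw [sub_ne_zero]
      rintro rfl
      linarith
    have hs : Complex.I * (r - p) ∈ Complex.slitPlane := by
      left
      simp
      linarith
    refine ((((hasDerivAt_id' r).sub_const p).const_mul Complex.I).clog hs).congr_deriv ?_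
    have := Complex.I_ne_zero
    field_simp
  have hlow : (∫ θ in π..(2 * π), ((ε : ℂ) * Complex.exp (θ * Complex.I) * Complex.I) •
      ((c : ℂ) + (ε : ℂ) * Complex.exp (θ * Complex.I) - p)⁻¹)
      = ∫ t in (c - ε)..(c + ε), ((t : ℂ) - p)⁻¹ := by
    rw [intervalIntegral.integral_eq_sub_of_hasDerivAt
      (f := fun t : ℝ => Complex.log (Complex.I * ((t : ℂ) - p)))
      (fun t _ => (hlog t (by simp)).comp_ofReal)]
    · rw [intervalIntegral.integral_eq_sub_of_hasDerivAt
        (f := fun θ : ℝ => Complex.log (Complex.I *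
          ((c : ℂ) + (ε : ℂ) * Complex.exp (θ * Complex.I) - p)))
        (fun θ hθ => (hlog _ ?_).scomp θ (hasDerivAt_arc c ε θ)) (hcont.intervalIntegrable _ _)]
      · have h2 : Complex.exp (2 * (π : ℂ) * Complex.I) = 1 := Complex.exp_two_pi_mul_I
        simp [h2, sub_eq_add_neg]
      · rw [uIcc_of_le (by linarith [Real.pi_pos])] at hθ
        have hsin : Real.sin θ ≤ 0 := by
          have := Real.sin_nonneg_of_mem_Icc (x := θ - π) ⟨by linarith [hθ.1], by linarith [hθ.2]⟩
          rw [Real.sin_sub_pi] at this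
          linarith
        simp only [Complex.add_im, Complex.ofReal_im, Complex.mul_im, Complex.ofReal_re,
          Complex.exp_ofReal_mul_I_im, zero_mul, zero_add, add_zero]
        exact mul_nonpos_of_nonneg_of_nonpos hε.le hsin
    · apply Continuous.intervalIntegrable
      apply Continuous.inv₀ (by fun_prop)
      intro t h
      have := congrArg Complex.im h
      simp at this
      linarith
  unfold halfDiscIntegral
  rw [← hlow, add_comm, intervalIntegral.integral_add_adjacent_intervals
    (hcont.intervalIntegrable _ _) (hcont.intervalIntegrable _ _), ← hcirc]
  simp [circleIntegral, circleMap]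

end HalfDisc

section Projections

variable {E : Type*} [NormedAddCommGroup E] [InnerProductSpace ℂ E] [CompleteSpace E]

/-- The trace of a finite-rank idempotent, in any Hilbert basis, is its rank. -/
lemma hasSum_inner_of_isIdempotent {ι : Type*} (b : HilbertBasis ι ℂ E) {Q : E →L[ℂ] E}
    (hQ : Q * Q = Q) [FiniteDimensional ℂ (LinearMap.range Q.toLinearMap)] :
    HasSum (fun i => ⟪b i, Q (b i)⟫_ℂ)
      (Module.finrank ℂ (LinearMap.range Q.toLinearMap) : ℂ) := by
  set R := LinearMap.range Q.toLinearMap with hR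
  let f := stdOrthonormalBasis ℂ R
  have hfix : ∀ x ∈ R, Q x = x := by
    rintro _ ⟨y, rfl⟩
    change (Q * Q) y = Q y
    rw [hQ]
  have hexp : ∀ x, Q x = ∑ k, ⟪(f k : E), Q x⟫_ℂ • (f k : E) := by
    intro x
    have h := f.sum_repr' (⟨Q x, x, rfl⟩ : R)
    have h2 := congrArg (Subtype.val) h
    simpa using h2.symm
  have hterm : ∀ i, ⟪b i, Q (b i)⟫_ℂ =
      ∑ k, ⟪ContinuousLinearMap.adjoint Q (f k : E), b i⟫_ℂ * ⟪b i, (f k : E)⟫_ℂ := by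
    intro i
    conv_lhs => rw [hexp (b i)]
    rw [inner_sum]
    simp only [inner_smul_right, ContinuousLinearMap.adjoint_inner_left]
  simp only [hterm]
  have hs := hasSum_sum (s := Finset.univ) fun (k : Fin (Module.finrank ℂ R)) _ =>
    b.hasSum_inner_mul_inner (ContinuousLinearMap.adjoint Q (f k : E)) (f k : E)
  have hone : ∀ k, ⟪ContinuousLinearMap.adjoint Q (f k : E), (f k : E)⟫_ℂ = 1 := by
    intro k
    rw [ContinuousLinearMap.adjoint_inner_left, hfix _ (f k).2]
    have := f.orthonormal.1 k
    rw [inner_self_eq_norm_sq_to_K]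
    have h2 : ‖(f k : E)‖ = 1 := this
    simp [h2]
  rw [Finset.sum_congr rfl fun k _ => hone k] at hs
  simpa using hs

lemma hasSum_trace_of_isIdempotent {Q : E →L[ℂ] E} (hQ : Q * Q = Q)
    [FiniteDimensional ℂ (LinearMap.range Q.toLinearMap)] :
    HasSum (fun i : (exists_hilbertBasis ℂ E).choose => ⟪(i : E), Q (i : E)⟫_ℂ)
      (Module.finrank ℂ (LinearMap.range Q.toLinearMap) : ℂ) := by
  obtain ⟨b, hb⟩ := (exists_hilbertBasis ℂ E).choose_spec
  have := hasSum_inner_of_isIdempotent b hQ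
  rwa [hb] at this

lemma trace_sub_of_isIdempotent {P Q : E →L[ℂ] E} (hP : P * P = P) (hQ : Q * Q = Q)
    [FiniteDimensional ℂ (LinearMap.range P.toLinearMap)]
    [FiniteDimensional ℂ (LinearMap.range Q.toLinearMap)] :
    trace (P - Q) = (Module.finrank ℂ (LinearMap.range P.toLinearMap) : ℂ)
      - (Module.finrank ℂ (LinearMap.range Q.toLinearMap) : ℂ) := by
  have := ((hasSum_trace_of_isIdempotent hP).sub (hasSum_trace_of_isIdempotent hQ)).tsum_eq
  rw [← this]
  simp [trace]

lemma adjoint_mul_self_of_isIdempotent {Q : E →L[ℂ] E} (hQ : Q * Q = Q) :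
    ContinuousLinearMap.adjoint Q * ContinuousLinearMap.adjoint Q
      = ContinuousLinearMap.adjoint Q := by
  have := congrArg star hQ
  rwa [star_mul] at this

lemma finiteDimensional_range_adjoint {Q : E →L[ℂ] E}
    [FiniteDimensional ℂ (LinearMap.range Q.toLinearMap)] :
    FiniteDimensional ℂ (LinearMap.range (ContinuousLinearMap.adjoint Q).toLinearMap) := by
  set R := LinearMap.range Q.toLinearMap with hR
  have hle : LinearMap.range (ContinuousLinearMap.adjoint Q).toLinearMap
      ≤ R.map (ContinuousLinearMap.adjoint Q).toLinearMap := by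
    rintro _ ⟨x, rfl⟩
    refine ⟨R.starProjection x, Submodule.starProjection_apply_mem R x, ?_⟩
    refine ext_inner_right ℂ fun y => ?_
    have h0 : ⟪x - R.starProjection x, Q y⟫_ℂ = 0 :=
      Submodule.starProjection_inner_eq_zero x (Q y) ⟨y, rfl⟩
    rw [inner_sub_left, sub_eq_zero] at h0
    simp [ContinuousLinearMap.adjoint_inner_left, h0]
  exact Submodule.finiteDimensional_of_le hle

lemma finrank_range_adjoint_of_isIdempotent {Q : E →L[ℂ] E} (hQ : Q * Q = Q)
    [FiniteDimensional ℂ (LinearMap.range Q.toLinearMap)] :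
    Module.finrank ℂ (LinearMap.range (ContinuousLinearMap.adjoint Q).toLinearMap)
      = Module.finrank ℂ (LinearMap.range Q.toLinearMap) := by
  have := finiteDimensional_range_adjoint (Q := Q)
  have h1 := hasSum_trace_of_isIdempotent (adjoint_mul_self_of_isIdempotent hQ)
  have h2 := (hasSum_trace_of_isIdempotent hQ).map (starRingEnd ℂ) Complex.continuous_conj
  have h3 : ((starRingEnd ℂ) ∘ fun i : (exists_hilbertBasis ℂ E).choose => ⟪(i : E), Q (i : E)⟫_ℂ)
      = fun i : (exists_hilbertBasis ℂ E).choose =>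
        ⟪(i : E), ContinuousLinearMap.adjoint Q (i : E)⟫_ℂ := by
    funext i
    simp [ContinuousLinearMap.adjoint_inner_right]
  rw [h3] at h2
  have := h1.unique h2
  simpa using this

lemma finrank_range_le_of_norm_sub_lt_one {P Q : E →L[ℂ] E} (hP : P * P = P)
    [FiniteDimensional ℂ (LinearMap.range Q.toLinearMap)] (h : ‖P - Q‖ < 1) :
    Module.finrank ℂ (LinearMap.range P.toLinearMap)
      ≤ Module.finrank ℂ (LinearMap.range Q.toLinearMap) := by
  have hinj : Function.Injective
      (Q.toLinearMap.restrict (p := LinearMap.range P.toLinearMap)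
        (q := LinearMap.range Q.toLinearMap) fun x _ => ⟨x, rfl⟩) := by
    rw [← LinearMap.ker_eq_bot, LinearMap.ker_eq_bot']
    rintro ⟨x, y, rfl⟩ hx
    have hx' : Q (P y) = 0 := congrArg Subtype.val hx
    have hPP : P (P y) = P y := by
      change (P * P) y = P y
      rw [hP]
    have h1 : ‖P y‖ ≤ ‖P - Q‖ * ‖P y‖ := by
      have := (P - Q).le_opNorm (P y)
      simpa [hx', hPP] using this
    have h2 : ‖P y‖ = 0 := by nlinarith [norm_nonneg (P y)]
    exact Subtype.ext (norm_eq_zero.1 h2)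
  exact LinearMap.finrank_le_finrank_of_injective hinj

end Projections

section Multiplicities

variable {E : Type*} [NormedAddCommGroup E] [InnerProductSpace ℂ E] [CompleteSpace E]

lemma range_le_maxGenEigenspace {A Q : E →L[ℂ] E} {a : ℂ} {k : ℕ}
    (h : (A - a • 1) ^ k * Q = 0) :
    LinearMap.range Q.toLinearMap ≤ Module.End.maxGenEigenspace (A : E →ₗ[ℂ] E) a := by
  rintro _ ⟨x, rfl⟩
  rw [Module.End.mem_maxGenEigenspace]
  refine ⟨k, ?_⟩
  have h1 := congrArg (fun B : E →L[ℂ] E => B x) h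
  have h2 : (((A : E →ₗ[ℂ] E) - a • (1 : Module.End ℂ E)) ^ k) =
      (((A - a • 1 : E →L[ℂ] E) ^ k : E →L[ℂ] E) : E →ₗ[ℂ] E) := by
    rw [ContinuousLinearMap.toLinearMap_pow]; rfl
  rw [h2]
  exact h1

lemma finiteDimensional_maxGenEigenspace {A : E →L[ℂ] E} (hA : IsCompactOperator A) {a : ℂ}
    (ha : a ≠ 0) :
    FiniteDimensional ℂ (Module.End.maxGenEigenspace (A : E →ₗ[ℂ] E) a) := by
  obtain ⟨Q, -, -, hfd, hr, -⟩ := exists_rieszProjection hA ha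
  rwa [hr] at hfd

lemma finrank_maxGenEigenspace_le_adjoint {A : E →L[ℂ] E} (hA : IsCompactOperator A)
    (hA' : IsCompactOperator (ContinuousLinearMap.adjoint A)) {a : ℂ} (ha : a ≠ 0) :
    Module.finrank ℂ (Module.End.maxGenEigenspace (A : E →ₗ[ℂ] E) a) ≤
      Module.finrank ℂ (Module.End.maxGenEigenspace
        ((ContinuousLinearMap.adjoint A : E →L[ℂ] E) : E →ₗ[ℂ] E) (starRingEnd ℂ a)) := by
  obtain ⟨Q, hQ, hcomm, hfd, hr, k, hk⟩ := exists_rieszProjection hA ha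
  rw [← hr, ← finrank_range_adjoint_of_isIdempotent hQ]
  have := finiteDimensional_maxGenEigenspace hA' (a := starRingEnd ℂ a) (by simpa using ha)
  apply Submodule.finrank_mono
  refine range_le_maxGenEigenspace (k := k) ?_
  have hc : Commute ((A - a • 1) ^ k) Q :=
    (hcomm.sub_left ((Commute.one_left Q).smul_left a)).pow_left k
  rw [hc.eq] at hk
  have := congrArg star hk
  rw [star_mul, star_pow, star_sub, star_smul, star_one, star_zero] at this
  exact this

lemma finrank_maxGenEigenspace_adjoint {A : E →L[ℂ] E} (hA : IsCompactOperator A)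
    (hA' : IsCompactOperator (ContinuousLinearMap.adjoint A)) {a : ℂ} (ha : a ≠ 0) :
    Module.finrank ℂ (Module.End.maxGenEigenspace
        ((ContinuousLinearMap.adjoint A : E →L[ℂ] E) : E →ₗ[ℂ] E) (starRingEnd ℂ a)) =
      Module.finrank ℂ (Module.End.maxGenEigenspace (A : E →ₗ[ℂ] E) a) := by
  apply le_antisymm _ (finrank_maxGenEigenspace_le_adjoint hA hA' ha)
  have := finrank_maxGenEigenspace_le_adjoint (A := ContinuousLinearMap.adjoint A) hA'
    (by simpa using hA) (a := starRingEnd ℂ a) (by simpa using ha)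
  rwa [ContinuousLinearMap.adjoint_adjoint, Complex.conj_conj] at this

lemma finrank_maxGenEigenspace_mul_comm_le {S T : E →L[ℂ] E} (hST : IsCompactOperator (S * T))
    {a : ℂ} (ha : a ≠ 0) :
    Module.finrank ℂ (Module.End.maxGenEigenspace ((T * S : E →L[ℂ] E) : E →ₗ[ℂ] E) a) ≤
      Module.finrank ℂ (Module.End.maxGenEigenspace ((S * T : E →L[ℂ] E) : E →ₗ[ℂ] E) a) := by
  have := finiteDimensional_maxGenEigenspace hST ha
  set f : Module.End ℂ E := ((T * S : E →L[ℂ] E) : E →ₗ[ℂ] E) with hf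
  set g : Module.End ℂ E := ((S * T : E →L[ℂ] E) : E →ₗ[ℂ] E) with hg
  have hintertwine : ∀ k x, ((g - a • (1 : Module.End ℂ E)) ^ k) (S x)
      = S (((f - a • (1 : Module.End ℂ E)) ^ k) x) := by
    intro k
    induction k with
    | zero => simp
    | succ k ih =>
      intro x
      rw [pow_succ, Module.End.mul_apply, pow_succ, Module.End.mul_apply, ← ih]
      congr 1
      simp [hf, hg]
  have hmaps : ∀ x ∈ Module.End.maxGenEigenspace f a, S x ∈ Module.End.maxGenEigenspace g a := by
    intro x hx
    rw [Module.End.mem_maxGenEigenspace] at hx ⊢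
    obtain ⟨k, hk⟩ := hx
    exact ⟨k, by rw [hintertwine, hk, map_zero]⟩
  have hinj : Function.Injective (S.toLinearMap.restrict hmaps) := by
    rw [← LinearMap.ker_eq_bot, LinearMap.ker_eq_bot']
    rintro ⟨x, hx⟩ hSx
    have hSx' : S x = 0 := congrArg Subtype.val hSx
    have h0 : x ∈ Module.End.maxGenEigenspace f 0 := by
      rw [Module.End.mem_maxGenEigenspace]
      exact ⟨1, by simp [hf, hSx']⟩
    have hd := Module.End.disjoint_genEigenspace f ha ⊤ ⊤
    exact Subtype.ext (by simpa using Submodule.disjoint_def.1 hd x hx h0)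
  exact LinearMap.finrank_le_finrank_of_injective hinj

lemma isUnit_one_add_mul_comm {S T : E →L[ℂ] E} (h : IsUnit (1 + S * T)) : IsUnit (1 + T * S) := by
  obtain ⟨u, hu⟩ := h
  refine ⟨⟨1 + T * S, 1 - T * (↑u⁻¹ : E →L[ℂ] E) * S, ?_, ?_⟩, rfl⟩
  · have h1 : (1 + S * T) * (↑u⁻¹ : E →L[ℂ] E) = 1 := by rw [← hu]; simp
    have : (1 + T * S) * (1 - T * (↑u⁻¹ : E →L[ℂ] E) * S)
      = 1 + T * S - T * ((1 + S * T) * (↑u⁻¹ : E →L[ℂ] E)) * S := by noncomm_ring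
    rw [this, h1]; noncomm_ring
  · have h1 : (↑u⁻¹ : E →L[ℂ] E) * (1 + S * T) = 1 := by rw [← hu]; simp
    have : (1 - T * (↑u⁻¹ : E →L[ℂ] E) * S) * (1 + T * S)
      = 1 + T * S - T * ((↑u⁻¹ : E →L[ℂ] E) * (1 + S * T)) * S := by noncomm_ring
    rw [this, h1]; noncomm_ring

variable {T J : E →L[ℂ] E} {s : ℝ}

lemma conj_mem_couplingPoles_of_adjoint (hJ : IsSelfAdjoint J) {r : ℂ}
    (hr : r ∈ couplingPoles (ContinuousLinearMap.adjoint T) J s) :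
    starRingEnd ℂ r ∈ couplingPoles T J s := by
  intro h
  apply hr
  have h1 := h.star
  have h2 : star ((1 : E →L[ℂ] E) + (starRingEnd ℂ r - (s : ℂ)) • (J ∘L T))
      = 1 + ((r - (s : ℂ)) • ContinuousLinearMap.adjoint T) * J := by
    change star ((1 : E →L[ℂ] E) + (starRingEnd ℂ r - (s : ℂ)) • (J * T)) = _
    rw [star_add, star_one, star_smul, star_mul, hJ.star_eq, smul_mul_assoc]
    simp [ContinuousLinearMap.star_eq_adjoint]
  rw [h2] at h1
  have := isUnit_one_add_mul_comm h1
  rwa [mul_smul_comm] at this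

lemma mem_couplingPoles_adjoint_iff (hJ : IsSelfAdjoint J) {r : ℂ} :
    r ∈ couplingPoles (ContinuousLinearMap.adjoint T) J s ↔
      starRingEnd ℂ r ∈ couplingPoles T J s := by
  refine ⟨conj_mem_couplingPoles_of_adjoint hJ, fun h => ?_⟩
  have := conj_mem_couplingPoles_of_adjoint (T := ContinuousLinearMap.adjoint T) hJ
    (s := s) (r := starRingEnd ℂ r) (by simpa using h)
  simpa using this

lemma ne_of_mem_couplingPoles {r : ℂ} (hr : r ∈ couplingPoles T J s) : (s : ℂ) - r ≠ 0 := by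
  intro h
  apply hr
  rw [← neg_sub, h]
  simp

lemma couplingMult_adjoint (hJ : IsSelfAdjoint J) (hT : IsCompactOperator T)
    (hT' : IsCompactOperator (ContinuousLinearMap.adjoint T)) {r : ℂ} (hr : (s : ℂ) - r ≠ 0) :
    couplingMult (ContinuousLinearMap.adjoint T) J s (starRingEnd ℂ r) = couplingMult T J s r := by
  have ha : ((s : ℂ) - r)⁻¹ ≠ 0 := inv_ne_zero hr
  have hJT : IsCompactOperator (J * T) := hT.clm_comp J
  have hTJ' : IsCompactOperator (ContinuousLinearMap.adjoint T * J) := hT'.comp_clm J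
  have hJT' : IsCompactOperator (J * ContinuousLinearMap.adjoint T) := hT'.clm_comp J
  have hadj : ContinuousLinearMap.adjoint (J * T) = ContinuousLinearMap.adjoint T * J := by
    rw [← ContinuousLinearMap.star_eq_adjoint, star_mul, hJ.star_eq,
      ContinuousLinearMap.star_eq_adjoint]
  have h1 := finrank_maxGenEigenspace_adjoint hJT (by rwa [hadj]) ha
  rw [hadj] at h1
  have hconj : (starRingEnd ℂ) (((s : ℂ) - r)⁻¹) = ((s : ℂ) - starRingEnd ℂ r)⁻¹ := by simp
  have ha' : ((s : ℂ) - starRingEnd ℂ r)⁻¹ ≠ 0 := by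
    rw [← hconj]
    exact (map_ne_zero _).2 ha
  rw [hconj] at h1
  unfold couplingMult
  exact (le_antisymm (finrank_maxGenEigenspace_mul_comm_le hTJ' ha')
    (finrank_maxGenEigenspace_mul_comm_le hJT' ha')).trans h1

lemma poleCount_adjoint (hJ : IsSelfAdjoint J) (hT : IsCompactOperator T)
    (hT' : IsCompactOperator (ContinuousLinearMap.adjoint T)) (c ε : ℝ) :
    poleCount (ContinuousLinearMap.adjoint T) J s c ε true = poleCount T J s c ε false := by
  unfold poleCount
  refine finsum_mem_eq_of_bijOn (starRingEnd ℂ) ⟨?_, ?_, ?_⟩ ?_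
  · rintro r ⟨h1, h2, h3⟩
    refine ⟨?_, by simpa using h2, (mem_couplingPoles_adjoint_iff hJ).1 h3⟩
    rw [← Complex.conj_ofReal, Complex.dist_conj_conj]
    exact h1
  · exact (starRingEnd ℂ).injective.injOn
  · rintro r ⟨h1, h2, h3⟩
    refine ⟨starRingEnd ℂ r, ⟨?_, by simpa using h2, ?_⟩, by simp⟩
    · rw [← Complex.conj_ofReal, Complex.dist_conj_conj]
      exact h1
    · rw [mem_couplingPoles_adjoint_iff hJ]
      simpa using h3
  · rintro r ⟨h1, h2, h3⟩
    have h4 := ne_of_mem_couplingPoles ((mem_couplingPoles_adjoint_iff hJ).1 h3)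
    have := couplingMult_adjoint hJ hT hT' h4
    simpa using this

end Multiplicities

section Coupling

variable {E : Type*} [NormedAddCommGroup E] [InnerProductSpace ℂ E] [CompleteSpace E]

lemma continuous_one_add_smul (A : E →L[ℂ] E) (s : ℂ) :
    Continuous fun r : ℂ => (1 : E →L[ℂ] E) + (r - s) • A := by
  fun_prop

lemma isOpen_setOf_isUnit_one_add_smul (A : E →L[ℂ] E) (s : ℂ) :
    IsOpen {r : ℂ | IsUnit ((1 : E →L[ℂ] E) + (r - s) • A)} :=
  Units.isOpen.preimage (continuous_one_add_smul A s)

lemma mem_maxGenEigenspace_of_add_smul_eq_zero {A : E →L[ℂ] E} {u : ℂ} (hu : u ≠ 0) {x : E}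
    (hx : x + u • A x = 0) : x ∈ Module.End.maxGenEigenspace (A : E →ₗ[ℂ] E) (-u)⁻¹ := by
  rw [Module.End.mem_maxGenEigenspace]
  refine ⟨1, ?_⟩
  have h1 : x = -(u • A x) := eq_neg_of_add_eq_zero_left hx
  have h2 : (-u)⁻¹ • x = A x := by
    conv_lhs => rw [h1]
    rw [← neg_smul, smul_smul, inv_mul_cancel₀ (neg_ne_zero.2 hu), one_smul]
  have h3 : ((A : E →ₗ[ℂ] E) - (-u)⁻¹ • (1 : Module.End ℂ E)) x = A x - (-u)⁻¹ • x := rfl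
  rw [pow_one, h3, h2, sub_self]

lemma isUnit_one_add_smul_mul_one_sub {A Q : E →L[ℂ] E} (hA : IsCompactOperator A)
    (hQ : Q * Q = Q) (hc : Commute A Q) {u : ℂ} (hker : ∀ x, x + u • A x = 0 → Q x = x) :
    IsUnit (1 + u • (A * (1 - Q))) := by
  have hcomp : IsCompactOperator (u • (A * (1 - Q)) : E →L[ℂ] E) :=
    (hA.comp_clm (1 - Q)).smul u
  refine isUnit_one_add_of_isCompactOperator hcomp fun x hx => ?_
  have hQA : ∀ y, Q (A y) = A (Q y) := fun y =>
    (congrArg (fun B : E →L[ℂ] E => B y) hc.eq).symm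
  have hQQ : ∀ y, Q (Q y) = Q y := fun y => congrArg (fun B : E →L[ℂ] E => B y) hQ
  have hx' : x + u • A (x - Q x) = 0 := by simpa using hx
  have hQx : Q x = 0 := by
    have := congrArg Q hx'
    simpa [hQA, hQQ] using this
  rw [hQx, sub_zero] at hx'
  rw [← hker x hx', hQx]

/-- The poles of the coupling constant are isolated. -/
lemma eventually_isUnit_one_add_smul {A : E →L[ℂ] E} (hA : IsCompactOperator A) (s p : ℂ) :
    ∀ᶠ r in 𝓝[≠] p, IsUnit ((1 : E →L[ℂ] E) + (r - s) • A) := by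
  by_cases hps : p = s
  · subst hps
    refine Filter.Eventually.filter_mono nhdsWithin_le_nhds ?_
    exact (isOpen_setOf_isUnit_one_add_smul A p).mem_nhds (by simp)
  have hu : p - s ≠ 0 := sub_ne_zero.2 hps
  have ha : (-(p - s))⁻¹ ≠ 0 := inv_ne_zero (neg_ne_zero.2 hu)
  obtain ⟨Q, hQ, hcomm, -, hr, -⟩ := exists_rieszProjection hA ha
  have hQA : ∀ y, Q (A y) = A (Q y) := fun y =>
    (congrArg (fun B : E →L[ℂ] E => B y) hcomm.eq).symm
  have hQQ : ∀ y, Q (Q y) = Q y := fun y => congrArg (fun B : E →L[ℂ] E => B y) hQ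
  have hunit : IsUnit ((1 : E →L[ℂ] E) + (p - s) • (A * (1 - Q))) := by
    refine isUnit_one_add_smul_mul_one_sub hA hQ hcomm fun x hx => ?_
    have := mem_maxGenEigenspace_of_add_smul_eq_zero hu hx
    rw [← hr] at this
    obtain ⟨y, rfl⟩ := this
    exact hQQ y
  have hnear := (isOpen_setOf_isUnit_one_add_smul (A * (1 - Q)) s).mem_nhds hunit
  filter_upwards [nhdsWithin_le_nhds hnear, self_mem_nhdsWithin] with r hr1 hr2
  by_cases hrs : r - s = 0
  · simp [hrs]
  refine isUnit_one_add_of_isCompactOperator (hA.smul (r - s)) fun x hx => ?_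
  have hx' : x + (r - s) • A x = 0 := hx
  have hy : (1 + (r - s) • (A * (1 - Q)) : E →L[ℂ] E) (x - Q x) = 0 := by
    have := congrArg Q hx'
    simp only [map_add, map_smul, hQA, map_zero] at this
    have h3 : (1 + (r - s) • (A * (1 - Q)) : E →L[ℂ] E) (x - Q x)
        = (x + (r - s) • A x) - (Q x + (r - s) • A (Q x)) := by
      simp [hQQ, smul_sub]
      abel
    rw [h3, hx', this, sub_zero]
  have hxQ : x - Q x = 0 := by
    obtain ⟨v, hv⟩ := hr1
    have h4 : (↑v⁻¹ * ↑v : E →L[ℂ] E) (x - Q x) = 0 := by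
      rw [hv, mul_apply_eq_comp, hy, map_zero]
    simpa using h4
  have hx1 : x ∈ Module.End.maxGenEigenspace (A : E →ₗ[ℂ] E) (-(p - s))⁻¹ := by
    rw [← hr]
    exact ⟨x, (sub_eq_zero.1 hxQ).symm⟩
  have hx2 := mem_maxGenEigenspace_of_add_smul_eq_zero hrs hx'
  have hne : (-(p - s))⁻¹ ≠ (-(r - s))⁻¹ := by
    intro h
    have h5 := neg_injective (inv_injective h)
    exact hr2 (sub_left_injective h5).symm
  have hd := Module.End.disjoint_genEigenspace (A : E →ₗ[ℂ] E) hne ⊤ ⊤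
  exact Submodule.disjoint_def.1 hd x hx1 hx2

lemma finite_poles_inter_of_isCompact {A : E →L[ℂ] E} (hA : IsCompactOperator A) (s : ℂ)
    {K : Set ℂ} (hK : IsCompact K) :
    {r : ℂ | r ∈ K ∧ ¬ IsUnit ((1 : E →L[ℂ] E) + (r - s) • A)}.Finite := by
  by_contra hinf
  obtain ⟨p, -, hp⟩ := Set.Infinite.exists_accPt_of_subset_isCompact hinf hK fun r hr => hr.1
  have h := accPt_iff_frequently_nhdsNE.1 hp
  exact h ((eventually_isUnit_one_add_smul hA s p).mono fun r hr hr' => hr'.2 hr)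

section OrthogonalFamily

variable {ι : Type*} {Q : ι → E →L[ℂ] E} {S : Finset ι}

lemma sum_mul_of_pairwise_mul_eq_zero (hQ : ∀ i ∈ S, Q i * Q i = Q i)
    (ho : ∀ i ∈ S, ∀ j ∈ S, i ≠ j → Q i * Q j = 0) {i : ι} (hi : i ∈ S) :
    (∑ j ∈ S, Q j) * Q i = Q i := by
  rw [Finset.sum_mul, Finset.sum_eq_single_of_mem i hi fun j hj hji => ho j hj i hi hji, hQ i hi]

lemma sum_isIdempotent_of_pairwise_mul_eq_zero (hQ : ∀ i ∈ S, Q i * Q i = Q i)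
    (ho : ∀ i ∈ S, ∀ j ∈ S, i ≠ j → Q i * Q j = 0) :
    (∑ j ∈ S, Q j) * (∑ j ∈ S, Q j) = ∑ j ∈ S, Q j := by
  conv_lhs => rw [Finset.mul_sum]
  exact Finset.sum_congr rfl fun i hi => sum_mul_of_pairwise_mul_eq_zero hQ ho hi

lemma finiteDimensional_range_sum
    (hf : ∀ i ∈ S, FiniteDimensional ℂ (LinearMap.range (Q i).toLinearMap)) :
    FiniteDimensional ℂ (LinearMap.range (∑ j ∈ S, Q j).toLinearMap) := by
  have hle : LinearMap.range (∑ j ∈ S, Q j).toLinearMap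
      ≤ ⨆ i : S, LinearMap.range (Q i).toLinearMap := by
    rintro _ ⟨x, rfl⟩
    have : (∑ j ∈ S, Q j).toLinearMap x = ∑ j ∈ S, Q j x := by simp
    rw [this]
    refine Submodule.sum_mem _ fun i hi => ?_
    exact Submodule.mem_iSup_of_mem (⟨i, hi⟩ : S) ⟨x, rfl⟩
  have : ∀ i : S, FiniteDimensional ℂ (LinearMap.range (Q i).toLinearMap) := fun i => hf i i.2
  exact Submodule.finiteDimensional_of_le hle

lemma finrank_range_sum (hQ : ∀ i ∈ S, Q i * Q i = Q i)
    (ho : ∀ i ∈ S, ∀ j ∈ S, i ≠ j → Q i * Q j = 0)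
    (hf : ∀ i ∈ S, FiniteDimensional ℂ (LinearMap.range (Q i).toLinearMap)) :
    Module.finrank ℂ (LinearMap.range (∑ j ∈ S, Q j).toLinearMap)
      = ∑ j ∈ S, Module.finrank ℂ (LinearMap.range (Q j).toLinearMap) := by
  have := finiteDimensional_range_sum hf
  have h1 := hasSum_trace_of_isIdempotent (sum_isIdempotent_of_pairwise_mul_eq_zero hQ ho)
  have h2 := hasSum_sum (s := S) fun i hi =>
    @hasSum_trace_of_isIdempotent E _ _ _ (Q i) (hQ i hi) (hf i hi)
  have h3 := h1.unique (by simpa [sum_apply, inner_sum] using h2)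
  exact_mod_cast h3

end OrthogonalFamily

variable {A : E →L[ℂ] E} {s : ℂ} {c ε : ℝ}

lemma continuousOn_mul_inverse {K : Set ℂ}
    (hb : ∀ r ∈ K, IsUnit ((1 : E →L[ℂ] E) + (r - s) • A)) :
    ContinuousOn (fun r : ℂ => A * Ring.inverse ((1 : E →L[ℂ] E) + (r - s) • A)) K := by
  intro r hr
  refine ContinuousAt.continuousWithinAt ?_
  refine continuousAt_const.mul ?_
  obtain ⟨v, hv⟩ := hb r hr
  have h1 : ContinuousAt Ring.inverse ((1 : E →L[ℂ] E) + (r - s) • A) := by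
    rw [← hv]; exact NormedRing.inverse_continuousAt v
  exact ContinuousAt.comp (f := fun r : ℂ => (1 : E →L[ℂ] E) + (r - s) • A) h1
    (continuous_one_add_smul A s).continuousAt

lemma halfDiscIntegral_smul_const (hε : 0 < ε) {g : ℂ → ℂ}
    (hg : ContinuousOn g (halfDiscBoundary c ε)) (X : E →L[ℂ] E) :
    halfDiscIntegral (fun r => g r • X) c ε = halfDiscIntegral g c ε • X :=
  halfDiscIntegral_clm (ContinuousLinearMap.toSpanSingleton ℂ X) hε hg

/-- Residue computation on a generalised eigenspace. -/
lemma halfDiscIntegral_mul_inverse_mul (hε : 0 < ε)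
    (hb : ∀ r ∈ halfDiscBoundary c ε, IsUnit ((1 : E →L[ℂ] E) + (r - s) • A))
    {p : ℂ} (hp : p ∉ halfDiscBoundary c ε) (k : ℕ) :
    ∀ X : E →L[ℂ] E, ((1 : E →L[ℂ] E) + (p - s) • A) ^ k * X = 0 → ∀ j : ℕ,
      halfDiscIntegral (fun r => ((r - p) ^ j)⁻¹ •
        (A * Ring.inverse ((1 : E →L[ℂ] E) + (r - s) • A) * X)) c ε
      = if j = 0 then halfDiscIntegral (fun r : ℂ => (r - p)⁻¹) c ε • X else 0 := by
  have hcf := continuousOn_mul_inverse hb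
  set f : ℂ → E →L[ℂ] E := fun r => A * Ring.inverse ((1 : E →L[ℂ] E) + (r - s) • A) with hf
  set D : E →L[ℂ] E := (1 : E →L[ℂ] E) + (p - s) • A with hD
  induction k with
  | zero =>
    intro X hX j
    have hX0 : X = 0 := by simpa using hX
    subst hX0
    simp [halfDiscIntegral]
  | succ k ih =>
    intro X hX j
    have hDX : D ^ k * (D * X) = 0 := by rw [← mul_assoc, ← pow_succ, hX]
    have key : ∀ r ∈ halfDiscBoundary c ε, ((r - p) ^ j)⁻¹ • (f r * X)
        = ((r - p) ^ (j + 1))⁻¹ • (X - D * X) + (((r - p) ^ j)⁻¹ • (f r * (D * X))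
          + (p - s) • (((r - p) ^ (j + 1))⁻¹ • (f r * (D * X)))) := by
      intro r hr
      have hne : r - p ≠ 0 := by
        rw [sub_ne_zero]
        rintro rfl
        exact hp hr
      have hfd : f r * (1 + (r - s) • A) = A := by
        rw [hf]
        dsimp only
        rw [mul_assoc, Ring.inverse_mul_cancel _ (hb r hr), mul_one]
      have h1 : f r + (r - s) • (f r * A) = A := by
        rwa [mul_add, mul_one, mul_smul_comm] at hfd
      have h2 : (r - p) • (f r * X) = (X - D * X) + ((r - p) • (f r * (D * X))
          + (p - s) • (f r * (D * X))) := by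
        have h3 : f r * (D * X) = f r * X + (p - s) • (f r * A * X) := by
          rw [hD, add_mul, one_mul, mul_add, smul_mul_assoc, mul_smul_comm, mul_assoc (f r)]
        have h4 : D * X = X + (p - s) • (A * X) := by
          rw [hD, add_mul, one_mul, smul_mul_assoc]
        have h5 : A * X = f r * X + (r - s) • (f r * A * X) := by
          conv_lhs => rw [← h1]
          rw [add_mul, smul_mul_assoc]
        rw [h3, h4, h5]
        module
      have h6 : f r * X = (r - p)⁻¹ • ((X - D * X) + ((r - p) • (f r * (D * X))
          + (p - s) • (f r * (D * X)))) := by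
        rw [← h2, smul_smul, inv_mul_cancel₀ hne, one_smul]
      rw [h6]
      rw [pow_succ, mul_inv]
      simp only [smul_add, smul_smul]
      congr 2
      · congr 1
        field_simp
      · congr 1
        ring
    rw [halfDiscIntegral_congr hε key]
    have hcp : ∀ (i : ℕ) (Y : E →L[ℂ] E), ContinuousOn
        (fun r => ((r - p) ^ i)⁻¹ • (f r * Y)) (halfDiscBoundary c ε) := fun i Y =>
      (continuousOn_sub_pow_inv hp i).smul (hcf.mul continuousOn_const)
    have hc1 : ContinuousOn (fun r => ((r - p) ^ (j + 1))⁻¹ • (X - D * X))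
        (halfDiscBoundary c ε) := (continuousOn_sub_pow_inv hp (j + 1)).smul continuousOn_const
    have hc2 : ContinuousOn (fun r => (p - s) • (((r - p) ^ (j + 1))⁻¹ • (f r * (D * X))))
        (halfDiscBoundary c ε) := (hcp (j + 1) _).const_smul (p - s)
    have hc3 : ContinuousOn (fun r => ((r - p) ^ j)⁻¹ • (f r * (D * X))
        + (p - s) • (((r - p) ^ (j + 1))⁻¹ • (f r * (D * X))))
        (halfDiscBoundary c ε) := (hcp j _).add hc2
    rw [halfDiscIntegral_add hε hc1 hc3, halfDiscIntegral_add hε (hcp j _) hc2,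
      halfDiscIntegral_smul, ih _ hDX, ih _ hDX,
      halfDiscIntegral_smul_const hε (continuousOn_sub_pow_inv hp (j + 1))]
    cases j with
    | zero =>
      simp only [zero_add, pow_one, if_true, one_ne_zero, if_false, smul_zero, add_zero, ← smul_add]
      congr 1
      abel
    | succ j =>
      rw [halfDiscIntegral_sub_pow_inv hε hp j]
      simp

lemma halfDiscIntegral_zero_fun : halfDiscIntegral (fun _ : ℂ => (0 : E →L[ℂ] E)) c ε = 0 := by
  simp [halfDiscIntegral]

lemma halfDiscIntegral_sum (hε : 0 < ε) {ι : Type*} (S : Finset ι) {g : ι → ℂ → E →L[ℂ] E}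
    (hg : ∀ i ∈ S, ContinuousOn (g i) (halfDiscBoundary c ε)) :
    halfDiscIntegral (fun r => ∑ i ∈ S, g i r) c ε = ∑ i ∈ S, halfDiscIntegral (g i) c ε := by
  classical
  induction S using Finset.induction_on with
  | empty => simpa using halfDiscIntegral_zero_fun
  | insert i S hi ih =>
    simp only [Finset.sum_insert hi]
    rw [halfDiscIntegral_add hε (hg i (Finset.mem_insert_self i S))
      (continuousOn_finsetSum S fun j hj => hg j (Finset.mem_insert_of_mem hj)),
      ih fun j hj => hg j (Finset.mem_insert_of_mem hj)]

lemma one_add_pow_mul_eq_zero {Q : E →L[ℂ] E} {u : ℂ} (hu : u ≠ 0) {k : ℕ}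
    (h : (A - (-u)⁻¹ • 1) ^ k * Q = 0) : ((1 : E →L[ℂ] E) + u • A) ^ k * Q = 0 := by
  have h1 : (1 : E →L[ℂ] E) + u • A = u • (A - (-u)⁻¹ • 1) := by
    rw [smul_sub, smul_smul, inv_neg, mul_neg, mul_inv_cancel₀ hu]
    module
  rw [h1, smul_pow, smul_mul_assoc, h, smul_zero]

/-- Off the generalised eigenspaces of the enclosed poles the integrand is holomorphic. -/
lemma halfDiscIntegral_mul_inverse_mul_one_sub (hε : 0 < ε)
    (hb : ∀ r ∈ halfDiscBoundary c ε, IsUnit ((1 : E →L[ℂ] E) + (r - s) • A))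
    {Q : E →L[ℂ] E} (hQ : Q * Q = Q) (hc : Commute A Q)
    (hu : ∀ r ∈ Metric.closedBall (c : ℂ) ε,
      IsUnit ((1 : E →L[ℂ] E) + (r - s) • (A * (1 - Q)))) :
    halfDiscIntegral (fun r =>
      A * Ring.inverse ((1 : E →L[ℂ] E) + (r - s) • A) * (1 - Q)) c ε = 0 := by
  have hcongr : ∀ r ∈ halfDiscBoundary c ε,
      A * Ring.inverse ((1 : E →L[ℂ] E) + (r - s) • A) * (1 - Q)
        = A * (1 - Q) * Ring.inverse ((1 : E →L[ℂ] E) + (r - s) • (A * (1 - Q))) := by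
    intro r hr
    have hD := hb r hr
    have hD' := hu r (halfDiscBoundary_subset_closedBall hε hr)
    have hAQ : A * (1 - Q) = (1 - Q) * A := (((Commute.one_right A).sub_right hc)).eq
    have hQ1 : (1 - Q) * (1 - Q) = 1 - Q := by
      have : (1 - Q) * (1 - Q) = 1 - Q - Q + Q * Q := by noncomm_ring
      rw [this, hQ]; abel
    have h1 : (1 - Q) * ((1 : E →L[ℂ] E) + (r - s) • (A * (1 - Q)))
        = ((1 : E →L[ℂ] E) + (r - s) • A) * (1 - Q) := by
      rw [mul_add, add_mul, mul_smul_comm, smul_mul_assoc, hAQ, ← mul_assoc, hQ1, mul_one, one_mul]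
    have h2 : Ring.inverse ((1 : E →L[ℂ] E) + (r - s) • A) * (1 - Q)
        = (1 - Q) * Ring.inverse ((1 : E →L[ℂ] E) + (r - s) • (A * (1 - Q))) := by
      calc Ring.inverse ((1 : E →L[ℂ] E) + (r - s) • A) * (1 - Q)
          = Ring.inverse ((1 : E →L[ℂ] E) + (r - s) • A) *
            ((1 - Q) * ((1 : E →L[ℂ] E) + (r - s) • (A * (1 - Q)))) *
              Ring.inverse ((1 : E →L[ℂ] E) + (r - s) • (A * (1 - Q))) := by
            rw [mul_assoc, mul_assoc (1 - Q), Ring.mul_inverse_cancel _ hD', mul_one]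
        _ = (1 - Q) * Ring.inverse ((1 : E →L[ℂ] E) + (r - s) • (A * (1 - Q))) := by
            rw [h1, ← mul_assoc (Ring.inverse _), Ring.inverse_mul_cancel _ hD, one_mul]
    rw [mul_assoc, h2, mul_assoc]
  rw [halfDiscIntegral_congr hε hcongr]
  obtain ⟨δ, hδ, hsub⟩ := (isCompact_closedBall (c : ℂ) ε).exists_thickening_subset_open
    (isOpen_setOf_isUnit_one_add_smul (A * (1 - Q)) s) hu
  rw [thickening_closedBall hδ hε.le] at hsub
  refine halfDiscIntegral_eq_zero_of_differentiableOn (δ := δ + ε) hε (by linarith) ?_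
  refine DifferentiableOn.const_mul (DifferentiableOn.inverse (by fun_prop) fun r hr => hsub hr) _

/-- The contour integral of `r ↦ A (1 + (r - s) A)⁻¹` around the upper half-disc is `2πi` times
the idempotent onto the generalised eigenspaces of the enclosed poles. -/
lemma exists_isIdempotent_halfDiscIntegral (hA : IsCompactOperator A) (hε : 0 < ε)
    (hb : ∀ r ∈ halfDiscBoundary c ε, IsUnit ((1 : E →L[ℂ] E) + (r - s) • A)) :
    ∃ P : E →L[ℂ] E, P * P = P ∧ FiniteDimensional ℂ (LinearMap.range P.toLinearMap) ∧
      halfDiscIntegral (fun r => A * Ring.inverse ((1 : E →L[ℂ] E) + (r - s) • A)) c ε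
        = (2 * π * Complex.I) • P ∧
      Module.finrank ℂ (LinearMap.range P.toLinearMap)
        = ∑ᶠ r ∈ {r : ℂ | dist r (c : ℂ) < ε ∧ 0 < r.im ∧
            ¬ IsUnit ((1 : E →L[ℂ] E) + (r - s) • A)},
          Module.finrank ℂ (Module.End.maxGenEigenspace (A : E →ₗ[ℂ] E) ((s - r)⁻¹)) := by
  classical
  set S : Finset ℂ := (finite_poles_inter_of_isCompact hA s
    (isCompact_closedBall (c : ℂ) ε)).toFinset with hS
  have hmem : ∀ p, p ∈ S ↔ p ∈ Metric.closedBall (c : ℂ) ε ∧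
      ¬ IsUnit ((1 : E →L[ℂ] E) + (p - s) • A) := by
    intro p
    rw [hS, Set.Finite.mem_toFinset]
    rfl
  have hne : ∀ p ∈ S, p - s ≠ 0 := by
    intro p hp h
    apply ((hmem p).1 hp).2
    simp [h]
  have hpb : ∀ p ∈ S, p ∉ halfDiscBoundary c ε := fun p hp h => ((hmem p).1 hp).2 (hb p h)
  have hex : ∀ p, ∃ Q : E →L[ℂ] E, p ∈ S → Q * Q = Q ∧ Commute A Q ∧
      FiniteDimensional ℂ (LinearMap.range Q.toLinearMap) ∧
      LinearMap.range Q.toLinearMap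
        = Module.End.maxGenEigenspace (A : E →ₗ[ℂ] E) (-(p - s))⁻¹ ∧
      ∃ k, (A - (-(p - s))⁻¹ • 1) ^ k * Q = 0 := by
    intro p
    by_cases hp : p ∈ S
    · obtain ⟨Q, hQ⟩ := exists_rieszProjection hA (inv_ne_zero (neg_ne_zero.2 (hne p hp)))
      exact ⟨Q, fun _ => hQ⟩
    · exact ⟨0, fun h => absurd h hp⟩
  choose Q hQ using hex
  have hQQ : ∀ p ∈ S, Q p * Q p = Q p := fun p hp => (hQ p hp).1
  have hQA : ∀ p ∈ S, Commute A (Q p) := fun p hp => (hQ p hp).2.1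
  have hQf : ∀ p ∈ S, FiniteDimensional ℂ (LinearMap.range (Q p).toLinearMap) :=
    fun p hp => (hQ p hp).2.2.1
  have hQr : ∀ p ∈ S, LinearMap.range (Q p).toLinearMap
      = Module.End.maxGenEigenspace (A : E →ₗ[ℂ] E) (-(p - s))⁻¹ := fun p hp => (hQ p hp).2.2.2.1
  have hQk : ∀ p ∈ S, ∃ k, (A - (-(p - s))⁻¹ • 1) ^ k * Q p = 0 := fun p hp => (hQ p hp).2.2.2.2
  have hQo : ∀ p ∈ S, ∀ q ∈ S, p ≠ q → Q p * Q q = 0 := by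
    intro p hp q hq hpq
    ext x
    have hne' : (-(p - s))⁻¹ ≠ (-(q - s))⁻¹ := fun h =>
      hpq (sub_left_injective (neg_injective (inv_injective h)))
    have hd := Module.End.disjoint_genEigenspace (A : E →ₗ[ℂ] E) hne' ⊤ ⊤
    refine Submodule.disjoint_def.1 hd _ ?_ ?_
    · change (Q p * Q q) x ∈ Module.End.maxGenEigenspace (A : E →ₗ[ℂ] E) (-(p - s))⁻¹
      rw [← hQr p hp]
      exact ⟨Q q x, rfl⟩
    · have hcomm : Commute (A : Module.End ℂ E) ((Q p : E →L[ℂ] E) : Module.End ℂ E) := by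
        have := congrArg (fun B : E →L[ℂ] E => (B : E →ₗ[ℂ] E)) (hQA p hp).eq
        exact this
      refine Module.End.mapsTo_maxGenEigenspace_of_comm hcomm _ ?_
      rw [← hQr q hq]
      exact ⟨x, rfl⟩
  have hsum : (∑ p ∈ S, Q p) * (∑ p ∈ S, Q p) = ∑ p ∈ S, Q p :=
    sum_isIdempotent_of_pairwise_mul_eq_zero hQQ hQo
  have hcsum : Commute A (∑ p ∈ S, Q p) := Commute.sum_right _ _ _ hQA
  have hunit : ∀ r ∈ Metric.closedBall (c : ℂ) ε,
      IsUnit ((1 : E →L[ℂ] E) + (r - s) • (A * (1 - ∑ p ∈ S, Q p))) := by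
    intro r hr
    refine isUnit_one_add_smul_mul_one_sub hA hsum hcsum fun x hx => ?_
    by_cases hrS : r ∈ S
    · have hx' := mem_maxGenEigenspace_of_add_smul_eq_zero (hne r hrS) hx
      rw [← hQr r hrS] at hx'
      obtain ⟨y, rfl⟩ := hx'
      exact congrArg (fun B : E →L[ℂ] E => B y) (sum_mul_of_pairwise_mul_eq_zero hQQ hQo hrS)
    · have hu : IsUnit ((1 : E →L[ℂ] E) + (r - s) • A) := by
        by_contra h
        exact hrS ((hmem r).2 ⟨hr, h⟩)
      obtain ⟨v, hv⟩ := hu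
      have hx0 : x = 0 := by
        have h4 : (↑v⁻¹ * ↑v : E →L[ℂ] E) x = 0 := by
          have h5 : (v : E →L[ℂ] E) x = 0 := by rw [hv]; exact hx
          rw [mul_apply_eq_comp, h5, map_zero]
        simpa using h4
      rw [hx0, map_zero]
  have hcf := continuousOn_mul_inverse hb
  set f : ℂ → E →L[ℂ] E := fun r => A * Ring.inverse ((1 : E →L[ℂ] E) + (r - s) • A) with hf
  have hres : ∀ p ∈ S, halfDiscIntegral (fun r => f r * Q p) c ε
      = if 0 < p.im then (2 * π * Complex.I : ℂ) • Q p else 0 := by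
    intro p hp
    obtain ⟨k, hk⟩ := hQk p hp
    have h1 := halfDiscIntegral_mul_inverse_mul hε hb (hpb p hp) k (Q p)
      (one_add_pow_mul_eq_zero (hne p hp) hk) 0
    simp only [pow_zero, inv_one, one_smul, if_true] at h1
    rw [hf, h1]
    have hpc := ((hmem p).1 hp).1
    rcases lt_trichotomy p.im 0 with him | him | him
    · rw [halfDiscIntegral_sub_inv_of_im_neg hε him, zero_smul, if_neg (not_lt.2 him.le)]
    · exfalso
      apply hpb p hp
      have hpre : p = (p.re : ℂ) := Complex.ext rfl (by simpa using him)
      rw [hpre] at hpc ⊢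
      apply ofReal_mem_halfDiscBoundary hε
      rw [uIcc_of_le (by linarith)]
      rw [Metric.mem_closedBall, dist_eq_norm, ← Complex.ofReal_sub, Complex.norm_real,
        Real.norm_eq_abs, abs_le] at hpc
      exact ⟨by linarith [hpc.1], by linarith [hpc.2]⟩
    · rw [halfDiscIntegral_sub_inv_of_mem_ball hε him, if_pos him]
      rw [Metric.mem_ball]
      refine lt_of_le_of_ne hpc fun h => ?_
      exact hpb p hp (mem_halfDiscBoundary_of_norm_eq him.le h)
  have hsub : ∀ p ∈ S.filter (fun p => 0 < p.im), p ∈ S := fun p hp => (Finset.mem_filter.1 hp).1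
  refine ⟨∑ p ∈ S.filter (fun p => 0 < p.im), Q p,
    sum_isIdempotent_of_pairwise_mul_eq_zero (fun p hp => hQQ p (hsub p hp))
      (fun p hp q hq => hQo p (hsub p hp) q (hsub q hq)),
    finiteDimensional_range_sum fun p hp => hQf p (hsub p hp), ?_, ?_⟩
  · have hdec : ∀ r, f r = f r * (1 - ∑ p ∈ S, Q p) + ∑ p ∈ S, f r * Q p := by
      intro r
      rw [← Finset.mul_sum, ← mul_add, sub_add_cancel, mul_one]
    have hcm : ∀ X : E →L[ℂ] E, ContinuousOn (fun r => f r * X) (halfDiscBoundary c ε) :=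
      fun X => hcf.mul continuousOn_const
    have hzero : halfDiscIntegral (fun r => f r * (1 - ∑ p ∈ S, Q p)) c ε = 0 :=
      halfDiscIntegral_mul_inverse_mul_one_sub hε hb hsum hcsum hunit
    rw [halfDiscIntegral_congr hε fun r _ => hdec r,
      halfDiscIntegral_add hε (hcm _) (continuousOn_finsetSum S fun p _ => hcm _),
      halfDiscIntegral_sum hε S (fun p _ => hcm _), hzero, zero_add,
      Finset.sum_congr rfl hres, ← Finset.sum_filter, Finset.smul_sum]
  · rw [finrank_range_sum (fun p hp => hQQ p (hsub p hp))
      (fun p hp q hq => hQo p (hsub p hp) q (hsub q hq)) fun p hp => hQf p (hsub p hp)]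
    have hset : {r : ℂ | dist r (c : ℂ) < ε ∧ 0 < r.im ∧
        ¬ IsUnit ((1 : E →L[ℂ] E) + (r - s) • A)} = ↑(S.filter (fun p => 0 < p.im)) := by
      ext r
      simp only [Finset.coe_filter, mem_ofPred_eq, hmem, Metric.mem_closedBall]
      refine ⟨fun h => ⟨⟨h.1.le, h.2.2⟩, h.2.1⟩, fun h => ⟨?_, h.2, h.1.2⟩⟩
      refine lt_of_le_of_ne h.1.1 fun h' => ?_
      exact h.1.2 (hb r (mem_halfDiscBoundary_of_norm_eq h.2.le h'))
    rw [hset, finsum_mem_coe_finset]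
    refine Finset.sum_congr rfl fun p hp => ?_
    rw [hQr p (hsub p hp), neg_sub]

end Coupling

section Resolvent

variable {G : Type*} [NormedAddCommGroup G] [InnerProductSpace ℂ G] [CompleteSpace G]
variable {E : Type*} [NormedAddCommGroup E] [InnerProductSpace ℂ E] [CompleteSpace E]

lemma SelfAdjointOperator.adjoint_resolvent (H : SelfAdjointOperator G) {z : ℂ} (hz : z.im ≠ 0) :
    ContinuousLinearMap.adjoint (H.resolvent z) = H.resolvent (starRingEnd ℂ z) := by
  have hz' : (starRingEnd ℂ z).im ≠ 0 := by simpa using hz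
  symm
  rw [ContinuousLinearMap.eq_adjoint_iff]
  intro g f
  have hf := H.resolvent_right z hz f
  have hg := H.resolvent_right _ hz' g
  have hsym := H.symmetric ⟨_, H.resolvent_mem _ hz' g⟩ ⟨_, H.resolvent_mem z hz f⟩
  conv_lhs => rw [← hf]
  conv_rhs => rw [← hg]
  rw [inner_sub_right, inner_sub_left, hsym, inner_smul_left, inner_smul_right]
  simp

lemma SelfAdjointOperator.resolvent_identity (H : SelfAdjointOperator G) {z w : ℂ}
    (hz : z.im ≠ 0) (hw : w.im ≠ 0) :
    H.resolvent z = H.resolvent w + (z - w) • (H.resolvent w * H.resolvent z) := by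
  ext f
  have hf := H.resolvent_right z hz f
  have h := H.resolvent_left w hw ⟨_, H.resolvent_mem z hz f⟩
  rw [sub_eq_iff_eq_add] at hf
  rw [hf] at h
  simp only [map_sub, map_add, map_smul] at h
  simp only [add_apply, smul_apply, mul_apply_eq_comp]
  rw [sub_smul]
  conv_lhs => rw [← h]
  abel

lemma SelfAdjointOperator.continuousAt_resolvent (H : SelfAdjointOperator G) {w : ℂ}
    (hw : w.im ≠ 0) : ContinuousAt H.resolvent w := by
  have hev : ∀ᶠ z in 𝓝 w, H.resolvent z
      = Ring.inverse (1 - (z - w) • H.resolvent w) * H.resolvent w := by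
    have h1 : ∀ᶠ z in 𝓝 w, z.im ≠ 0 :=
      (isOpen_ne.preimage Complex.continuous_im).mem_nhds hw
    have h2 : ∀ᶠ z in 𝓝 w, IsUnit ((1 : G →L[ℂ] G) - (z - w) • H.resolvent w) := by
      have hc : Continuous fun z : ℂ => (1 : G →L[ℂ] G) - (z - w) • H.resolvent w := by fun_prop
      exact (Units.isOpen.preimage hc).mem_nhds (by simp)
    filter_upwards [h1, h2] with z hz hu
    have h3 : (1 - (z - w) • H.resolvent w) * H.resolvent z = H.resolvent w := by
      rw [sub_mul, one_mul, smul_mul_assoc, sub_eq_iff_eq_add]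
      exact H.resolvent_identity hz hw
    calc H.resolvent z = Ring.inverse (1 - (z - w) • H.resolvent w) *
          ((1 - (z - w) • H.resolvent w) * H.resolvent z) := by
          rw [← mul_assoc, Ring.inverse_mul_cancel _ hu, one_mul]
      _ = _ := by rw [h3]
  refine ContinuousAt.congr ?_ (hev.mono fun z hz => hz.symm)
  refine ContinuousAt.mul ?_ continuousAt_const
  have hc : ContinuousAt (fun z : ℂ => (1 : G →L[ℂ] G) - (z - w) • H.resolvent w) w := by fun_prop
  have h1 : ContinuousAt Ring.inverse ((1 : G →L[ℂ] G) - (w - w) • H.resolvent w) := by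
    have := NormedRing.inverse_continuousAt (1 : (G →L[ℂ] G)ˣ)
    simpa using this
  exact ContinuousAt.comp (f := fun z : ℂ => (1 : G →L[ℂ] G) - (z - w) • H.resolvent w) h1 hc

lemma isSelfAdjoint_sandwich (F : G →L[ℂ] E) {J : E →L[ℂ] E} (hJ : IsSelfAdjoint J) :
    ContinuousLinearMap.adjoint (sandwich F J) = sandwich F J := by
  unfold sandwich
  rw [ContinuousLinearMap.adjoint_comp, ContinuousLinearMap.adjoint_comp,
    ContinuousLinearMap.adjoint_adjoint, hJ.adjoint_eq]
  rfl

/-- The second resolvent identity with the factors in the other order. -/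
lemma IsSum.resolvent_eq {H₀ H₁ : SelfAdjointOperator G} {V : G →L[ℂ] G}
    (hV : ContinuousLinearMap.adjoint V = V) (h : IsSum H₀ V H₁) {z : ℂ} (hz : z.im ≠ 0) :
    H₁.resolvent z = H₀.resolvent z * (1 - V * H₁.resolvent z) := by
  have hz' : (starRingEnd ℂ z).im ≠ 0 := by simpa using hz
  have h1 := congrArg ContinuousLinearMap.adjoint (h _ hz')
  rw [map_sub, map_neg, ContinuousLinearMap.adjoint_comp, ContinuousLinearMap.adjoint_comp,
    H₁.adjoint_resolvent hz', H₀.adjoint_resolvent hz', Complex.conj_conj, hV] at h1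
  rw [sub_eq_iff_eq_add] at h1
  rw [mul_sub, mul_one]
  refine h1.trans ?_
  change -(H₀.resolvent z * V * H₁.resolvent z) + _ = _ - H₀.resolvent z * (V * H₁.resolvent z)
  rw [mul_assoc]
  abel

lemma IsHSRigging.isCompactOperator {H₀ : SelfAdjointOperator G} {F : G →L[ℂ] E}
    (hF : IsHSRigging F H₀) {z : ℂ} (hz : z.im ≠ 0) :
    IsCompactOperator (F ∘L H₀.resolvent z) := by
  obtain ⟨-, w, hw, hHS⟩ := hF
  have h1 : F ∘L H₀.resolvent z
      = (F ∘L H₀.resolvent w) ∘L (1 + (z - w) • H₀.resolvent z) := by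
    conv_lhs => rw [H₀.resolvent_identity hz hw]
    ext x
    simp
  rw [h1]
  exact hHS.isCompactOperator.comp_clm _

lemma isCompactOperator_Tz {H₀ H₁ : SelfAdjointOperator G} {F : G →L[ℂ] E}
    (hF : IsHSRigging F H₀) {V : G →L[ℂ] G}
    (hV : ContinuousLinearMap.adjoint V = V) (h : IsSum H₀ V H₁) {z : ℂ} (hz : z.im ≠ 0) :
    IsCompactOperator (Tz F H₁ z) := by
  have h1 : Tz F H₁ z = (F ∘L H₀.resolvent z) ∘L
      ((1 - V * H₁.resolvent z) ∘L ContinuousLinearMap.adjoint F) := by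
    unfold Tz
    conv_lhs => rw [h.resolvent_eq hV hz]
    rfl
  rw [h1]
  exact (hF.isCompactOperator hz).comp_clm _

lemma adjoint_Tz (F : G →L[ℂ] E) (H : SelfAdjointOperator G) {z : ℂ} (hz : z.im ≠ 0) :
    ContinuousLinearMap.adjoint (Tz F H z) = Tz F H (starRingEnd ℂ z) := by
  unfold Tz
  rw [ContinuousLinearMap.adjoint_comp, ContinuousLinearMap.adjoint_comp,
    ContinuousLinearMap.adjoint_adjoint, H.adjoint_resolvent hz]
  rfl

lemma continuousAt_Tz (F : G →L[ℂ] E) (H : SelfAdjointOperator G) {z : ℂ} (hz : z.im ≠ 0) :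
    ContinuousAt (Tz F H) z := by
  have := H.continuousAt_resolvent hz
  unfold Tz
  fun_prop

/-- At nonreal energy the coupling-constant poles are nonreal. -/
lemma isUnit_of_real_coupling (F : G →L[ℂ] E) (H : SelfAdjointOperator G) {J : E →L[ℂ] E}
    (hJ : IsSelfAdjoint J) {z : ℂ} (hz : z.im ≠ 0) (hT : IsCompactOperator (Tz F H z)) (u : ℝ) :
    IsUnit ((1 : E →L[ℂ] E) + (u : ℂ) • (J ∘L Tz F H z)) := by
  refine isUnit_one_add_of_isCompactOperator ((hT.clm_comp J).smul (u : ℂ)) fun x hx => ?_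
  set y := H.resolvent z (ContinuousLinearMap.adjoint F x) with hy
  have hx' : x = -((u : ℂ) • J (F y)) := eq_neg_of_add_eq_zero_left hx
  have hop := H.resolvent_right z hz (ContinuousLinearMap.adjoint F x)
  have hsym := H.symmetric ⟨y, H.resolvent_mem z hz _⟩ ⟨y, H.resolvent_mem z hz _⟩
  set w := H.op ⟨y, H.resolvent_mem z hz _⟩ with hw
  have hwre : (⟪y, w⟫_ℂ).im = 0 := by
    rw [← Complex.conj_eq_iff_im, inner_conj_symm]
    exact hsym
  have hJre : (⟪F y, J (F y)⟫_ℂ).im = 0 := by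
    rw [← Complex.conj_eq_iff_im, inner_conj_symm]
    conv_lhs => rw [← hJ.adjoint_eq]
    rw [ContinuousLinearMap.adjoint_inner_left]
  have h1 : ⟪y, w⟫_ℂ - z * ⟪y, y⟫_ℂ = -((u : ℂ) * ⟪F y, J (F y)⟫_ℂ) := by
    have := congrArg (fun v => ⟪y, v⟫_ℂ) hop
    rw [inner_sub_right, inner_smul_right, ContinuousLinearMap.adjoint_inner_right] at this
    conv_rhs at this => rw [hx']
    rw [inner_neg_right, inner_smul_right] at this
    exact this
  have h2 := congrArg Complex.im h1
  rw [inner_self_eq_norm_sq_to_K] at h2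
  have h3 : z.im * ‖y‖ ^ 2 = 0 := by
    have h4 : ((‖y‖ : ℂ) ^ 2) = ((‖y‖ ^ 2 : ℝ) : ℂ) := by push_cast; rfl
    simp only [RCLike.ofReal_eq_complex_ofReal] at h2
    rw [h4] at h2
    simp only [Complex.sub_im, Complex.neg_im, Complex.im_mul_ofReal,  Complex.im_ofReal_mul, hwre, hJre] at h2
    linarith
  have hy0 : y = 0 := by
    rcases mul_eq_zero.1 h3 with h | h
    · exact absurd h hz
    · simpa using h
  rw [hx', hy0]
  simp

end Resolvent

section PoleCount

variable {E : Type*} [NormedAddCommGroup E] [InnerProductSpace ℂ E] [CompleteSpace E]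
variable {T J : E →L[ℂ] E} {s c ε : ℝ}

lemma isUnit_adjoint_coupling (hJ : IsSelfAdjoint J) {r : ℂ}
    (h : IsUnit ((1 : E →L[ℂ] E) + (starRingEnd ℂ r - (s : ℂ)) • (J ∘L T))) :
    IsUnit ((1 : E →L[ℂ] E) + (r - (s : ℂ)) • (J ∘L ContinuousLinearMap.adjoint T)) := by
  by_contra hr
  exact conj_mem_couplingPoles_of_adjoint (T := T) hJ hr h

lemma isUnit_adjoint_coupling_of_forall (hJ : IsSelfAdjoint J)
    (hu : ∀ r : ℂ, r.im = 0 ∨ dist r (c : ℂ) = ε →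
      IsUnit ((1 : E →L[ℂ] E) + (r - (s : ℂ)) • (J ∘L T))) (r : ℂ)
    (hr : r.im = 0 ∨ dist r (c : ℂ) = ε) :
    IsUnit ((1 : E →L[ℂ] E) + (r - (s : ℂ)) • (J ∘L ContinuousLinearMap.adjoint T)) := by
  refine isUnit_adjoint_coupling hJ (hu _ ?_)
  rcases hr with hr | hr
  · left
    simpa using hr
  · right
    rw [← Complex.conj_ofReal, Complex.dist_conj_conj]
    exact hr

lemma isUnit_of_mem_halfDiscBoundary (hε : 0 < ε)
    (hu : ∀ r : ℂ, r.im = 0 ∨ dist r (c : ℂ) = ε →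
      IsUnit ((1 : E →L[ℂ] E) + (r - (s : ℂ)) • (J ∘L T))) (r : ℂ)
    (hr : r ∈ halfDiscBoundary c ε) :
    IsUnit ((1 : E →L[ℂ] E) + (r - (s : ℂ)) • (J ∘L T)) := by
  apply hu
  rcases hr with ⟨t, -, rfl⟩ | ⟨θ, -, rfl⟩
  · left
    simp
  · right
    rw [dist_eq_norm]
    simp [Complex.norm_exp_ofReal_mul_I, abs_of_pos hε]

lemma exists_isIdempotent_halfDiscIntegral_Tcoupling (hT : IsCompactOperator T) (hε : 0 < ε)
    (hu : ∀ r : ℂ, r.im = 0 ∨ dist r (c : ℂ) = ε →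
      IsUnit ((1 : E →L[ℂ] E) + (r - (s : ℂ)) • (J ∘L T))) :
    ∃ P : E →L[ℂ] E, P * P = P ∧ FiniteDimensional ℂ (LinearMap.range P.toLinearMap) ∧
      halfDiscIntegral (fun r => J ∘L Tcoupling T J s r) c ε = (2 * π * Complex.I : ℂ) • P ∧
      Module.finrank ℂ (LinearMap.range P.toLinearMap) = poleCount T J s c ε true :=
  exists_isIdempotent_halfDiscIntegral (A := J ∘L T) (hT.clm_comp J) hε
    (isUnit_of_mem_halfDiscBoundary hε hu)

lemma continuousOn_Tcoupling {K : Set ℂ}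
    (hu : ∀ r ∈ K, IsUnit ((1 : E →L[ℂ] E) + (r - (s : ℂ)) • (J ∘L T))) :
    ContinuousOn (fun r => J ∘L Tcoupling T J s r) K :=
  continuousOn_mul_inverse (A := J ∘L T) hu

/-- The trace of the normalised semicircle integral is the difference of the pole counts. -/
lemma trace_upperSemicircleIntegral (hJ : IsSelfAdjoint J) (hT : IsCompactOperator T)
    (hT' : IsCompactOperator (ContinuousLinearMap.adjoint T)) (hε : 0 < ε)
    (hu : ∀ r : ℂ, r.im = 0 ∨ dist r (c : ℂ) = ε →
      IsUnit ((1 : E →L[ℂ] E) + (r - (s : ℂ)) • (J ∘L T))) :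
    trace ((π : ℂ)⁻¹ • upperSemicircleIntegral (fun r : ℂ => J ∘L ((2 * Complex.I)⁻¹ •
      (Tcoupling T J s r - Tcoupling (ContinuousLinearMap.adjoint T) J s r))) c ε)
      = (poleCount T J s c ε true : ℂ) - (poleCount T J s c ε false : ℂ) := by
  have hu' := isUnit_adjoint_coupling_of_forall hJ hu
  obtain ⟨P, hP, hPf, hPi, hPr⟩ := exists_isIdempotent_halfDiscIntegral_Tcoupling hT hε hu
  obtain ⟨Q, hQ, hQf, hQi, hQr⟩ := exists_isIdempotent_halfDiscIntegral_Tcoupling hT' hε hu'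
  have hcP := continuousOn_Tcoupling (isUnit_of_mem_halfDiscBoundary hε hu)
  have hcQ := continuousOn_Tcoupling (isUnit_of_mem_halfDiscBoundary hε hu')
  have hintegral : upperSemicircleIntegral (fun r : ℂ => J ∘L ((2 * Complex.I)⁻¹ •
      (Tcoupling T J s r - Tcoupling (ContinuousLinearMap.adjoint T) J s r))) c ε
      = (π : ℂ) • (P - Q) := by
    change halfDiscIntegral (fun r : ℂ => J ∘L ((2 * Complex.I)⁻¹ •
      (Tcoupling T J s r - Tcoupling (ContinuousLinearMap.adjoint T) J s r))) c ε = _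
    have hfun : ∀ r ∈ halfDiscBoundary c ε, J ∘L ((2 * Complex.I)⁻¹ •
        (Tcoupling T J s r - Tcoupling (ContinuousLinearMap.adjoint T) J s r))
        = (2 * Complex.I)⁻¹ • (J ∘L Tcoupling T J s r
          + (-1 : ℂ) • (J ∘L Tcoupling (ContinuousLinearMap.adjoint T) J s r)) := by
      intro r _
      rw [ContinuousLinearMap.comp_smul, ContinuousLinearMap.comp_sub, neg_one_smul, sub_eq_add_neg]
    have hcQ' : ContinuousOn (fun r => (-1 : ℂ) •
        (J ∘L Tcoupling (ContinuousLinearMap.adjoint T) J s r)) (halfDiscBoundary c ε) :=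
      hcQ.const_smul (-1 : ℂ)
    rw [halfDiscIntegral_congr hε hfun, halfDiscIntegral_smul, halfDiscIntegral_add hε hcP hcQ',
      halfDiscIntegral_smul, hPi, hQi, smul_comm (-1 : ℂ), ← smul_add, smul_smul, neg_one_smul,
      ← sub_eq_add_neg]
    congr 1
    have := Complex.I_ne_zero
    field_simp
  rw [hintegral, smul_smul, inv_mul_cancel₀ (by exact_mod_cast Real.pi_ne_zero), one_smul,
    trace_sub_of_isIdempotent hP hQ, hPr, hQr, poleCount_adjoint hJ hT hT']

lemma continuous_halfDiscIntegral_Tcoupling {X : Type*} [TopologicalSpace X] (hε : 0 < ε)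
    {B : X → E →L[ℂ] E} (hB : Continuous B)
    (hu : ∀ x, ∀ r : ℂ, r.im = 0 ∨ dist r (c : ℂ) = ε →
      IsUnit ((1 : E →L[ℂ] E) + (r - (s : ℂ)) • (J ∘L B x))) :
    Continuous fun x => halfDiscIntegral (fun r => J ∘L Tcoupling (B x) J s r) c ε := by
  have hjoint : ∀ φ : ℝ → ℂ, Continuous φ → (∀ t, (φ t).im = 0 ∨ dist (φ t) (c : ℂ) = ε) →
      Continuous fun q : X × ℝ => J ∘L Tcoupling (B q.1) J s (φ q.2) := by
    intro φ hφ hφu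
    have hg : Continuous fun q : X × ℝ =>
        (1 : E →L[ℂ] E) + (φ q.2 - (s : ℂ)) • (J ∘L B q.1) := by
      fun_prop
    have hinv : Continuous fun q : X × ℝ =>
        Ring.inverse ((1 : E →L[ℂ] E) + (φ q.2 - (s : ℂ)) • (J ∘L B q.1)) := by
      rw [continuous_iff_continuousAt]
      intro q
      obtain ⟨v, hv⟩ := hu q.1 (φ q.2) (hφu q.2)
      have h1 : ContinuousAt Ring.inverse
          ((1 : E →L[ℂ] E) + (φ q.2 - (s : ℂ)) • (J ∘L B q.1)) := by
        rw [← hv]; exact NormedRing.inverse_continuousAt v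
      exact ContinuousAt.comp
        (f := fun q : X × ℝ => (1 : E →L[ℂ] E) + (φ q.2 - (s : ℂ)) • (J ∘L B q.1))
        h1 hg.continuousAt
    unfold Tcoupling
    fun_prop
  unfold halfDiscIntegral
  refine Continuous.add ?_ ?_
  · exact intervalIntegral.continuous_parametric_intervalIntegral_of_continuous'
      (hjoint (fun t => (t : ℂ)) Complex.continuous_ofReal fun t => Or.inl (by simp)) _ _
  · refine intervalIntegral.continuous_parametric_intervalIntegral_of_continuous'
      (f := fun x θ => ((ε : ℂ) * Complex.exp (θ * Complex.I) * Complex.I) •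
        (J ∘L Tcoupling (B x) J s ((c : ℂ) + (ε : ℂ) * Complex.exp (θ * Complex.I)))) ?_ _ _
    have h := hjoint (fun θ => (c : ℂ) + (ε : ℂ) * Complex.exp (θ * Complex.I)) (by fun_prop)
      fun θ => Or.inr (by
        rw [dist_eq_norm]
        simp [Complex.norm_exp_ofReal_mul_I, abs_of_pos hε])
    have h2 : Continuous fun q : X × ℝ => (ε : ℂ) * Complex.exp (q.2 * Complex.I) * Complex.I := by
      fun_prop
    exact h2.smul h

/-- The number of enclosed upper poles is constant along a connected family for which no pole
meets the contour. -/
lemma poleCount_eq_of_preconnectedSpace {X : Type*} [TopologicalSpace X] [PreconnectedSpace X]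
    (hε : 0 < ε) {B : X → E →L[ℂ] E} (hB : Continuous B) (hBc : ∀ x, IsCompactOperator (B x))
    (hu : ∀ x, ∀ r : ℂ, r.im = 0 ∨ dist r (c : ℂ) = ε →
      IsUnit ((1 : E →L[ℂ] E) + (r - (s : ℂ)) • (J ∘L B x))) (x x' : X) :
    poleCount (B x) J s c ε true = poleCount (B x') J s c ε true := by
  choose P hP hPf hPi hPr using fun x =>
    exists_isIdempotent_halfDiscIntegral_Tcoupling (hBc x) hε (hu x)
  have hPc : Continuous P := by
    have hne : (2 * π * Complex.I : ℂ) ≠ 0 := Complex.two_pi_I_ne_zero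
    have h1 : P = fun x => (2 * π * Complex.I : ℂ)⁻¹ •
        halfDiscIntegral (fun r => J ∘L Tcoupling (B x) J s r) c ε := by
      funext x
      rw [hPi, smul_smul, inv_mul_cancel₀ hne, one_smul]
    rw [h1]
    exact (continuous_halfDiscIntegral_Tcoupling hε hB hu).const_smul ((2 * π * Complex.I : ℂ)⁻¹)
  have hloc : IsLocallyConstant fun x => poleCount (B x) J s c ε true := by
    rw [IsLocallyConstant.iff_eventually_eq]
    intro x
    have hnear : ∀ᶠ y in 𝓝 x, dist (P y) (P x) < 1 :=
      hPc.continuousAt.eventually (Metric.ball_mem_nhds _ one_pos)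
    filter_upwards [hnear] with y hy
    rw [dist_eq_norm] at hy
    rw [← hPr, ← hPr]
    have := hPf x
    have := hPf y
    exact le_antisymm (finrank_range_le_of_norm_sub_lt_one (hP y) hy)
      (finrank_range_le_of_norm_sub_lt_one (hP x) (by rwa [norm_sub_rev]))
  exact hloc.apply_eq_of_preconnectedSpace x x'

lemma poleCount_eq_of_forall_isUnit {ε' : ℝ} (hεε' : ε ≤ ε')
    (h : ∀ r : ℂ, ε ≤ dist r (c : ℂ) → dist r (c : ℂ) ≤ ε' →
      IsUnit ((1 : E →L[ℂ] E) + (r - (s : ℂ)) • (J ∘L T))) (b : Bool) :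
    poleCount T J s c ε b = poleCount T J s c ε' b := by
  unfold poleCount
  refine finsum_mem_congr (Set.ext fun r => ?_) fun _ _ => rfl
  refine ⟨fun hr => ⟨hr.1.trans_le hεε', hr.2⟩, fun hr => ⟨?_, hr.2⟩⟩
  by_contra hlt
  exact hr.2.2 (h r (not_lt.1 hlt) hr.1.le)

/-- Stability of invertibility over a compact set of coupling constants. -/
lemma eventually_forall_isUnit {ι : Type*} {f : Filter ι} {B : ι → E →L[ℂ] E} {L : E →L[ℂ] E}
    (hB : Tendsto B f (𝓝 L)) {K : Set ℂ} (hK : IsCompact K)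
    (h : ∀ r ∈ K, IsUnit ((1 : E →L[ℂ] E) + (r - (s : ℂ)) • (J ∘L L))) :
    ∀ᶠ i in f, ∀ r ∈ K, IsUnit ((1 : E →L[ℂ] E) + (r - (s : ℂ)) • (J ∘L B i)) := by
  refine hB.eventually (hK.eventually_forall_of_forall_eventually
    (P := fun (C : E →L[ℂ] E) (r : ℂ) =>
      IsUnit ((1 : E →L[ℂ] E) + (r - (s : ℂ)) • (J ∘L C))) fun r hr => ?_)
  have hc : Continuous fun q : (E →L[ℂ] E) × ℂ =>
      (1 : E →L[ℂ] E) + (q.2 - (s : ℂ)) • (J ∘L q.1) := by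
    fun_prop
  exact (Units.isOpen.preimage hc).mem_nhds (h r hr)

end PoleCount

/-- Let `H_r = H₀ + rV`, `V = F*JF`, let `l` be an essentially
regular point (i.e. `l ∈ Λ(H_s,F)` for some `s`) and let `r_l` be a resonance point.
Then for all sufficiently small `y > 0` (and sufficiently small semicircles `C₊(r_l)`
capturing exactly the `r_l`-group), the resonance index `N₊ − N₋` satisfies
`ind_res(l; H_{r_l}, V) = Tr((1/π) ∮_{C₊(r_l)} J Im T_{l+iy}(H_r) dr)`. -/
theorem resonance_index_eq_semicircle_integral
    (𝓗 𝓚 : Type) [NormedAddCommGroup 𝓗] [InnerProductSpace ℂ 𝓗] [CompleteSpace 𝓗]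
    [TopologicalSpace.SeparableSpace 𝓗]
    [NormedAddCommGroup 𝓚] [InnerProductSpace ℂ 𝓚] [CompleteSpace 𝓚]
    (H₀ : SelfAdjointOperator 𝓗) (F : 𝓗 →L[ℂ] 𝓚) (hF : IsHSRigging F H₀)
    (J : 𝓚 →L[ℂ] 𝓚) (hJ : IsSelfAdjoint J)
    (H : ℝ → SelfAdjointOperator 𝓗) (hH0 : H 0 = H₀)
    (hH : ∀ r : ℝ, IsSum H₀ ((r : ℂ) • sandwich F J) (H r))
    -- `l` is an essentially regular point of the path: `l ∈ Λ(H_s, F)` for some `s`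
    (l : ℝ) (s : ℝ) (hs : l ∈ LambdaSet F (H s))
    -- `r_l` is a resonance point: a (real) pole of `r ↦ T_{l+i0}(H_r)`
    (rl : ℝ) (hrl : ((rl : ℂ)) ∈ couplingPoles (Tlim F (H s) l) J s) :
    ∃ n : ℤ, ∃ ε₀ : ℝ, 0 < ε₀ ∧ ∀ ε : ℝ, 0 < ε → ε ≤ ε₀ →
      ∃ y₀ : ℝ, 0 < y₀ ∧ ∀ y : ℝ, 0 < y → y < y₀ →
        -- the resonance index `ind_res = N₊ − N₋` of the `r_l`-group
        ((poleCount (Tz F (H s) ((l : ℂ) + y * Complex.I)) J s rl ε true : ℤ) -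
          (poleCount (Tz F (H s) ((l : ℂ) + y * Complex.I)) J s rl ε false : ℤ) = n) ∧
        -- equals the trace of `(1/π) ∮_{C₊(r_l)} J Im T_{l+iy}(H_r) dr`
        (n : ℂ) = trace (((π : ℂ))⁻¹ •
          upperSemicircleIntegral
            (fun r : ℂ => J ∘L ((2 * Complex.I)⁻¹ •
              (Tcoupling (Tz F (H s) ((l : ℂ) + y * Complex.I)) J s r -
               Tcoupling (Tz F (H s) ((l : ℂ) - y * Complex.I)) J s r)))
            rl ε) := by
  obtain ⟨L, hL⟩ := hs
  have hV : ContinuousLinearMap.adjoint ((s : ℂ) • sandwich F J) = (s : ℂ) • sandwich F J := by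
    rw [map_smulₛₗ, isSelfAdjoint_sandwich F hJ, Complex.conj_ofReal]
  have him : ∀ y : ℝ, 0 < y → ((l : ℂ) + y * Complex.I).im ≠ 0 := by
    intro y hy
    simpa using hy.ne'
  have hconj : ∀ y : ℝ, starRingEnd ℂ ((l : ℂ) + y * Complex.I) = (l : ℂ) - y * Complex.I := by
    intro y
    simp [sub_eq_add_neg]
  have him' : ∀ y : ℝ, 0 < y → ((l : ℂ) - y * Complex.I).im ≠ 0 := by
    intro y hy
    simpa using hy.ne'
  set T : ℝ → 𝓚 →L[ℂ] 𝓚 := fun y => Tz F (H s) ((l : ℂ) + y * Complex.I) with hT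
  have hTc : ∀ y, 0 < y → IsCompactOperator (T y) := fun y hy =>
    isCompactOperator_Tz hF hV (hH s) (him y hy)
  have hTadj : ∀ y, 0 < y →
      ContinuousLinearMap.adjoint (T y) = Tz F (H s) ((l : ℂ) - y * Complex.I) := by
    intro y hy
    rw [hT, ← hconj]
    exact adjoint_Tz F (H s) (him y hy)
  have hTc' : ∀ y, 0 < y → IsCompactOperator (ContinuousLinearMap.adjoint (T y)) := by
    intro y hy
    rw [hTadj y hy]
    exact isCompactOperator_Tz hF hV (hH s) (him' y hy)
  have hLc : IsCompactOperator L := by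
    refine isCompactOperator_of_tendsto hL ?_
    filter_upwards [self_mem_nhdsWithin] with y hy using hTc y hy
  have hreal : ∀ y, 0 < y → ∀ r : ℂ, r.im = 0 →
      IsUnit ((1 : 𝓚 →L[ℂ] 𝓚) + (r - (s : ℂ)) • (J ∘L T y)) := by
    intro y hy r hr
    have h := isUnit_of_real_coupling F (H s) hJ (him y hy) (hTc y hy) (r.re - s)
    have hre : r - (s : ℂ) = ((r.re - s : ℝ) : ℂ) := by
      apply Complex.ext <;> simp [hr]
    rw [hre]
    exact h
  obtain ⟨δ, hδ, hiso⟩ : ∃ δ > 0, ∀ r : ℂ, dist r (rl : ℂ) < δ → r ≠ rl →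
      IsUnit ((1 : 𝓚 →L[ℂ] 𝓚) + (r - (s : ℂ)) • (J ∘L L)) := by
    have h := eventually_isUnit_one_add_smul (A := J ∘L L) (hLc.clm_comp J) (s : ℂ) (rl : ℂ)
    rw [eventually_nhdsWithin_iff, Metric.eventually_nhds_iff] at h
    exact h
  have htube : ∀ K : Set ℂ, IsCompact K → (∀ r ∈ K, dist r (rl : ℂ) < δ ∧ r ≠ rl) →
      ∃ y₁ > 0, ∀ y, 0 < y → y < y₁ → ∀ r ∈ K,
        IsUnit ((1 : 𝓚 →L[ℂ] 𝓚) + (r - (s : ℂ)) • (J ∘L T y)) := by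
    intro K hK hKr
    have h := eventually_forall_isUnit (J := J) (s := s) hL hK
      fun r hr => hiso r (hKr r hr).1 (hKr r hr).2
    obtain ⟨y₁, hy₁, hsub⟩ := mem_nhdsGT_iff_exists_Ioo_subset.1 h
    exact ⟨y₁, hy₁, fun y hy hlt => hsub ⟨hy, hlt⟩⟩
  have hannulus : ∀ a : ℝ, 0 < a → ∃ y₁ > 0, ∀ y, 0 < y → y < y₁ → ∀ r : ℂ,
      a ≤ dist r (rl : ℂ) → dist r (rl : ℂ) ≤ δ / 2 →
        IsUnit ((1 : 𝓚 →L[ℂ] 𝓚) + (r - (s : ℂ)) • (J ∘L T y)) := by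
    intro a ha
    obtain ⟨y₁, hy₁, h⟩ := htube (Metric.closedBall (rl : ℂ) (δ / 2) \ Metric.ball (rl : ℂ) a)
      ((isCompact_closedBall _ _).diff Metric.isOpen_ball) (by
        rintro r ⟨h1, h2⟩
        refine ⟨lt_of_le_of_lt h1 (by linarith), ?_⟩
        rintro rfl
        exact h2 (Metric.mem_ball_self ha))
    exact ⟨y₁, hy₁, fun y hy hlt r h1 h2 => h y hy hlt r ⟨h2, fun h3 => absurd h3 (not_lt.2 h1)⟩⟩
  obtain ⟨y₁, hy₁, hsphere⟩ := hannulus (δ / 2) (by linarith)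
  have hu : ∀ y, 0 < y → y < y₁ → ∀ r : ℂ, r.im = 0 ∨ dist r (rl : ℂ) = δ / 2 →
      IsUnit ((1 : 𝓚 →L[ℂ] 𝓚) + (r - (s : ℂ)) • (J ∘L T y)) := by
    rintro y hy hlt r (hr | hr)
    · exact hreal y hy r hr
    · exact hsphere y hy hlt r hr.ge hr.le
  have hcont : Continuous fun y : Ioo 0 y₁ => T y := by
    rw [continuous_iff_continuousAt]
    intro y
    refine ContinuousAt.comp (f := fun y : Ioo 0 y₁ => (l : ℂ) + ((y : ℝ) : ℂ) * Complex.I)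
      (continuousAt_Tz F (H s) (him y y.2.1)) ?_
    fun_prop
  have : PreconnectedSpace (Ioo 0 y₁) := Subtype.preconnectedSpace isPreconnected_Ioo
  have hconst : ∀ y, 0 < y → y < y₁ → ∀ b, poleCount (T y) J s rl (δ / 2) b
      = poleCount (T (y₁ / 2)) J s rl (δ / 2) b := by
    intro y hy hlt b
    have hy₁' : 0 < y₁ / 2 := by linarith
    have hlt' : y₁ / 2 < y₁ := by linarith
    cases b with
    | true =>
      exact poleCount_eq_of_preconnectedSpace (half_pos hδ) hcont (fun x => hTc x x.2.1)
        (fun x => hu x x.2.1 x.2.2) ⟨y, hy, hlt⟩ ⟨y₁ / 2, hy₁', hlt'⟩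
    | false =>
      rw [← poleCount_adjoint hJ (hTc y hy) (hTc' y hy),
        ← poleCount_adjoint hJ (hTc _ hy₁') (hTc' _ hy₁')]
      exact poleCount_eq_of_preconnectedSpace (half_pos hδ)
        (B := fun x : Ioo 0 y₁ => ContinuousLinearMap.adjoint (T x))
        (ContinuousLinearMap.adjoint.continuous.comp hcont) (fun x => hTc' x x.2.1)
        (fun x => isUnit_adjoint_coupling_of_forall hJ (hu x x.2.1 x.2.2))
        ⟨y, hy, hlt⟩ ⟨y₁ / 2, hy₁', hlt'⟩
  refine ⟨(poleCount (T (y₁ / 2)) J s rl (δ / 2) true : ℤ)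
    - (poleCount (T (y₁ / 2)) J s rl (δ / 2) false : ℤ), δ / 2, half_pos hδ, fun ε hε hle => ?_⟩
  obtain ⟨y₂, hy₂, hann⟩ := hannulus ε hε
  refine ⟨min y₁ y₂, lt_min hy₁ hy₂, fun y hy hlt => ?_⟩
  have hlt₁ : y < y₁ := hlt.trans_le (min_le_left _ _)
  have hlt₂ : y < y₂ := hlt.trans_le (min_le_right _ _)
  have hcount : ∀ b, poleCount (T y) J s rl ε b
      = poleCount (T (y₁ / 2)) J s rl (δ / 2) b := fun b =>
    (poleCount_eq_of_forall_isUnit hle (hann y hy hlt₂) b).trans (hconst y hy hlt₁ b)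
  refine ⟨?_, ?_⟩
  · change (poleCount (T y) J s rl ε true : ℤ) - (poleCount (T y) J s rl ε false : ℤ) = _
    rw [hcount, hcount]
  · have huε : ∀ r : ℂ, r.im = 0 ∨ dist r (rl : ℂ) = ε →
        IsUnit ((1 : 𝓚 →L[ℂ] 𝓚) + (r - (s : ℂ)) • (J ∘L T y)) := by
      rintro r (hr | hr)
      · exact hreal y hy r hr
      · exact hann y hy hlt₂ r hr.ge (hr.le.trans hle)
    have htr := trace_upperSemicircleIntegral hJ (hTc y hy) (hTc' y hy) hε huε
    rw [hTadj y hy, hcount, hcount] at htr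
    rw [htr]
    push_cast
    rfl

end SSF
end
end

section
/- Let H be a self-adjoint operator on a separable complex Hilbert space ℋ with spectral measure E, and let F : ℋ → 𝒦 be a rigging operator. Then the operator 𝔈(H) : ℋ → ℌ(H) = ∫^⊕_{Λ(H,F)} 𝔥_λ(H) dλ, defined on ran F* by (𝔈(H)f)(λ) = √(π^{-1} Im T_{λ+i0}(H)) (F*)^{-1} f and extended by continuity, is a partial isometry with initial space E(Λ(H,F))ℋ and final space ℌ(H). Moreover 𝔈(H) diagonalises E(Λ(H,F))H: for all f ∈ dom H, (𝔈(H)Hf)(λ) = λ(𝔈(H)f)(λ) for a.e. λ ∈ Λ(H,F), and if h is a bounded Borel function whose minimal support is contained in Λ(H,F), then (𝔈(H)h(H)f)(λ) = h(λ)(𝔈(H)f)(λ) for a.e. λ ∈ Λ(H,F) and all f ∈ ℋ. -/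
open MeasureTheory Filter Complex Set Topology
open scoped InnerProductSpace ComplexInnerProductSpace ENNReal Topology Real
set_option autoImplicit false

noncomputable section

namespace SSF

variable {𝓗 : Type*} {𝓚 : Type*}

variable [NormedAddCommGroup 𝓗] [InnerProductSpace ℂ 𝓗] [CompleteSpace 𝓗]
variable [NormedAddCommGroup 𝓚] [InnerProductSpace ℂ 𝓚] [CompleteSpace 𝓚]

/-- The fibre Hilbert space `𝔥_λ(H)`: the closure of the range of
`Q = √(Im T_{λ+i0}(H))`. -/
def fibSpace (Q : 𝓚 →L[ℂ] 𝓚) : Submodule ℂ 𝓚 :=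
  (LinearMap.range (Q : 𝓚 →ₗ[ℂ] 𝓚)).topologicalClosure

/-- The element `Q ψ` of the fibre space. -/
def toFib (Q : 𝓚 →L[ℂ] 𝓚) (ψ : 𝓚) : fibSpace Q :=
  ⟨Q ψ, Submodule.le_topologicalClosure _ (LinearMap.mem_range_self _ ψ)⟩

/-- `Q`, corestricted to the fibre space. -/
def codToFib (Q : 𝓚 →L[ℂ] 𝓚) : 𝓚 →L[ℂ] (fibSpace Q) :=
  Q.codRestrict (fibSpace Q) fun ψ =>
    Submodule.le_topologicalClosure _ (LinearMap.mem_range_self _ ψ)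

/-- `Q` is the positive square root of `Im T_{l+i0}(H)`. -/
def IsSqrtImT (F : 𝓗 →L[ℂ] 𝓚) (H : SelfAdjointOperator 𝓗) (l : ℝ)
    (Q : 𝓚 →L[ℂ] 𝓚) : Prop :=
  IsSelfAdjoint Q ∧ (∀ ψ : 𝓚, 0 ≤ (⟪ψ, Q ψ⟫_ℂ).re) ∧ Q ∘L Q = imOp (Tlim F H l)

/-- The defining property of the wave matrix `w_±(l; H₁, H₀)` (`ε = 1` for `w₊`,
`ε = -1` for `w₋`), given positive square roots `Q₁, Q₀` of `Im T_{l+i0}(H₁)`,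
`Im T_{l+i0}(H₀)`: it is a contraction `𝔥_l(H₀) → 𝔥_l(H₁)` determined by
`⟪𝔈_l(H₁)f, w_± 𝔈_l(H₀)g⟫ = lim_{y→0⁺} (y/π)⟪R_{l±iy}(H₁)f, R_{l±iy}(H₀)g⟫`
for `f, g ∈ ran F*`. -/
def IsWaveMatrix (F : 𝓗 →L[ℂ] 𝓚) (H₁ H₀ : SelfAdjointOperator 𝓗)
    (Q₁ Q₀ : 𝓚 →L[ℂ] 𝓚) (l : ℝ) (ε : ℝ)
    (w : fibSpace Q₀ →L[ℂ] fibSpace Q₁) : Prop :=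
  ‖w‖ ≤ 1 ∧ ∀ φ ψ : 𝓚,
    Tendsto (fun y : ℝ =>
        (y : ℂ) * ⟪H₁.resolvent ((l : ℂ) + (ε : ℂ) * y * Complex.I)
            (ContinuousLinearMap.adjoint F φ),
          H₀.resolvent ((l : ℂ) + (ε : ℂ) * y * Complex.I)
            (ContinuousLinearMap.adjoint F ψ)⟫_ℂ)
      (𝓝[>] (0:ℝ)) (𝓝 ⟪Q₁ φ, ((w (toFib Q₀ ψ)) : 𝓚)⟫_ℂ)

/-- Pointwise application of an `L²` element (via its canonical representative). -/
def lpApply {μ : Measure ℝ} (g : MeasureTheory.Lp 𝓚 2 μ) (l : ℝ) : 𝓚 :=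
  (g : ℝ →ₘ[μ] 𝓚) l

section Poisson

/-- The Poisson integral of a measure `μ` on the line, as an extended nonnegative number
(without the normalising factor `π⁻¹`). -/
def poisson (μ : Measure ℝ) (l y : ℝ) : ℝ≥0∞ :=
  ∫⁻ x : ℝ, ENNReal.ofReal (y / ((x - l) ^ 2 + y ^ 2)) ∂μ

lemma measure_closedBall_le_poisson (μ : Measure ℝ) (l : ℝ) {y : ℝ} (hy : 0 < y) :
    μ (Metric.closedBall l y) ≤ ENNReal.ofReal (2 * y) * poisson μ l y := by
  have h1 : ∀ x ∈ Metric.closedBall l y,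
      (1 : ℝ≥0∞) ≤ ENNReal.ofReal (2 * y) * ENNReal.ofReal (y / ((x - l) ^ 2 + y ^ 2)) := by
    intro x hx
    rw [← ENNReal.ofReal_mul (by positivity), ENNReal.one_le_ofReal, mul_div_assoc',
      le_div_iff₀ (by positivity)]
    rw [Metric.mem_closedBall, Real.dist_eq] at hx
    nlinarith [sq_abs (x - l), abs_nonneg (x - l)]
  calc μ (Metric.closedBall l y) = ∫⁻ _ in Metric.closedBall l y, 1 ∂μ := by simp
    _ ≤ ∫⁻ x in Metric.closedBall l y,
          ENNReal.ofReal (2 * y) * ENNReal.ofReal (y / ((x - l) ^ 2 + y ^ 2)) ∂μ :=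
        setLIntegral_mono' Metric.isClosed_closedBall.measurableSet h1
    _ ≤ ∫⁻ x, ENNReal.ofReal (2 * y) * ENNReal.ofReal (y / ((x - l) ^ 2 + y ^ 2)) ∂μ :=
        setLIntegral_le_lintegral _ _
    _ = _ := by rw [lintegral_const_mul' _ _ ENNReal.ofReal_ne_top, poisson]

/-- A finite measure is absolutely continuous on a set at every point of which its Poisson
integral stays bounded. -/
lemma restrict_absolutelyContinuous_of_tendsto_poisson (μ : Measure ℝ) [IsFiniteMeasure μ]
    {A : Set ℝ} (p : ℝ → ℝ≥0∞) (hp : ∀ l ∈ A, p l ≠ ∞)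
    (h : ∀ l ∈ A, Tendsto (poisson μ l) (𝓝[>] 0) (𝓝 (p l))) :
    μ.restrict A ≪ volume := by
  refine Measure.AbsolutelyContinuous.mk fun s hs hs0 => ?_
  rw [Measure.restrict_apply hs]
  have hcov : s ∩ A ⊆ ⋃ n : ℕ, (s ∩ A) ∩ {l | p l < n} := by
    intro l hl
    obtain ⟨n, hn⟩ := ENNReal.exists_nat_gt (hp l hl.2)
    exact mem_iUnion.2 ⟨n, hl, hn⟩
  refine measure_mono_null hcov (measure_iUnion_null fun n => ?_)
  have key := (Besicovitch.vitaliFamily μ).measure_le_of_frequently_le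
    (ρ := μ) ((n : NNReal) • (volume : Measure ℝ)) Measure.AbsolutelyContinuous.rfl
    ((s ∩ A) ∩ {l | p l < n}) ?_
  · refine le_antisymm (key.trans ?_) zero_le
    rw [Measure.smul_apply, measure_mono_null (fun x hx => hx.1.1) hs0]
    simp
  · rintro l ⟨hl, hln⟩
    refine (Besicovitch.tendsto_filterAt μ l).frequently (Eventually.frequently ?_)
    filter_upwards [(h l hl.2).eventually_lt_const hln, self_mem_nhdsWithin] with y hy hy0
    refine (measure_closedBall_le_poisson μ l hy0).trans ?_
    rw [Measure.smul_apply, Real.volume_closedBall, ENNReal.smul_def, smul_eq_mul, mul_comm]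
    gcongr
    simpa using hy.le

lemma hasDerivAt_neg_inv_one_add_sq (s : ℝ) :
    HasDerivAt (fun s : ℝ => -(1 + s ^ 2)⁻¹) (2 * s / (1 + s ^ 2) ^ 2) s := by
  have h : HasDerivAt (fun s : ℝ => 1 + s ^ 2) (2 * s) s := by
    simpa using (hasDerivAt_pow 2 s).const_add 1
  exact (h.inv (by positivity)).neg.congr_deriv (by ring)

lemma tendsto_neg_inv_one_add_sq_atTop :
    Tendsto (fun s : ℝ => -(1 + s ^ 2)⁻¹) atTop (𝓝 0) := by
  have h : Tendsto (fun s : ℝ => 1 + s ^ 2) atTop atTop :=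
    tendsto_atTop_add_const_left _ _ (tendsto_pow_atTop two_ne_zero)
  simpa using h.inv_tendsto_atTop.neg

lemma lintegral_Ici_two_mul_div_one_add_sq_sq {d : ℝ} (hd : 0 ≤ d) :
    ∫⁻ s in Ici d, ENNReal.ofReal (2 * s / (1 + s ^ 2) ^ 2) = ENNReal.ofReal (1 + d ^ 2)⁻¹ := by
  have hpos : ∀ s ∈ Ioi d, 0 ≤ 2 * s / (1 + s ^ 2) ^ 2 := fun s hs => by
    have : 0 < s := hd.trans_lt hs
    positivity
  have hInt : IntegrableOn (fun s : ℝ => 2 * s / (1 + s ^ 2) ^ 2) (Ioi d) :=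
    integrableOn_Ioi_deriv_of_nonneg' (fun s _ => hasDerivAt_neg_inv_one_add_sq s) hpos
      tendsto_neg_inv_one_add_sq_atTop
  rw [setLIntegral_congr Ioi_ae_eq_Ici.symm, ← ofReal_integral_eq_lintegral_ofReal hInt
    ((ae_restrict_iff' measurableSet_Ioi).2 (ae_of_all _ hpos)),
    integral_Ioi_of_hasDerivAt_of_nonneg' (fun s _ => hasDerivAt_neg_inv_one_add_sq s) hpos
      tendsto_neg_inv_one_add_sq_atTop]
  simp

lemma lintegral_Ioi_four_mul_sq_div_one_add_sq_sq :
    ∫⁻ s in Ioi (0 : ℝ), ENNReal.ofReal (4 * s ^ 2 / (1 + s ^ 2) ^ 2) = ENNReal.ofReal π := by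
  have hderiv : ∀ s ∈ Ici (0 : ℝ),
      HasDerivAt (fun s : ℝ => 2 * Real.arctan s + s * (2 * -(1 + s ^ 2)⁻¹))
        (4 * s ^ 2 / (1 + s ^ 2) ^ 2) s := by
    intro s _
    refine (((Real.hasDerivAt_arctan s).const_mul 2).add
      ((hasDerivAt_id s).mul ((hasDerivAt_neg_inv_one_add_sq s).const_mul 2))).congr_deriv ?_
    simp only [id]
    field_simp
    ring
  have hpos : ∀ s ∈ Ioi (0 : ℝ), 0 ≤ 4 * s ^ 2 / (1 + s ^ 2) ^ 2 := fun s _ => by positivity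
  have hlim : Tendsto (fun s : ℝ => 2 * Real.arctan s + s * (2 * -(1 + s ^ 2)⁻¹)) atTop (𝓝 π) := by
    have h1 : Tendsto (fun s : ℝ => 2 * Real.arctan s) atTop (𝓝 (2 * (π / 2))) :=
      ((Real.tendsto_arctan_atTop.mono_right nhdsWithin_le_nhds)).const_mul 2
    have h2 : Tendsto (fun s : ℝ => s * (2 * -(1 + s ^ 2)⁻¹)) atTop (𝓝 0) := by
      have h3 : Tendsto (fun s : ℝ => 2 * s⁻¹) atTop (𝓝 0) := by
        simpa using tendsto_inv_atTop_zero.const_mul (2 : ℝ)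
      refine squeeze_zero_norm' ?_ h3
      filter_upwards [eventually_gt_atTop 0] with s hs
      rw [Real.norm_eq_abs, abs_mul, abs_mul, abs_neg, abs_of_pos hs, abs_two,
        abs_of_pos (by positivity)]
      field_simp
      nlinarith
    convert h1.add h2 using 2
    ring
  have hInt := integrableOn_Ioi_deriv_of_nonneg' hderiv hpos hlim
  rw [← ofReal_integral_eq_lintegral_ofReal hInt
    ((ae_restrict_iff' measurableSet_Ioi).2 (ae_of_all _ hpos)),
    integral_Ioi_of_hasDerivAt_of_nonneg' hderiv hpos hlim]
  simp

/-- The Poisson integral as an average of ball ratios. -/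
lemma poisson_eq_lintegral_closedBall (μ : Measure ℝ) [IsFiniteMeasure μ] (l : ℝ) {y : ℝ}
    (hy : 0 < y) :
    poisson μ l y = ∫⁻ s in Ioi (0 : ℝ), ENNReal.ofReal (4 * s ^ 2 / (1 + s ^ 2) ^ 2) *
      (μ (Metric.closedBall l (y * s)) / volume (Metric.closedBall l (y * s))) := by
  set k : ℝ → ℝ≥0∞ := fun s => ENNReal.ofReal (2 * s / (1 + s ^ 2) ^ 2) with hk
  have hkm : Measurable k := by fun_prop
  set S : Set (ℝ × ℝ) := {q | dist q.1 l ≤ y * q.2} with hS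
  have hSm : MeasurableSet S := by
    refine (isClosed_le ?_ ?_).measurableSet <;> fun_prop
  have hlayer : ∀ x : ℝ, ENNReal.ofReal (y / ((x - l) ^ 2 + y ^ 2)) =
      ENNReal.ofReal y⁻¹ * ∫⁻ s in Ioi (0 : ℝ), S.indicator (fun q => k q.2) (x, s) := by
    intro x
    have h1 : ∀ s, S.indicator (fun q => k q.2) (x, s) = (Ici (dist x l / y)).indicator k s := by
      intro s
      have : (x, s) ∈ S ↔ s ∈ Ici (dist x l / y) := by
        rw [mem_Ici, div_le_iff₀ hy, mul_comm]
        rfl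
      by_cases h : (x, s) ∈ S
      · rw [indicator_of_mem h, indicator_of_mem (this.1 h)]
      · rw [indicator_of_notMem h, indicator_of_notMem (fun h' => h (this.2 h'))]
    simp_rw [h1]
    rw [setLIntegral_congr Ioi_ae_eq_Ici, setLIntegral_indicator measurableSet_Ici,
      inter_eq_self_of_subset_left (Ici_subset_Ici.2 (by positivity)),
      lintegral_Ici_two_mul_div_one_add_sq_sq (by positivity),
      ← ENNReal.ofReal_mul (by positivity)]
    congr 1
    rw [div_pow, Real.dist_eq, sq_abs]
    field_simp
    ring
  rw [poisson]
  simp_rw [hlayer]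
  rw [lintegral_const_mul' _ _ ENNReal.ofReal_ne_top, lintegral_lintegral_swap,
    ← lintegral_const_mul' _ _ ENNReal.ofReal_ne_top]
  · refine setLIntegral_congr_fun measurableSet_Ioi fun s hs => ?_
    have hs0 : 0 < s := hs
    have h2 : ∀ x, S.indicator (fun q => k q.2) (x, s) =
        (Metric.closedBall l (y * s)).indicator (fun _ => k s) x := fun x => rfl
    simp_rw [h2]
    rw [lintegral_indicator_const Metric.isClosed_closedBall.measurableSet,
      Real.volume_closedBall, ENNReal.div_eq_inv_mul, ← mul_assoc, ← mul_assoc,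
      ← ENNReal.ofReal_inv_of_pos (by positivity), hk,
      ← ENNReal.ofReal_mul (by positivity), ← ENNReal.ofReal_mul (by positivity)]
    congr 2
    field_simp
    ring
  · exact (Measurable.indicator (hkm.comp measurable_snd) hSm).aemeasurable

/-- Fatou's theorem: the Poisson integral converges wherever the ball ratios do. -/
lemma tendsto_poisson_of_tendsto_ratio (μ : Measure ℝ) [IsFiniteMeasure μ] (l : ℝ) {D : ℝ≥0∞}
    (hD : D ≠ ∞)
    (h : Tendsto (fun r => μ (Metric.closedBall l r) / volume (Metric.closedBall l r))
      (𝓝[>] 0) (𝓝 D)) :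
    Tendsto (poisson μ l) (𝓝[>] 0) (𝓝 (ENNReal.ofReal π * D)) := by
  set ρ : ℝ → ℝ≥0∞ := fun r => μ (Metric.closedBall l r) / volume (Metric.closedBall l r) with hρ
  obtain ⟨C, hC, hρC⟩ : ∃ C : ℝ≥0∞, C ≠ ∞ ∧ ∀ r > 0, ρ r ≤ C := by
    have h1 : ∀ᶠ r in 𝓝[>] (0 : ℝ), ρ r < D + 1 :=
      h.eventually_lt_const (ENNReal.lt_add_right hD one_ne_zero)
    obtain ⟨δ, hδ, hδ'⟩ := mem_nhdsGT_iff_exists_Ioo_subset.1 h1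
    have hδ0 : 0 < δ := hδ
    refine ⟨max (D + 1) (μ univ / ENNReal.ofReal (2 * δ)), ?_, fun r hr => ?_⟩
    · refine (max_lt (by finiteness) (ENNReal.div_lt_top (measure_ne_top _ _) ?_)).ne
      simpa using hδ0
    · rcases lt_or_ge r δ with hrδ | hrδ
      · exact (hδ' ⟨hr, hrδ⟩ : ρ r < D + 1).le.trans (le_max_left _ _)
      · refine le_trans ?_ (le_max_right _ _)
        simp only [hρ, Real.volume_closedBall]
        gcongr
        exact subset_univ _
  have hmeas : Measurable ρ := by
    have hm : Monotone fun r => μ (Metric.closedBall l r) :=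
      fun a b hab => measure_mono (Metric.closedBall_subset_closedBall hab)
    have hv : Monotone fun r => volume (Metric.closedBall l r) :=
      fun a b hab => measure_mono (Metric.closedBall_subset_closedBall hab)
    exact hm.measurable.div hv.measurable
  have hlim : Tendsto (fun y => ∫⁻ s in Ioi (0 : ℝ),
      ENNReal.ofReal (4 * s ^ 2 / (1 + s ^ 2) ^ 2) * ρ (y * s)) (𝓝[>] 0)
      (𝓝 (∫⁻ s in Ioi (0 : ℝ), ENNReal.ofReal (4 * s ^ 2 / (1 + s ^ 2) ^ 2) * D)) := by
    refine tendsto_lintegral_filter_of_dominated_convergence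
      (fun s => ENNReal.ofReal (4 * s ^ 2 / (1 + s ^ 2) ^ 2) * C)
      (Eventually.of_forall fun y => ?_) ?_ ?_ ?_
    · have : Measurable fun s : ℝ => ρ (y * s) := hmeas.comp (by fun_prop)
      fun_prop
    · filter_upwards [self_mem_nhdsWithin] with y hy
      refine (ae_restrict_iff' measurableSet_Ioi).2 (ae_of_all _ fun s hs => ?_)
      gcongr
      exact hρC _ (mul_pos hy hs)
    · rw [lintegral_mul_const' _ _ hC, lintegral_Ioi_four_mul_sq_div_one_add_sq_sq]
      finiteness
    · refine (ae_restrict_iff' measurableSet_Ioi).2 (ae_of_all _ fun s hs => ?_)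
      have hs0 : 0 < s := hs
      refine ENNReal.Tendsto.const_mul (h.comp ?_) (Or.inr ENNReal.ofReal_ne_top)
      refine tendsto_nhdsWithin_of_tendsto_nhds_of_eventually_within _ ?_ ?_
      · have : Tendsto (fun y : ℝ => y * s) (𝓝 0) (𝓝 (0 * s)) := tendsto_id.mul_const s
        rw [zero_mul] at this
        exact this.mono_left nhdsWithin_le_nhds
      · filter_upwards [self_mem_nhdsWithin] with y hy
        exact mul_pos hy hs0
  rw [lintegral_mul_const' _ _ hD, lintegral_Ioi_four_mul_sq_div_one_add_sq_sq] at hlim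
  refine hlim.congr' ?_
  filter_upwards [self_mem_nhdsWithin] with y hy
  exact (poisson_eq_lintegral_closedBall μ l hy).symm

/-- If the Poisson integral of a finite measure has a finite limit at every point of a Borel set,
then the measure of this set is the integral of that limit, up to the factor `π⁻¹`. -/
lemma measure_eq_setLIntegral_of_tendsto_poisson (μ : Measure ℝ) [IsFiniteMeasure μ]
    {A : Set ℝ} (hA : MeasurableSet A) (p : ℝ → ℝ≥0∞) (hp : ∀ l ∈ A, p l ≠ ∞)
    (h : ∀ l ∈ A, Tendsto (poisson μ l) (𝓝[>] 0) (𝓝 (p l))) :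
    μ A = ∫⁻ l in A, (ENNReal.ofReal π)⁻¹ * p l := by
  have hac := restrict_absolutelyContinuous_of_tendsto_poisson μ p hp h
  calc μ A = μ.restrict A univ := by simp
    _ = ∫⁻ l, (μ.restrict A).rnDeriv volume l := (Measure.lintegral_rnDeriv hac).symm
    _ = ∫⁻ l, A.indicator (μ.rnDeriv volume) l :=
        lintegral_congr_ae (Measure.rnDeriv_restrict μ volume hA)
    _ = ∫⁻ l in A, μ.rnDeriv volume l := lintegral_indicator hA _
    _ = _ := by
      refine lintegral_congr_ae ?_
      filter_upwards [ae_restrict_mem hA,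
        ae_restrict_of_ae (Besicovitch.ae_tendsto_rnDeriv μ (volume : Measure ℝ)),
        ae_restrict_of_ae (Measure.rnDeriv_lt_top μ (volume : Measure ℝ))] with l hl h1 h2
      rw [tendsto_nhds_unique (h l hl) (tendsto_poisson_of_tendsto_ratio μ l h2.ne h1),
        ENNReal.inv_mul_cancel_left (by simpa using Real.pi_pos) ENNReal.ofReal_ne_top]

end Poisson

section Resolvent

namespace SelfAdjointOperator

variable (H : SelfAdjointOperator 𝓗)

lemma norm_resolvent_apply_le {z : ℂ} (hz : z.im ≠ 0) (f : 𝓗) :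
    |z.im| * ‖H.resolvent z f‖ ≤ ‖f‖ := by
  set g : H.domain := ⟨H.resolvent z f, H.resolvent_mem z hz f⟩ with hg
  have hf : H.op g - z • (g : 𝓗) = f := H.resolvent_right z hz f
  have hreal : (⟪(g : 𝓗), H.op g⟫_ℂ).im = 0 := by
    have h1 := H.symmetric g g
    rw [← inner_conj_symm] at h1
    exact Complex.conj_eq_iff_im.1 h1
  have him : (⟪(g : 𝓗), f⟫_ℂ).im = -z.im * ‖(g : 𝓗)‖ ^ 2 := by
    rw [← hf, inner_sub_right, inner_smul_right, inner_self_eq_norm_sq_to_K, Complex.sub_im, hreal]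
    simp [Complex.mul_im, ← Complex.ofReal_pow]
  have hle : |z.im| * ‖(g : 𝓗)‖ ^ 2 ≤ ‖(g : 𝓗)‖ * ‖f‖ := by
    calc |z.im| * ‖(g : 𝓗)‖ ^ 2 = |(⟪(g : 𝓗), f⟫_ℂ).im| := by
          rw [him, abs_mul, abs_neg, abs_of_nonneg (sq_nonneg ‖(g : 𝓗)‖)]
      _ ≤ ‖⟪(g : 𝓗), f⟫_ℂ‖ := Complex.abs_im_le_norm _
      _ ≤ _ := norm_inner_le_norm _ _
  change |z.im| * ‖(g : 𝓗)‖ ≤ ‖f‖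
  rcases (norm_nonneg (g : 𝓗)).eq_or_lt with h0 | h0
  · rw [← h0]
    simp
  · nlinarith

lemma norm_resolvent_le {z : ℂ} (hz : z.im ≠ 0) : ‖H.resolvent z‖ ≤ |z.im|⁻¹ := by
  have hz0 : 0 < |z.im| := abs_pos.2 hz
  refine ContinuousLinearMap.opNorm_le_bound _ (by positivity) fun f => ?_
  rw [inv_mul_eq_div, le_div_iff₀ hz0, mul_comm]
  exact H.norm_resolvent_apply_le hz f

lemma resolvent_sub {z w : ℂ} (hz : z.im ≠ 0) (hw : w.im ≠ 0) :
    H.resolvent z - H.resolvent w = (z - w) • (H.resolvent z ∘L H.resolvent w) := by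
  ext f
  have h1 := H.resolvent_left z hz ⟨H.resolvent w f, H.resolvent_mem w hw f⟩
  have h2 := H.resolvent_right w hw f
  rw [sub_eq_iff_eq_add] at h2
  simp only [h2, map_sub, map_add, map_smul] at h1
  simp only [sub_apply, smul_apply, ContinuousLinearMap.comp_apply]
  rw [sub_eq_iff_eq_add']
  nth_rewrite 1 [← h1]
  module

lemma continuousAt_resolvent_s12 {w : ℂ} (hw : w.im ≠ 0) : ContinuousAt H.resolvent w := by
  rw [ContinuousAt, tendsto_iff_norm_sub_tendsto_zero]
  have hev : ∀ᶠ z in 𝓝 w, z.im ≠ 0 := Complex.continuous_im.continuousAt.eventually_ne hw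
  have hlim : Tendsto (fun z : ℂ => ‖z - w‖ * (|z.im|⁻¹ * |w.im|⁻¹)) (𝓝 w) (𝓝 0) := by
    have h : ContinuousAt (fun z : ℂ => ‖z - w‖ * (|z.im|⁻¹ * |w.im|⁻¹)) w := by
      refine ContinuousAt.mul (by fun_prop) (ContinuousAt.mul (ContinuousAt.inv₀ ?_ ?_) ?_)
      · exact (Complex.continuous_im.abs).continuousAt
      · exact abs_ne_zero.2 hw
      · exact continuousAt_const
    simpa using h.tendsto
  refine squeeze_zero' (Eventually.of_forall fun z => norm_nonneg _) ?_ hlim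
  filter_upwards [hev] with z hz
  rw [H.resolvent_sub hz hw, norm_smul]
  gcongr
  refine (ContinuousLinearMap.opNorm_comp_le _ _).trans ?_
  gcongr
  · exact H.norm_resolvent_le hz
  · exact H.norm_resolvent_le hw

end SelfAdjointOperator

lemma continuousAt_Tz_s12 (F : 𝓗 →L[ℂ] 𝓚) (H : SelfAdjointOperator 𝓗) {w : ℂ} (hw : w.im ≠ 0) :
    ContinuousAt (Tz F H) w := by
  have h := H.continuousAt_resolvent_s12 hw
  exact (continuousAt_const (y := F)).clm_comp
    (h.clm_comp (continuousAt_const (y := ContinuousLinearMap.adjoint F)))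

lemma continuousAt_Tz_vertical (F : 𝓗 →L[ℂ] 𝓚) (H : SelfAdjointOperator 𝓗) (l : ℝ) {y : ℝ}
    (hy : 0 < y) : ContinuousAt (fun y : ℝ => Tz F H ((l : ℂ) + y * Complex.I)) y :=
  ContinuousAt.comp (f := fun y : ℝ => (l : ℂ) + y * Complex.I)
    (continuousAt_Tz_s12 F H (by simpa using hy.ne')) (by fun_prop)

lemma continuous_Tz_horizontal (F : 𝓗 →L[ℂ] 𝓚) (H : SelfAdjointOperator 𝓗) {y : ℝ}
    (hy : 0 < y) : Continuous fun l : ℝ => Tz F H ((l : ℂ) + y * Complex.I) :=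
  continuous_iff_continuousAt.2 fun l =>
    ContinuousAt.comp (f := fun l : ℝ => (l : ℂ) + y * Complex.I)
      (continuousAt_Tz_s12 F H (by simpa using hy.ne')) (by fun_prop)

/-- The rational Cauchy criterion for membership in `Λ(H,F)`. -/
lemma mem_LambdaSet_iff (F : 𝓗 →L[ℂ] 𝓚) (H : SelfAdjointOperator 𝓗) (l : ℝ) :
    l ∈ LambdaSet F H ↔ ∀ n : ℕ, ∃ m : ℕ, ∀ a b : ℚ, 0 < (a : ℝ) → 0 < (b : ℝ) →
      (a : ℝ) < ((m : ℝ) + 1)⁻¹ → (b : ℝ) < ((m : ℝ) + 1)⁻¹ →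
      ‖Tz F H ((l : ℂ) + (a : ℝ) * Complex.I) - Tz F H ((l : ℂ) + (b : ℝ) * Complex.I)‖
        ≤ ((n : ℝ) + 1)⁻¹ := by
  set T : ℝ → (𝓚 →L[ℂ] 𝓚) := fun y => Tz F H ((l : ℂ) + y * Complex.I) with hT
  have hcrit : l ∈ LambdaSet F H ↔ Cauchy (map T (𝓝[>] (0 : ℝ))) :=
    (cauchy_map_iff_exists_tendsto).symm
  rw [hcrit, cauchy_map_iff, Metric.uniformity_basis_dist_le.tendsto_right_iff]
  constructor
  · rintro ⟨-, h⟩ n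
    obtain ⟨δ, hδ, hδ'⟩ := (nhdsGT_basis (0 : ℝ)).prod_self.eventually_iff.1
      (h ((n : ℝ) + 1)⁻¹ (by positivity))
    obtain ⟨m, hm⟩ := exists_nat_one_div_lt hδ
    rw [one_div] at hm
    refine ⟨m, fun a b ha hb ha' hb' => ?_⟩
    have := hδ' (x := ((a : ℝ), (b : ℝ))) ⟨⟨ha, ha'.trans hm⟩, ⟨hb, hb'.trans hm⟩⟩
    exact (dist_eq_norm (T a) (T b)).symm.trans_le this
  · intro h
    refine ⟨inferInstance, fun ε hε => ?_⟩
    obtain ⟨n, hn⟩ := exists_nat_one_div_lt hε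
    rw [one_div] at hn
    obtain ⟨m, hm⟩ := h n
    refine (nhdsGT_basis (0 : ℝ)).prod_self.eventually_iff.2 ⟨((m : ℝ) + 1)⁻¹, by positivity, ?_⟩
    set I : Set ℝ := Ioo 0 ((m : ℝ) + 1)⁻¹ with hI
    have hdense : I ⊆ closure (I ∩ range ((↑) : ℚ → ℝ)) :=
      Rat.denseRange_cast.open_subset_closure_inter isOpen_Ioo
    have hcont : ContinuousOn T I := fun y hy =>
      (continuousAt_Tz_vertical F H l hy.1).continuousWithinAt
    rintro ⟨a, b⟩ ⟨ha, hb⟩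
    refine le_trans ?_ hn.le
    have h1 : ∀ q : ℚ, (q : ℝ) ∈ I → ∀ y ∈ I, ‖T y - T q‖ ≤ ((n : ℝ) + 1)⁻¹ := by
      intro q hq y hy
      have hy' := mem_closure_iff_nhdsWithin_neBot.1 (hdense hy)
      have hlim : Tendsto (fun x => ‖T x - T q‖) (𝓝[I ∩ range ((↑) : ℚ → ℝ)] y)
          (𝓝 ‖T y - T q‖) :=
        (((hcont y hy).mono_left (nhdsWithin_mono _ inter_subset_left)).sub_const _).norm
      refine le_of_tendsto hlim ?_
      filter_upwards [self_mem_nhdsWithin]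
      rintro _ ⟨hx, r, rfl⟩
      exact hm r q hx.1 hq.1 hx.2 hq.2
    have hb' := mem_closure_iff_nhdsWithin_neBot.1 (hdense hb)
    have hlim : Tendsto (fun x => ‖T a - T x‖) (𝓝[I ∩ range ((↑) : ℚ → ℝ)] b)
        (𝓝 ‖T a - T b‖) :=
      (((hcont b hb).mono_left (nhdsWithin_mono _ inter_subset_left)).const_sub _).norm
    rw [dist_eq_norm]
    refine le_of_tendsto hlim ?_
    filter_upwards [self_mem_nhdsWithin]
    rintro _ ⟨hx, r, rfl⟩
    exact h1 r hx a ha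

lemma measurableSet_LambdaSet (F : 𝓗 →L[ℂ] 𝓚) (H : SelfAdjointOperator 𝓗) :
    MeasurableSet (LambdaSet F H) := by
  have h : LambdaSet F H = {l : ℝ | ∀ n : ℕ, ∃ m : ℕ, ∀ a b : ℚ, 0 < (a : ℝ) → 0 < (b : ℝ) →
      (a : ℝ) < ((m : ℝ) + 1)⁻¹ → (b : ℝ) < ((m : ℝ) + 1)⁻¹ →
      ‖Tz F H ((l : ℂ) + (a : ℝ) * Complex.I) - Tz F H ((l : ℂ) + (b : ℝ) * Complex.I)‖
        ≤ ((n : ℝ) + 1)⁻¹} := ext fun l => mem_LambdaSet_iff F H l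
  rw [h]
  simp only [ofPred_forall, ofPred_exists]
  refine MeasurableSet.iInter fun n => MeasurableSet.iUnion fun m => MeasurableSet.iInter fun a =>
    MeasurableSet.iInter fun b => MeasurableSet.iInter fun ha => MeasurableSet.iInter fun hb =>
    MeasurableSet.iInter fun _ => MeasurableSet.iInter fun _ => ?_
  exact (isClosed_le ((continuous_Tz_horizontal F H ha).sub
    (continuous_Tz_horizontal F H hb)).norm continuous_const).measurableSet

lemma tendsto_Tlim (F : 𝓗 →L[ℂ] 𝓚) (H : SelfAdjointOperator 𝓗) {l : ℝ}
    (hl : l ∈ LambdaSet F H) :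
    Tendsto (fun y : ℝ => Tz F H ((l : ℂ) + y * Complex.I)) (𝓝[>] (0 : ℝ)) (𝓝 (Tlim F H l)) :=
  tendsto_nhds_limUnder hl

end Resolvent

section Spectral

lemma ext_of_inner_map_self {V : Type*} [NormedAddCommGroup V] [InnerProductSpace ℂ V]
    {S T : V →L[ℂ] V} (h : ∀ f, ⟪f, S f⟫_ℂ = ⟪f, T f⟫_ℂ) : S = T := by
  have h' : (S : V →ₗ[ℂ] V) = T := (ext_inner_map _ _).1 fun f => by
    rw [← inner_conj_symm, ← inner_conj_symm _ f]
    exact congrArg _ (h f)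
  ext f
  exact DFunLike.congr_fun h' f

namespace SpectralMeasure

variable {H : SelfAdjointOperator 𝓗} (E : SpectralMeasure H)

lemma inner_proj_left (s : Set ℝ) (f g : 𝓗) : ⟪E.proj s f, g⟫_ℂ = ⟪f, E.proj s g⟫_ℂ := by
  rw [← ContinuousLinearMap.adjoint_inner_right, (E.proj_sa s).adjoint_eq]

lemma proj_proj (s t : Set ℝ) (f : 𝓗) : E.proj s (E.proj t f) = E.proj (s ∩ t) f := by
  rw [E.proj_mul]
  rfl

lemma scalar_toReal {s : Set ℝ} (hs : MeasurableSet s) (f : 𝓗) :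
    (E.scalar f s).toReal = ‖E.proj s f‖ ^ 2 := by
  have h : ⟪f, E.proj s f⟫_ℂ = ⟪E.proj s f, E.proj s f⟫_ℂ := by
    rw [E.inner_proj_left, E.proj_proj, inter_self]
  rw [E.scalar_spec f s hs, h, inner_self_eq_norm_sq_to_K]
  simp [← Complex.ofReal_pow]

lemma scalar_eq_enorm_sq {s : Set ℝ} (hs : MeasurableSet s) (f : 𝓗) :
    E.scalar f s = ‖E.proj s f‖ₑ ^ 2 := by
  have := E.scalar_finite f
  rw [← ENNReal.ofReal_toReal (measure_ne_top (E.scalar f) s), E.scalar_toReal hs,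
    ENNReal.ofReal_pow (norm_nonneg _), ofReal_norm]

lemma proj_empty : E.proj ∅ = 0 := by
  ext f
  have h := E.scalar_toReal MeasurableSet.empty f
  simpa using h.symm

lemma proj_add_proj_compl {s : Set ℝ} (hs : MeasurableSet s) (f : 𝓗) :
    E.proj s f + E.proj sᶜ f = f := by
  have := E.scalar_finite
  have key : ∀ g : 𝓗, E.proj s g = 0 → E.proj sᶜ g = 0 → g = 0 := by
    intro g h1 h2
    have h3 : E.scalar g univ = 0 := by
      rw [← measure_add_measure_compl hs, E.scalar_eq_enorm_sq hs, E.scalar_eq_enorm_sq hs.compl,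
        h1, h2]
      simp
    rw [E.scalar_eq_enorm_sq MeasurableSet.univ, E.proj_univ] at h3
    simpa using h3
  refine sub_eq_zero.1 (key _ ?_ ?_) <;>
    simp [map_sub, map_add, E.proj_proj, E.proj_empty]

lemma scalar_proj {s : Set ℝ} (hs : MeasurableSet s) (f : 𝓗) :
    E.scalar (E.proj s f) = (E.scalar f).restrict s := by
  ext t ht
  rw [Measure.restrict_apply ht, E.scalar_eq_enorm_sq ht, E.scalar_eq_enorm_sq (ht.inter hs),
    E.proj_proj]

lemma inner_proj_fc {h : ℝ → ℂ} (hm : Measurable h) (hb : ∃ C, ∀ x, ‖h x‖ ≤ C) {s : Set ℝ}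
    (hs : MeasurableSet s) (f : 𝓗) :
    ⟪E.proj s f, E.fc h f⟫_ℂ = ∫ x in s, h x ∂(E.scalar f) := by
  have hdecomp : E.fc h = E.proj s ∘L E.fc h ∘L E.proj s + E.proj sᶜ ∘L E.fc h ∘L E.proj sᶜ := by
    have := E.scalar_finite
    refine ext_of_inner_map_self fun f => ?_
    have hInt : Integrable h (E.scalar f) := by
      obtain ⟨C, hC⟩ := hb
      exact Integrable.of_bound hm.aestronglyMeasurable C (ae_of_all _ hC)
    simp only [add_apply, ContinuousLinearMap.comp_apply, inner_add_right]
    rw [← E.inner_proj_left, ← E.inner_proj_left, E.fc_spec h hm hb, E.fc_spec h hm hb,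
      E.fc_spec h hm hb, E.scalar_proj hs, E.scalar_proj hs.compl, integral_add_compl hs hInt]
  rw [hdecomp]
  simp only [add_apply, ContinuousLinearMap.comp_apply, inner_add_right]
  rw [E.inner_proj_left, E.inner_proj_left s f (E.proj sᶜ _), E.proj_proj, E.proj_proj, inter_self,
    inter_compl_self, E.proj_empty, ← E.inner_proj_left, E.fc_spec h hm hb, E.scalar_proj hs]
  simp

lemma resolvent_eq_fc {z : ℂ} (hz : z.im ≠ 0) (hm : Measurable fun x : ℝ => ((x : ℂ) - z)⁻¹)
    (hb : ∃ C, ∀ x : ℝ, ‖((x : ℂ) - z)⁻¹‖ ≤ C) :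
    H.resolvent z = E.fc fun x : ℝ => ((x : ℂ) - z)⁻¹ :=
  ext_of_inner_map_self fun f => by rw [E.resolvent_spec z hz, E.fc_spec _ hm hb]

lemma ofReal_im_inner_resolvent (f : 𝓗) (l : ℝ) {y : ℝ} (hy : 0 < y) :
    ENNReal.ofReal (⟪f, H.resolvent ((l : ℂ) + y * Complex.I) f⟫_ℂ).im =
      poisson (E.scalar f) l y := by
  have := E.scalar_finite
  have hne : ∀ x : ℝ, (x : ℂ) - (l + y * Complex.I) ≠ 0 := fun x h0 => by
    have := congrArg Complex.im h0
    simp [hy.ne'] at this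
  have him : ∀ x : ℝ, (((x : ℂ) - (l + y * Complex.I))⁻¹).im = y / ((x - l) ^ 2 + y ^ 2) := by
    intro x
    rw [Complex.inv_im, Complex.normSq_apply]
    simp
    ring
  have hInt : Integrable (fun x : ℝ => ((x : ℂ) - (l + y * Complex.I))⁻¹) (E.scalar f) := by
    refine Integrable.of_bound (C := y⁻¹) ?_ (ae_of_all _ fun x => ?_)
    · exact (Continuous.inv₀ (by fun_prop) hne).aestronglyMeasurable
    · rw [norm_inv]
      gcongr
      refine le_trans ?_ (Complex.abs_im_le_norm _)
      simp [abs_of_pos hy]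
  rw [E.resolvent_spec _ (by simpa using hy.ne'), poisson]
  have h1 := integral_im hInt
  simp only [RCLike.im_to_complex, him] at h1
  rw [← h1, ofReal_integral_eq_lintegral_ofReal]
  · simpa only [RCLike.im_to_complex, him] using hInt.im
  · exact ae_of_all _ fun x => by positivity

end SpectralMeasure

end Spectral

section L2

variable {V : Type*} [NormedAddCommGroup V] {μ : Measure ℝ}

lemma lintegral_enorm_sq_eq (g : Lp V 2 μ) : ∫⁻ l, ‖g l‖ₑ ^ 2 ∂μ = ‖g‖ₑ ^ 2 := by
  have h := eLpNorm_nnreal_pow_eq_lintegral (f := g) (μ := μ) (p := 2) two_ne_zero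
  rw [Lp.enorm_def]
  simpa using h.symm

variable [InnerProductSpace ℂ V]

lemma setLIntegral_enorm_sq_eq (g : Lp V 2 μ) (A : Set ℝ) :
    ∫⁻ l in A, ‖g l‖ₑ ^ 2 ∂μ = ‖LpToLpRestrictCLM ℝ V ℂ μ 2 A g‖ₑ ^ 2 := by
  rw [← lintegral_enorm_sq_eq]
  refine lintegral_congr_ae ?_
  filter_upwards [LpToLpRestrictCLM_coeFn ℂ A g] with l hl
  rw [hl]

lemma memLp_bounded_smul {h : ℝ → ℂ} (hm : Measurable h) (hb : ∃ C, ∀ x, ‖h x‖ ≤ C)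
    (g : Lp V 2 μ) : MemLp (fun l => h l • g l) 2 μ := by
  obtain ⟨C, hC⟩ := hb
  refine (Lp.memLp g).of_le_mul (c := C)
    (hm.aestronglyMeasurable.smul (Lp.aestronglyMeasurable g)) (ae_of_all _ fun l => ?_)
  rw [norm_smul]
  gcongr
  exact hC l

/-- Multiplication by a bounded Borel function on `L²`. -/
def mulBounded (μ : Measure ℝ) (h : ℝ → ℂ) (hm : Measurable h) (hb : ∃ C, ∀ x, ‖h x‖ ≤ C) :
    Lp V 2 μ →ₗ[ℂ] Lp V 2 μ :=
  have hmem := memLp_bounded_smul (V := V) (μ := μ) hm hb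
  { toFun := fun g => (hmem g).toLp _
    map_add' := fun f g => by
      refine Lp.ext ?_
      filter_upwards [(hmem (f + g)).coeFn_toLp, (hmem f).coeFn_toLp, (hmem g).coeFn_toLp,
        Lp.coeFn_add f g, Lp.coeFn_add ((hmem f).toLp _) ((hmem g).toLp _)] with l h1 h2 h3 h4 h5
      rw [h1, h5, Pi.add_apply, h2, h3, h4, Pi.add_apply, smul_add]
    map_smul' := fun c f => by
      refine Lp.ext ?_
      filter_upwards [(hmem (c • f)).coeFn_toLp, (hmem f).coeFn_toLp,
        Lp.coeFn_smul c f, Lp.coeFn_smul c ((hmem f).toLp _)] with l h1 h2 h3 h4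
      rw [RingHom.id_apply, h1, h4, Pi.smul_apply, h2, h3, Pi.smul_apply, smul_comm] }

lemma coeFn_mulBounded (h : ℝ → ℂ) (hm : Measurable h) (hb : ∃ C, ∀ x, ‖h x‖ ≤ C)
    (g : Lp V 2 μ) : mulBounded μ h hm hb g =ᵐ[μ] fun l => h l • g l :=
  (memLp_bounded_smul hm hb g).coeFn_toLp

/-- The decomposable subspace of `L²` determined by a field of closed subspaces is closed. -/
lemma ae_mem_of_mem_closure (S : ℝ → Submodule ℂ V) (hS : ∀ l, IsClosed (S l : Set V))
    {g : Lp V 2 μ} (hg : g ∈ closure {u : Lp V 2 μ | ∀ᵐ l ∂μ, u l ∈ S l}) :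
    ∀ᵐ l ∂μ, g l ∈ S l := by
  obtain ⟨u, hu, hug⟩ := mem_closure_iff_seq_limit.1 hg
  obtain ⟨ns, -, hns⟩ := (tendstoInMeasure_of_tendsto_Lp hug).exists_seq_tendsto_ae
  filter_upwards [hns, ae_all_iff.2 hu] with l h1 h2
  exact (hS l).mem_of_tendsto h1 (Eventually.of_forall fun n => h2 (ns n))

end L2

section Intertwining

variable {V : Type*} [NormedAddCommGroup V] [InnerProductSpace ℂ V]
  {H : SelfAdjointOperator 𝓗} (E : SpectralMeasure H) {L : Set ℝ}
  {U : 𝓗 →L[ℂ] Lp V 2 ((volume : Measure ℝ).restrict L)}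

/-- The operator `U` represents the spectral measure `E` on `L` by its densities. -/
def IsSpectralRepresentation
    (U : 𝓗 →L[ℂ] Lp V 2 ((volume : Measure ℝ).restrict L)) : Prop :=
  ∀ f A, MeasurableSet A →
    ∫⁻ l in A, ‖U f l‖ₑ ^ 2 ∂((volume : Measure ℝ).restrict L) = E.scalar f (A ∩ L)

lemma isSpectralRepresentation_of_dense (hL : MeasurableSet L) {D : Set 𝓗} (hD : Dense D)
    (h : ∀ f ∈ D, ∀ A, MeasurableSet A →
      ∫⁻ l in A, ‖U f l‖ₑ ^ 2 ∂((volume : Measure ℝ).restrict L) = E.scalar f (A ∩ L)) :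
    IsSpectralRepresentation E U := by
  intro f A hA
  rw [setLIntegral_enorm_sq_eq, E.scalar_eq_enorm_sq (hA.inter hL)]
  have hcont1 : Continuous fun f =>
      ‖LpToLpRestrictCLM ℝ V ℂ ((volume : Measure ℝ).restrict L) 2 A (U f)‖ₑ ^ 2 := by
    refine (ENNReal.continuous_pow 2).comp (Continuous.enorm ?_)
    exact (ContinuousLinearMap.continuous _).comp U.continuous
  have hcont2 : Continuous fun f => ‖E.proj (A ∩ L) f‖ₑ ^ 2 :=
    (ENNReal.continuous_pow 2).comp (E.proj (A ∩ L)).continuous.enorm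
  refine congrFun (Continuous.ext_on hD hcont1 hcont2 fun g hg => ?_) f
  rw [← setLIntegral_enorm_sq_eq, h g hg A hA, E.scalar_eq_enorm_sq (hA.inter hL)]

namespace IsSpectralRepresentation

variable {E}

lemma norm_apply (hU : IsSpectralRepresentation E U) (hL : MeasurableSet L) (f : 𝓗) :
    ‖U f‖ = ‖E.proj L f‖ := by
  have h := hU f univ MeasurableSet.univ
  rw [Measure.restrict_univ, lintegral_enorm_sq_eq, univ_inter, E.scalar_eq_enorm_sq hL] at h
  have h' : ‖U f‖ₑ = ‖E.proj L f‖ₑ := (ENNReal.pow_right_strictMono two_ne_zero).injective h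
  rw [← toReal_enorm, h', toReal_enorm]

lemma apply_proj_ae_eq_zero (hU : IsSpectralRepresentation E U) {A : Set ℝ}
    (hA : MeasurableSet A) (f : 𝓗) :
    ∀ᵐ l ∂((volume : Measure ℝ).restrict L), l ∈ A → U (E.proj Aᶜ f) l = 0 := by
  have h := hU (E.proj Aᶜ f) A hA
  rw [E.scalar_proj hA.compl, Measure.restrict_apply' hA.compl,
    (by ext; simp; tauto : A ∩ L ∩ Aᶜ = ∅), measure_empty, lintegral_eq_zero_iff'] at h
  · filter_upwards [(ae_restrict_iff' hA).1 h] with l hl hlA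
    simpa using hl hlA
  · exact ((Lp.stronglyMeasurable _).enorm.pow_const 2).aemeasurable

lemma apply_proj (hU : IsSpectralRepresentation E U) {A : Set ℝ} (hA : MeasurableSet A) (f : 𝓗) :
    U (E.proj A f) =ᵐ[(volume : Measure ℝ).restrict L] A.indicator (U f) := by
  have h2 := hU.apply_proj_ae_eq_zero hA.compl f
  rw [compl_compl] at h2
  have h3 : U f = U (E.proj A f) + U (E.proj Aᶜ f) := by
    rw [← map_add, E.proj_add_proj_compl hA]
  filter_upwards [hU.apply_proj_ae_eq_zero hA f, h2,
    Lp.coeFn_add (U (E.proj A f)) (U (E.proj Aᶜ f))] with l h4 h5 h6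
  by_cases hl : l ∈ A
  · rw [indicator_of_mem hl, h3, h6, Pi.add_apply, h4 hl, add_zero]
  · rw [indicator_of_notMem hl, h5 hl]

lemma isClosed_range (hU : IsSpectralRepresentation E U) (hL : MeasurableSet L) :
    IsClosed (range U) := by
  have hP : ∀ f, E.proj L (E.proj L f) = E.proj L f := fun f => by rw [E.proj_proj, inter_self]
  set K : Submodule ℂ 𝓗 := ((1 : 𝓗 →L[ℂ] 𝓗) - E.proj L).ker with hK
  have hmem : ∀ f, f ∈ K ↔ E.proj L f = f := fun f => by
    rw [hK, LinearMap.mem_ker]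
    change f - E.proj L f = 0 ↔ _
    rw [sub_eq_zero, eq_comm]
  have hKc : IsClosed (K : Set 𝓗) := ContinuousLinearMap.isClosed_ker _
  have : CompleteSpace K := hKc.completeSpace_coe
  have hiso : Isometry (U ∘L K.subtypeL) :=
    AddMonoidHomClass.isometry_of_norm _ fun f => by
      rw [ContinuousLinearMap.comp_apply, hU.norm_apply hL, Submodule.subtypeL_apply,
        (hmem f).1 f.2, Submodule.coe_norm]
  have hrange : range U = range (U ∘L K.subtypeL) := by
    refine Subset.antisymm ?_ (by rintro _ ⟨f, rfl⟩; exact ⟨f, rfl⟩)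
    rintro _ ⟨f, rfl⟩
    refine ⟨⟨E.proj L f, (hmem _).2 (hP f)⟩, ?_⟩
    change U (E.proj L f) = U f
    rw [← sub_eq_zero, ← map_sub, ← norm_eq_zero, hU.norm_apply hL, map_sub, hP, sub_self,
      norm_zero]
  rw [hrange]
  exact hiso.isClosedEmbedding.isClosed_range

lemma restrict_scalar_eq (hU : IsSpectralRepresentation E U) (f : 𝓗) (hL : MeasurableSet L) :
    (E.scalar f).restrict L =
      ((volume : Measure ℝ).restrict L).withDensity fun l => ((‖U f l‖₊ ^ 2 : NNReal) : ℝ≥0∞) := by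
  ext A hA
  rw [Measure.restrict_apply' hL, withDensity_apply _ hA, ← hU f A hA]
  simp [enorm_eq_nnnorm]

variable [CompleteSpace V]

lemma inner_apply_apply (hU : IsSpectralRepresentation E U) (hL : MeasurableSet L) (f g : 𝓗) :
    ⟪U f, U g⟫_ℂ = ⟪E.proj L f, g⟫_ℂ := by
  have h : ContinuousLinearMap.adjoint U ∘L U = E.proj L := by
    refine ext_of_inner_map_self fun f => ?_
    rw [ContinuousLinearMap.comp_apply, ContinuousLinearMap.adjoint_inner_right,
      inner_self_eq_norm_sq_to_K, hU.norm_apply hL, ← inner_self_eq_norm_sq_to_K (𝕜 := ℂ),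
      E.inner_proj_left, E.proj_proj, inter_self]
  rw [← ContinuousLinearMap.adjoint_inner_right, E.inner_proj_left, ← h]
  rfl

lemma inner_apply_mulBounded (hU : IsSpectralRepresentation E U) (hL : MeasurableSet L)
    {h : ℝ → ℂ} (hm : Measurable h) (hb : ∃ C, ∀ x, ‖h x‖ ≤ C) (f : 𝓗) :
    ⟪U f, mulBounded _ h hm hb (U f)⟫_ℂ = ⟪U f, U (E.fc h f)⟫_ℂ := by
  have hmeas : Measurable fun l => ‖U f l‖₊ ^ 2 :=
    (Lp.stronglyMeasurable (U f)).nnnorm.measurable.pow_const 2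
  rw [hU.inner_apply_apply hL, E.inner_proj_fc hm hb hL, hU.restrict_scalar_eq f hL,
    integral_withDensity_eq_integral_smul hmeas, L2.inner_def]
  refine integral_congr_ae ?_
  filter_upwards [coeFn_mulBounded h hm hb (U f)] with l hl
  rw [hl, inner_smul_right, inner_self_eq_norm_sq_to_K, NNReal.smul_def, Complex.real_smul,
    mul_comm]
  simp

/-- If the range of `U` is invariant under multiplication by `h`, then `U` intertwines `h(H)`
with this multiplication. -/
lemma apply_fc (hU : IsSpectralRepresentation E U) (hL : MeasurableSet L)
    {h : ℝ → ℂ} (hm : Measurable h) (hb : ∃ C, ∀ x, ‖h x‖ ≤ C)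
    (hran : ∀ f, mulBounded _ h hm hb (U f) ∈ range U) (f : 𝓗) :
    U (E.fc h f) = mulBounded _ h hm hb (U f) := by
  set D : 𝓗 →ₗ[ℂ] Lp V 2 ((volume : Measure ℝ).restrict L) :=
    (U ∘L E.fc h : 𝓗 →ₗ[ℂ] _) - mulBounded _ h hm hb ∘ₗ (U : 𝓗 →ₗ[ℂ] _) with hD
  have hDapp : ∀ f, D f = U (E.fc h f) - mulBounded _ h hm hb (U f) := fun _ => rfl
  have h0 : (ContinuousLinearMap.adjoint U : _ →ₗ[ℂ] 𝓗) ∘ₗ D = 0 := by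
    rw [← inner_map_self_eq_zero]
    intro f
    change ⟪ContinuousLinearMap.adjoint U (D f), f⟫_ℂ = 0
    rw [ContinuousLinearMap.adjoint_inner_left, ← inner_conj_symm, hDapp, inner_sub_right,
      hU.inner_apply_mulBounded hL hm hb, sub_self, map_zero]
  obtain ⟨w, hw⟩ := hran f
  have h1 : D f = U (E.fc h f - w) := by rw [hDapp, map_sub, hw]
  have h2 : ⟪D f, D f⟫_ℂ = 0 := by
    nth_rewrite 2 [h1]
    rw [← ContinuousLinearMap.adjoint_inner_left]
    have := DFunLike.congr_fun h0 f
    change ContinuousLinearMap.adjoint U (D f) = 0 at this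
    rw [this, inner_zero_left]
  rw [← sub_eq_zero, ← hDapp]
  exact inner_self_eq_zero.1 h2

end IsSpectralRepresentation

end Intertwining

section Evaluation

variable {H : SelfAdjointOperator 𝓗} {F : 𝓗 →L[ℂ] 𝓚}

lemma denseRange_adjoint (hF : Function.Injective F) :
    DenseRange (ContinuousLinearMap.adjoint F) := by
  have h : (LinearMap.range
      (ContinuousLinearMap.adjoint F : 𝓚 →ₗ[ℂ] 𝓗)).topologicalClosure = ⊤ := by
    rw [Submodule.topologicalClosure_eq_top_iff, Submodule.eq_bot_iff]
    intro f hf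
    apply hF
    rw [map_zero]
    refine ext_inner_left ℂ fun φ => ?_
    rw [inner_zero_right, ← ContinuousLinearMap.adjoint_inner_left]
    exact (Submodule.mem_orthogonal _ f).1 hf _ (LinearMap.mem_range_self _ φ)
  intro f
  have hf : f ∈ (LinearMap.range
    (ContinuousLinearMap.adjoint F : 𝓚 →ₗ[ℂ] 𝓗)).topologicalClosure := h ▸ Submodule.mem_top
  rwa [← SetLike.mem_coe, Submodule.topologicalClosure_coe, LinearMap.coe_range] at hf

lemma inner_imOp_self (T : 𝓚 →L[ℂ] 𝓚) (φ : 𝓚) : ⟪φ, imOp T φ⟫_ℂ = (⟪φ, T φ⟫_ℂ).im := by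
  rw [imOp, smul_apply, sub_apply, inner_smul_right,
    inner_sub_right, ContinuousLinearMap.adjoint_inner_right, ← inner_conj_symm (T φ) φ,
    Complex.sub_conj]
  push_cast
  field_simp

lemma IsSqrtImT.norm_sq {l : ℝ} {q : 𝓚 →L[ℂ] 𝓚} (hq : IsSqrtImT F H l q) (φ : 𝓚) :
    ‖q φ‖ ^ 2 = (⟪φ, Tlim F H l φ⟫_ℂ).im := by
  have h : ((‖q φ‖ ^ 2 : ℝ) : ℂ) = ((⟪φ, Tlim F H l φ⟫_ℂ).im : ℝ) := by
    rw [← inner_imOp_self, ← hq.2.2, ContinuousLinearMap.comp_apply,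
      ← ContinuousLinearMap.adjoint_inner_left, ← ContinuousLinearMap.star_eq_adjoint,
      hq.1.star_eq, inner_self_eq_norm_sq_to_K]
    simp
  exact_mod_cast h

lemma tendsto_poisson_scalar_adjoint (E : SpectralMeasure H) {l : ℝ} (hl : l ∈ LambdaSet F H) (φ : 𝓚) :
    Tendsto (poisson (E.scalar (ContinuousLinearMap.adjoint F φ)) l) (𝓝[>] 0)
      (𝓝 (ENNReal.ofReal (⟪φ, Tlim F H l φ⟫_ℂ).im)) := by
  have hc : Continuous fun T : 𝓚 →L[ℂ] 𝓚 => ENNReal.ofReal (⟪φ, T φ⟫_ℂ).im :=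
    ENNReal.continuous_ofReal.comp (by fun_prop)
  refine ((hc.tendsto _).comp (tendsto_Tlim F H hl)).congr' ?_
  filter_upwards [self_mem_nhdsWithin] with y hy
  rw [← E.ofReal_im_inner_resolvent _ _ hy, ContinuousLinearMap.adjoint_inner_left]
  rfl

variable {Q : ℝ → (𝓚 →L[ℂ] 𝓚)}
  {U : 𝓗 →L[ℂ] Lp 𝓚 2 ((volume : Measure ℝ).restrict (LambdaSet F H))}

lemma isSpectralRepresentation_evaluation (E : SpectralMeasure H) (hF : Function.Injective F)
    (hQ : ∀ l ∈ LambdaSet F H, IsSqrtImT F H l (Q l))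
    (hU : ∀ φ, ∀ᵐ l ∂(volume : Measure ℝ).restrict (LambdaSet F H),
      U (ContinuousLinearMap.adjoint F φ) l = ((Real.sqrt π : ℂ))⁻¹ • Q l φ) :
    IsSpectralRepresentation E U := by
  have hL := measurableSet_LambdaSet F H
  refine isSpectralRepresentation_of_dense E hL (denseRange_adjoint hF) ?_
  rintro _ ⟨φ, rfl⟩ A hA
  have := E.scalar_finite (ContinuousLinearMap.adjoint F φ)
  rw [measure_eq_setLIntegral_of_tendsto_poisson _ (hA.inter hL)
    (fun l => ENNReal.ofReal (⟪φ, Tlim F H l φ⟫_ℂ).im) (fun _ _ => ENNReal.ofReal_ne_top)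
    (fun l hl => tendsto_poisson_scalar_adjoint E hl.2 φ), ← Measure.restrict_restrict hA]
  refine lintegral_congr_ae (ae_restrict_of_ae ?_)
  filter_upwards [hU φ, ae_restrict_mem hL] with l hl hlL
  rw [hl, ← (hQ l hlL).norm_sq, ← ENNReal.ofReal_inv_of_pos Real.pi_pos,
    ← ENNReal.ofReal_mul (by positivity), ← ofReal_norm,
    ← ENNReal.ofReal_pow (norm_nonneg _), norm_smul, mul_pow, norm_inv, inv_pow,
    Complex.norm_real, Real.norm_eq_abs, sq_abs, Real.sq_sqrt Real.pi_pos.le]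

/-- The decomposable subspace with fibres `𝔥_l(H)` is the range of the evaluation operator. -/
lemma range_evaluation [TopologicalSpace.SeparableSpace 𝓗] (E : SpectralMeasure H)
    (hF : IsRigging F)
    (hQ : ∀ l ∈ LambdaSet F H, IsSqrtImT F H l (Q l))
    (hU : ∀ φ, ∀ᵐ l ∂(volume : Measure ℝ).restrict (LambdaSet F H),
      U (ContinuousLinearMap.adjoint F φ) l = ((Real.sqrt π : ℂ))⁻¹ • Q l φ) :
    range U = {g | ∀ᵐ l ∂(volume : Measure ℝ).restrict (LambdaSet F H), g l ∈ fibSpace (Q l)} := by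
  have hL := measurableSet_LambdaSet F H
  have hrep := isSpectralRepresentation_evaluation E hF.1 hQ hU
  have hsub : ∀ f, ∀ᵐ l ∂(volume : Measure ℝ).restrict (LambdaSet F H),
      U f l ∈ fibSpace (Q l) := by
    intro f
    refine ae_mem_of_mem_closure (fun l => fibSpace (Q l))
      (fun l => Submodule.isClosed_topologicalClosure _) ?_
    refine map_mem_closure U.continuous (denseRange_adjoint hF.1 f) ?_
    rintro _ ⟨φ, rfl⟩
    filter_upwards [hU φ] with l hl
    rw [hl]
    exact Submodule.smul_mem _ _ (toFib (Q l) φ).2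
  refine Subset.antisymm (by rintro _ ⟨f, rfl⟩; exact hsub f) fun g hg => ?_
  set K := LinearMap.range
    (U : 𝓗 →ₗ[ℂ] Lp 𝓚 2 ((volume : Measure ℝ).restrict (LambdaSet F H))) with hK
  have hKc : IsClosed (K : Set (Lp 𝓚 2 ((volume : Measure ℝ).restrict (LambdaSet F H)))) :=
    hrep.isClosed_range hL
  have : CompleteSpace K := hKc.completeSpace_coe
  obtain ⟨_, ⟨f, rfl⟩, q, hq, hgq⟩ := K.exists_add_mem_mem_orthogonal g
  suffices hq0 : q = 0 from ⟨f, by rw [hgq, hq0, add_zero]; rfl⟩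
  have hqfib : ∀ᵐ l ∂(volume : Measure ℝ).restrict (LambdaSet F H), q l ∈ fibSpace (Q l) := by
    have hq' : q = g - U f := by rw [hgq]; exact (add_sub_cancel_left _ _).symm
    filter_upwards [hg, hsub f, Lp.coeFn_sub g (U f)] with l h1 h2 h3
    rw [hq', h3]
    exact Submodule.sub_mem _ h1 h2
  have horth : ∀ φ : 𝓚, ∀ᵐ l ∂(volume : Measure ℝ).restrict (LambdaSet F H),
      ⟪Q l φ, q l⟫_ℂ = 0 := by
    intro φ
    set u := U (ContinuousLinearMap.adjoint F φ) with hu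
    have hzero := (L2.integrable_inner (𝕜 := ℂ) u q).ae_eq_zero_of_forall_setIntegral_eq_zero
      fun A hA _ => by
        rw [← integral_indicator hA]
        have h1 := (Submodule.mem_orthogonal _ q).1 hq _
          (LinearMap.mem_range_self _ (E.proj A (ContinuousLinearMap.adjoint F φ)))
        rw [← h1, L2.inner_def]
        refine integral_congr_ae ?_
        filter_upwards [hrep.apply_proj hA (ContinuousLinearMap.adjoint F φ)] with l hl
        change _ = ⟪U (E.proj A _) l, q l⟫_ℂ
        rw [hl]
        by_cases hlA : l ∈ A
        · rw [indicator_of_mem hlA, indicator_of_mem hlA]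
        · rw [indicator_of_notMem hlA, indicator_of_notMem hlA, inner_zero_left]
    filter_upwards [hzero, hU φ] with l h1 h2
    have hpi : (Real.sqrt π : ℂ) ≠ 0 := by
      exact_mod_cast (Real.sqrt_pos.2 Real.pi_pos).ne'
    rw [h2, inner_smul_left, Pi.zero_apply] at h1
    exact (mul_eq_zero.1 h1).resolve_left (by simpa using hpi)
  have : TopologicalSpace.SeparableSpace 𝓚 := DenseRange.separableSpace hF.2 F.continuous
  refine Lp.eq_zero_iff_ae_eq_zero.2 ?_
  filter_upwards [hqfib, ae_all_iff.2 fun n => horth (TopologicalSpace.denseSeq 𝓚 n)]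
    with l h1 h2
  have h3 : ∀ φ, ⟪Q l φ, q l⟫_ℂ = 0 := by
    refine fun φ => congrFun (Continuous.ext_on (TopologicalSpace.denseRange_denseSeq 𝓚)
      (by fun_prop : Continuous fun φ => ⟪Q l φ, q l⟫_ℂ) continuous_const ?_) φ
    rintro _ ⟨n, rfl⟩
    exact h2 n
  have h4 : q l ∈ (fibSpace (Q l))ᗮ := by
    rw [fibSpace, Submodule.orthogonal_closure, Submodule.mem_orthogonal]
    rintro _ ⟨φ, rfl⟩
    exact h3 φ
  exact inner_self_eq_zero.1 ((Submodule.mem_orthogonal _ _).1 h4 _ h1)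

lemma apply_op_of_apply_fc (E : SpectralMeasure H) {V : Type*} [NormedAddCommGroup V]
    [InnerProductSpace ℂ V] {L : Set ℝ} {U : 𝓗 →L[ℂ] Lp V 2 ((volume : Measure ℝ).restrict L)}
    (h : ∀ h : ℝ → ℂ, Measurable h → (∃ C, ∀ x, ‖h x‖ ≤ C) → ∀ f,
      U (E.fc h f) =ᵐ[(volume : Measure ℝ).restrict L] fun l => h l • U f l) (f : H.domain) :
    U (H.op f) =ᵐ[(volume : Measure ℝ).restrict L] fun l => (l : ℂ) • U f l := by
  have him : ∀ x : ℝ, ((x : ℂ) - Complex.I).im = -1 := fun x => by simp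
  have hne : ∀ x : ℝ, (x : ℂ) - Complex.I ≠ 0 := fun x h0 => by
    have := him x
    rw [h0] at this
    norm_num at this
  have hm : Measurable fun x : ℝ => ((x : ℂ) - Complex.I)⁻¹ := by fun_prop
  have hb : ∃ C, ∀ x : ℝ, ‖((x : ℂ) - Complex.I)⁻¹‖ ≤ C := ⟨1, fun x => by
    rw [norm_inv]
    refine inv_le_one_of_one_le₀ ?_
    have := Complex.abs_im_le_norm ((x : ℂ) - Complex.I)
    rwa [him, abs_neg, abs_one] at this⟩
  have hf := H.resolvent_left Complex.I (by simp) f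
  rw [E.resolvent_eq_fc (by simp) hm hb] at hf
  have h1 := h _ hm hb (H.op f - Complex.I • (f : 𝓗))
  rw [hf, map_sub, map_smul] at h1
  filter_upwards [h1, Lp.coeFn_sub (U (H.op f)) (Complex.I • U f),
    Lp.coeFn_smul Complex.I (U (f : 𝓗))] with l h2 h3 h4
  rw [h3, Pi.sub_apply, h4, Pi.smul_apply] at h2
  have h5 := congrArg (fun v => ((l : ℂ) - Complex.I) • v) h2
  simp only [smul_inv_smul₀ (hne l), sub_smul] at h5
  exact (sub_left_inj.1 h5).symm

end Evaluation

/-- The evaluation operator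
`𝔈(H) : 𝓗 → ℌ(H) ⊆ L²(Λ(H,F), 𝒦)`, defined on `ran F*` by
`(𝔈(H)f)(l) = √(π⁻¹ Im T_{l+i0}(H))(F*)⁻¹ f` and extended by continuity, is a partial
isometry with initial space `E(Λ(H,F))𝓗` and final space `ℌ(H) = ∫^⊕ 𝔥_l(H) dl`,
and it diagonalises `E(Λ(H,F))H`. -/
theorem evaluation_operator_diagonalises
    (𝓗 𝓚 : Type) [NormedAddCommGroup 𝓗] [InnerProductSpace ℂ 𝓗] [CompleteSpace 𝓗]
    [TopologicalSpace.SeparableSpace 𝓗]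
    [NormedAddCommGroup 𝓚] [InnerProductSpace ℂ 𝓚] [CompleteSpace 𝓚]
    (H : SelfAdjointOperator 𝓗) (E : SpectralMeasure H)
    (F : 𝓗 →L[ℂ] 𝓚) (hF : IsRigging F)
    -- `Q l` is the positive square root of `Im T_{l+i0}(H)`, for `l ∈ Λ(H,F)`
    (Q : ℝ → (𝓚 →L[ℂ] 𝓚)) (hQ : ∀ l ∈ LambdaSet F H, IsSqrtImT F H l (Q l))
    -- `EE` is the operator `𝔈(H)`, i.e. the bounded extension of
    -- `F*φ ↦ (l ↦ √(π⁻¹ Im T_{l+i0}(H)) φ)`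
    (EE : 𝓗 →L[ℂ] (MeasureTheory.Lp 𝓚 2
      (MeasureTheory.volume.restrict (LambdaSet F H))))
    (hEE : ∀ φ : 𝓚,
      ∀ᵐ l : ℝ ∂(MeasureTheory.volume.restrict (LambdaSet F H)),
        lpApply (EE (ContinuousLinearMap.adjoint F φ)) l
          = ((Real.sqrt π : ℂ))⁻¹ • Q l φ) :
    -- `𝔈(H)` is a partial isometry with initial space `E(Λ(H,F))𝓗`
    (∀ f : 𝓗, ‖EE f‖ = ‖E.proj (LambdaSet F H) f‖) ∧
    -- and final space `ℌ(H) = ∫^⊕_{Λ(H,F)} 𝔥_l(H) dl`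
    (Set.range EE = {g : MeasureTheory.Lp 𝓚 2
        (MeasureTheory.volume.restrict (LambdaSet F H)) |
      ∀ᵐ l : ℝ ∂(MeasureTheory.volume.restrict (LambdaSet F H)),
        lpApply g l ∈ fibSpace (Q l)}) ∧
    -- `𝔈(H)` diagonalises `E(Λ(H,F)) H`
    (∀ f : 𝓗, ∀ hf : f ∈ H.domain,
      ∀ᵐ l : ℝ ∂(MeasureTheory.volume.restrict (LambdaSet F H)),
        lpApply (EE (H.op ⟨f, hf⟩)) l = (l : ℂ) • lpApply (EE f) l) ∧
    -- and, for a bounded Borel `h` whose minimal support lies in `Λ(H,F)`,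
    -- it diagonalises `h(H)`
    (∀ h : ℝ → ℂ, Measurable h → (∃ C, ∀ x, ‖h x‖ ≤ C) →
      (∀ᵐ l : ℝ, l ∉ LambdaSet F H → h l = 0) →
      ∀ f : 𝓗,
        ∀ᵐ l : ℝ ∂(MeasureTheory.volume.restrict (LambdaSet F H)),
          lpApply (EE (E.fc h f)) l = h l • lpApply (EE f) l) := by
  have hL := measurableSet_LambdaSet F H
  have hrep := isSpectralRepresentation_evaluation E hF.1 hQ hEE
  have hran := range_evaluation E hF hQ hEE
  have hfc : ∀ h : ℝ → ℂ, Measurable h → (∃ C, ∀ x, ‖h x‖ ≤ C) → ∀ f,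
      EE (E.fc h f) =ᵐ[volume.restrict (LambdaSet F H)] fun l => h l • EE f l := by
    intro h hm hb f
    rw [hrep.apply_fc hL hm hb (fun f => ?_) f]
    · exact coeFn_mulBounded h hm hb _
    · have hf : EE f ∈ range EE := mem_range_self f
      rw [hran] at hf ⊢
      filter_upwards [hf, coeFn_mulBounded h hm hb (EE f)] with l h1 h2
      rw [h2]
      exact Submodule.smul_mem _ _ h1
  exact ⟨hrep.norm_apply hL, hran,
    fun f hf => apply_op_of_apply_fc E hfc ⟨f, hf⟩,
    fun h hm hb _ f => hfc h hm hb f⟩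

end SSF
end
end
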